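/- Let F be a VSI Maxwell p-form field (type N with multiple null direction ℓ, £_ℓ F = 0, solving dF = 0 = d*F) on a Kundt spacetime whose Weyl tensor and traceless Ricci tensor are of aligned type III with respect to ℓ and whose Ricci scalar R satisfies DR = 0 = δ_i R (derivatives along an affinely parameterized ℓ and along the spatial frame vectors of a parallelly transported frame). Then F is universal: it simultaneously solves the field equations dF = 0, *d*F̃ = 0 of any generalized electrodynamics, where F̃ is an arbitrary p-form constructed from F and its covariant derivatives of arbitrary order. -/

import Mathlib

open scoped BigOperators

noncomputable section

namespace VSI

/-! ### Basic setup: tensor fields on an `n`-dimensional coordinate chart -/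

/-- A point of an `n`-dimensional coordinate chart. -/
abbrev Pt (n : ℕ) := Fin n → ℝ

/-- A covariant tensor field of rank `k`, given by its components. -/
abbrev TensorField (n k : ℕ) := Pt n → (Fin k → Fin n) → ℝ

/-- A vector field, given by its components. -/
abbrev VecField (n : ℕ) := Pt n → Fin n → ℝ

/-- A field of `n × n` matrices (e.g. a metric). -/
abbrev MetricField (n : ℕ) := Pt n → Matrix (Fin n) (Fin n) ℝ

/-- Partial derivative of a scalar function along the `a`-th coordinate. -/
def pd {n : ℕ} (f : Pt n → ℝ) (a : Fin n) (x : Pt n) : ℝ :=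
  fderiv ℝ f x (Pi.single a 1)

/-- Partial derivative masked to the transverse directions (coordinates `≥ 2`). -/
def pdT {n : ℕ} (f : Pt n → ℝ) (a : Fin n) (x : Pt n) : ℝ :=
  if 2 ≤ (a : ℕ) then pd f a x else 0

/-- A function on the chart is independent of the coordinate `r` (coordinate number 1). -/
def IndepOfR {n : ℕ} {α : Type*} (f : Pt n → α) : Prop :=
  ∀ x x' : Pt n, (∀ i : Fin n, (i : ℕ) ≠ 1 → x i = x' i) → f x = f x'

/-- A smooth symmetric metric of Lorentzian signature `(-,+,…,+)`. -/
def IsLorentzMetric {n : ℕ} (g : MetricField n) : Prop :=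
  (∀ a b, ContDiff ℝ (⊤ : ℕ∞) fun x => g x a b) ∧ (∀ x, (g x).IsSymm) ∧
  (∀ x, ∃ P : Matrix (Fin n) (Fin n) ℝ, IsUnit P.det ∧
    P.transpose * g x * P = Matrix.diagonal fun i : Fin n => if (i : ℕ) = 0 then (-1 : ℝ) else 1)

/-- Metric pairing of two vectors at a point. -/
def gdot {n : ℕ} (g : MetricField n) (x : Pt n) (X Y : Fin n → ℝ) : ℝ :=
  ∑ a, ∑ b, g x a b * X a * Y b

/-- Index lowering of a vector field. -/
def lower {n : ℕ} (g : MetricField n) (ℓ : VecField n) (x : Pt n) (a : Fin n) : ℝ :=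
  ∑ b, g x a b * ℓ x b

/-- The 1-form (rank-1 covariant tensor field) associated with a vector field. -/
def lowerField {n : ℕ} (g : MetricField n) (ℓ : VecField n) : TensorField n 1 :=
  fun x idx => lower g ℓ x (idx 0)

/-- Christoffel symbols `Γ^a_{bc}` of the Levi-Civita connection of `g`. -/
def christoffel {n : ℕ} (g : MetricField n) (x : Pt n) (a b c : Fin n) : ℝ :=
  (1/2) * ∑ d, (g x)⁻¹ a d *
    (pd (fun y => g y d c) b x + pd (fun y => g y b d) c x - pd (fun y => g y b c) d x)

/-- Covariant derivative of a covariant tensor field; the new (derivative) index is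
the first index of the result. -/
def covD {n k : ℕ} (g : MetricField n) (T : TensorField n k) : TensorField n (k+1) :=
  fun x idx =>
    pd (fun y => T y fun m => idx m.succ) (idx 0) x
    - ∑ m : Fin k, ∑ e : Fin n,
        christoffel g x e (idx 0) (idx m.succ) * T x (Function.update (fun m' => idx m'.succ) m e)

/-- Iterated covariant derivative. -/
def covDIter {n k : ℕ} (g : MetricField n) (T : TensorField n k) : (I : ℕ) → TensorField n (k + I)
  | 0 => T
  | I + 1 => covD g (covDIter g T I)

/-! ### Scalar polynomial invariants and tensor concomitants -/

/-- A scheme describing a polynomial concomitant of a rank-`k` tensor field: a full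
metric contraction of a tensor product of covariant derivatives (of orders `ord j`)
of the field, with `r` free indices left over.  `m` is the number of contracted
index pairs; `slots` enumerates all index slots of the tensor product. -/
structure ConcomScheme (k r : ℕ) where
  N : ℕ
  hN : 0 < N
  ord : Fin N → ℕ
  m : ℕ
  slots : ((Fin m × Bool) ⊕ Fin r) ≃ (Σ j : Fin N, Fin (k + ord j))

/-- The value of a concomitant scheme: all contracted index pairs are contracted with
the inverse metric. -/
def ConcomScheme.value {k r : ℕ} (S : ConcomScheme k r) {n : ℕ} (g : MetricField n)
    (T : TensorField n k) : TensorField n r := fun x free =>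
  ∑ φ : Fin S.m × Bool → Fin n,
    (∏ i : Fin S.m, (g x)⁻¹ (φ (i, false)) (φ (i, true))) *
    ∏ j : Fin S.N, covDIter g T (S.ord j) x
      (fun s => Sum.elim φ free (S.slots.symm ⟨j, s⟩))

/-- All scalar polynomial invariants constructed from `T` and its covariant
derivatives up to order `I` vanish. -/
def IsVSIUpTo {n k : ℕ} (g : MetricField n) (T : TensorField n k) (I : ℕ) : Prop :=
  ∀ S : ConcomScheme k 0, (∀ j, S.ord j ≤ I) → ∀ x v, S.value g T x v = 0

/-- All scalar polynomial invariants of arbitrary order vanish. -/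
def IsVSI {n k : ℕ} (g : MetricField n) (T : TensorField n k) : Prop :=
  ∀ I : ℕ, IsVSIUpTo g T I

/-- All zeroth order scalar polynomial invariants of `T` vanish at the point `x`. -/
def IsVSI0At {n k : ℕ} (g : MetricField n) (T : TensorField n k) (x : Pt n) : Prop :=
  ∀ S : ConcomScheme k 0, (∀ j, S.ord j = 0) → ∀ v, S.value g T x v = 0

/-- A rank-`r` tensor field `G` is (polynomially) constructed from `T`, its covariant
derivatives of arbitrary order and the metric. -/
def IsConstructedFrom {n k r : ℕ} (g : MetricField n) (T : TensorField n k)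
    (G : TensorField n r) : Prop :=
  G ∈ Submodule.span ℝ {G' : TensorField n r | ∃ S : ConcomScheme k r, G' = S.value g T}

/-- A symmetric-2-tensor "correction" to the standard electromagnetic energy-momentum
tensor: constructed from `T` and its covariant derivatives, where each monomial either
contains at least three factors of the field or at least one covariant derivative
(i.e. it comes from a non-Maxwellian term of a generalized electrodynamics). -/
def IsCorrectionTensor {n k : ℕ} (g : MetricField n) (T : TensorField n k)
    (Tc : TensorField n 2) : Prop :=
  Tc ∈ Submodule.span ℝ {G : TensorField n 2 |
    ∃ S : ConcomScheme k 2, (3 ≤ S.N ∨ ∃ j, 1 ≤ S.ord j) ∧ G = S.value g T}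

/-! ### p-forms, type N, Lie derivative -/

def IsAlternating {n k : ℕ} (T : TensorField n k) : Prop :=
  ∀ (x : Pt n) (idx : Fin k → Fin n) (σ : Equiv.Perm (Fin k)),
    T x (idx ∘ σ) = ((Equiv.Perm.sign σ : ℤ) : ℝ) * T x idx

def IsSmoothT {n k : ℕ} (T : TensorField n k) : Prop :=
  ∀ idx, ContDiff ℝ (⊤ : ℕ∞) fun x => T x idx

/-- A smooth differential form (totally antisymmetric covariant tensor field). -/
def IsFormField {n k : ℕ} (T : TensorField n k) : Prop :=
  IsSmoothT T ∧ IsAlternating T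

def IsSmoothVec {n : ℕ} (ℓ : VecField n) : Prop :=
  ∀ a, ContDiff ℝ (⊤ : ℕ∞) fun x => ℓ x a

/-- A (nowhere vanishing, smooth) null vector field. -/
def IsNullField {n : ℕ} (g : MetricField n) (ℓ : VecField n) : Prop :=
  IsSmoothVec ℓ ∧ (∀ x, ℓ x ≠ 0) ∧ ∀ x, gdot g x (ℓ x) (ℓ x) = 0

/-- `ℓ^a F_{a b₁ … b_{p-1}} = 0`. -/
def ContractsFirstZero {n p : ℕ} [NeZero p] (ℓ : VecField n) (F : TensorField n p) : Prop :=
  ∀ (x : Pt n) (v : Fin p → Fin n), (∑ a, ℓ x a * F x (Function.update v 0 a)) = 0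

/-- `ℓ_{[a} F_{b₁ … b_p]} = 0`. -/
def WedgeWithZero {n p : ℕ} (g : MetricField n) (ℓ : VecField n) (F : TensorField n p) : Prop :=
  ∀ (x : Pt n) (idx : Fin (p+1) → Fin n),
    (∑ σ : Equiv.Perm (Fin (p+1)), ((Equiv.Perm.sign σ : ℤ) : ℝ) *
      (lower g ℓ x (idx (σ 0)) * F x (fun m => idx (σ m.succ)))) = 0

/-- The `p`-form `F` is of type N with multiple null direction `ℓ`. -/
def IsTypeN {n p : ℕ} [NeZero p] (g : MetricField n) (F : TensorField n p)
    (ℓ : VecField n) : Prop :=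
  IsNullField g ℓ ∧ ContractsFirstZero ℓ F ∧ WedgeWithZero g ℓ F

/-- Lie derivative of a covariant tensor field along a vector field. -/
def lieD {n k : ℕ} (ℓ : VecField n) (T : TensorField n k) : TensorField n k :=
  fun x idx =>
    (∑ a, ℓ x a * pd (fun y => T y idx) a x)
    + ∑ m : Fin k, ∑ a, pd (fun y => ℓ y a) (idx m) x * T x (Function.update idx m a)

/-! ### Optical properties: geodesic, Kundt -/

/-- `∇_b ℓ_a` (first index is the derivative index). -/
def nablaLow {n : ℕ} (g : MetricField n) (ℓ : VecField n) (x : Pt n) (b a : Fin n) : ℝ :=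
  covD g (lowerField g ℓ) x ![b, a]

/-- `ℓ` is geodesic: `ℓ^b ∇_b ℓ_a ∝ ℓ_a`. -/
def IsGeodesicField {n : ℕ} (g : MetricField n) (ℓ : VecField n) : Prop :=
  ∀ x, ∃ c : ℝ, ∀ a, (∑ b, ℓ x b * nablaLow g ℓ x b a) = c * lower g ℓ x a

/-- `ℓ` is affinely parameterized: `ℓ^b ∇_b ℓ_a = 0`. -/
def IsAffinelyParam {n : ℕ} (g : MetricField n) (ℓ : VecField n) : Prop :=
  ∀ x a, (∑ b, ℓ x b * nablaLow g ℓ x b a) = 0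

/-- `ℓ` is a Kundt null vector field: null, geodesic and with vanishing optical matrix
(expansion-free, shear-free and twist-free). -/
def IsKundt {n : ℕ} (g : MetricField n) (ℓ : VecField n) : Prop :=
  IsNullField g ℓ ∧ IsGeodesicField g ℓ ∧
  ∀ (x : Pt n) (X Y : Fin n → ℝ), gdot g x X (ℓ x) = 0 → gdot g x Y (ℓ x) = 0 →
    (∑ a, ∑ b, X a * Y b * nablaLow g ℓ x b a) = 0

/-! ### Curvature -/

/-- Fully lowered Riemann tensor `R_{abcd}`. -/
def riemann {n : ℕ} (g : MetricField n) : TensorField n 4 := fun x idx =>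
  ∑ e, g x (idx 0) e *
    (pd (fun y => christoffel g y e (idx 3) (idx 1)) (idx 2) x
     - pd (fun y => christoffel g y e (idx 2) (idx 1)) (idx 3) x
     + ∑ f', (christoffel g x e (idx 2) f' * christoffel g x f' (idx 3) (idx 1)
            - christoffel g x e (idx 3) f' * christoffel g x f' (idx 2) (idx 1)))

def ricci {n : ℕ} (g : MetricField n) (x : Pt n) (b d : Fin n) : ℝ :=
  ∑ a, ∑ c, (g x)⁻¹ a c * riemann g x ![a, b, c, d]

def ricciScalar {n : ℕ} (g : MetricField n) (x : Pt n) : ℝ :=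
  ∑ b, ∑ d, (g x)⁻¹ b d * ricci g x b d

def tracelessRicci {n : ℕ} (g : MetricField n) : TensorField n 2 := fun x idx =>
  ricci g x (idx 0) (idx 1) - ricciScalar g x / (n : ℝ) * g x (idx 0) (idx 1)

/-- Weyl tensor `C_{abcd}` (for `n ≥ 3`). -/
def weyl {n : ℕ} (g : MetricField n) : TensorField n 4 := fun x idx =>
  riemann g x idx
  - (1 / ((n : ℝ) - 2)) *
      (g x (idx 0) (idx 2) * ricci g x (idx 3) (idx 1)
       - g x (idx 0) (idx 3) * ricci g x (idx 2) (idx 1)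
       - g x (idx 1) (idx 2) * ricci g x (idx 3) (idx 0)
       + g x (idx 1) (idx 3) * ricci g x (idx 2) (idx 0))
  + (1 / (((n : ℝ) - 1) * ((n : ℝ) - 2))) * ricciScalar g x *
      (g x (idx 0) (idx 2) * g x (idx 3) (idx 1) - g x (idx 0) (idx 3) * g x (idx 2) (idx 1))

/-! ### Null frames, boost weights, algebraic types -/

/-- A null frame at a point: two null vectors `e 0 = ℓ`, `e 1 = n` with `ℓ·n = 1`, and
orthonormal spacelike vectors `e i`, `i ≥ 2`, orthogonal to both. -/
structure NullFrameAt {n : ℕ} [NeZero n] (g : MetricField n) (x : Pt n) where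
  e : Fin n → Fin n → ℝ
  h00 : gdot g x (e 0) (e 0) = 0
  h11 : gdot g x (e 1) (e 1) = 0
  h01 : gdot g x (e 0) (e 1) = 1
  h0i : ∀ i : Fin n, 2 ≤ (i : ℕ) → gdot g x (e 0) (e i) = 0
  h1i : ∀ i : Fin n, 2 ≤ (i : ℕ) → gdot g x (e 1) (e i) = 0
  hij : ∀ i j : Fin n, 2 ≤ (i : ℕ) → 2 ≤ (j : ℕ) →
    gdot g x (e i) (e j) = (if i = j then 1 else 0)

/-- Boost weight of a frame multi-index: `+1` for each contraction with `ℓ = e 0`,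
`-1` for each contraction with `n = e 1`. -/
def bw {n k : ℕ} (a : Fin k → Fin n) : ℤ :=
  ((Finset.univ.filter fun m => (a m : ℕ) = 0).card : ℤ)
  - ((Finset.univ.filter fun m => (a m : ℕ) = 1).card : ℤ)

/-- Frame components of a covariant tensor. -/
def frameComp {n k : ℕ} (T : TensorField n k) (e : Fin n → Fin n → ℝ) (x : Pt n)
    (a : Fin k → Fin n) : ℝ :=
  ∑ idx : Fin k → Fin n, T x idx * ∏ m, e (a m) (idx m)

/-- The tensor field `T` has boost order at most `b` with respect to the null
direction `ℓ`: in any null frame containing `ℓ`, all frame components of boost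
weight `> b` vanish.  `b = 0` is the aligned type II condition, `b = -1` type III. -/
def BoostOrderLE {n k : ℕ} [NeZero n] (g : MetricField n) (ℓ : VecField n)
    (T : TensorField n k) (b : ℤ) : Prop :=
  ∀ (x : Pt n) (fr : NullFrameAt g x), fr.e 0 = ℓ x →
    ∀ a : Fin k → Fin n, b < bw a → frameComp T fr.e x a = 0

/-- `g` is a degenerate Kundt metric with Kundt null direction `ℓ`: `ℓ` is Kundt and
the Riemann tensor together with its covariant derivatives of all orders is of aligned
type II with respect to `ℓ`. -/
def IsDegenerateKundt {n : ℕ} [NeZero n] (g : MetricField n) (ℓ : VecField n) : Prop :=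
  IsKundt g ℓ ∧ ∀ I : ℕ, BoostOrderLE g ℓ (covDIter g (riemann g) I) 0

/-! ### Exterior derivative, Hodge dual, Maxwell equations -/

/-- Exterior derivative (components, no normalization factor). -/
def extD {n k : ℕ} (F : TensorField n k) : TensorField n (k+1) := fun x idx =>
  ∑ m : Fin (k+1), (-1 : ℝ) ^ (m : ℕ) *
    pd (fun y => F y fun i => idx (m.succAbove i)) (idx m) x

/-- Sign of a self-map of `Fin k` (0 if not bijective). -/
def permSign {k : ℕ} (f : Fin k → Fin k) : ℤ :=
  if h : Function.Bijective f then Equiv.Perm.sign (Equiv.ofBijective f h) else 0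

/-- Raise all indices of a covariant tensor with the inverse metric. -/
def raiseAll {n k : ℕ} (g : MetricField n) (T : TensorField n k) : TensorField n k :=
  fun x idx => ∑ jdx : Fin k → Fin n, (∏ m, (g x)⁻¹ (idx m) (jdx m)) * T x jdx

/-- Hodge dual of a `p`-form (`p + q = n`), via the metric volume element
`√|det g| ε_{a₁…aₙ}`. -/
def hodge {n p q : ℕ} (h : p + q = n) (g : MetricField n) (F : TensorField n p) :
    TensorField n q := fun x idx =>
  (1 / (Nat.factorial p : ℝ)) *
    ∑ a : Fin p → Fin n, raiseAll g F x a *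
      (Real.sqrt |(g x).det| *
        ((permSign fun i => Fin.append a idx (Fin.cast h.symm i) : ℤ) : ℝ))

/-- Source-free Maxwell equations `dF = 0 = d*F` for a `p`-form (`p + q = n`). -/
def MaxwellEqs {n p q : ℕ} (h : p + q = n) (g : MetricField n) (F : TensorField n p) : Prop :=
  (∀ x idx, extD F x idx = 0) ∧ (∀ x idx, extD (hodge h g F) x idx = 0)

/-! ### Wedge products -/

def wedgeP {n a b : ℕ} (F : TensorField n a) (G : TensorField n b) : TensorField n (a+b) :=
  fun x idx => ∑ σ : Equiv.Perm (Fin (a+b)), ((Equiv.Perm.sign σ : ℤ) : ℝ) *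
    (F x fun i => idx (σ (Fin.castAdd b i))) * (G x fun j => idx (σ (Fin.natAdd a j)))

def wedgePow {n p : ℕ} (F : TensorField n p) : (k : ℕ) → TensorField n (p * k)
  | 0 => fun _ _ => 1
  | k + 1 => wedgeP (wedgePow F k) F

def castT {n a b : ℕ} (h : a = b) (T : TensorField n a) : TensorField n b :=
  fun x idx => T x fun i => idx (Fin.cast h i)

/-! ### Degenerate Kundt metrics in adapted coordinates -/

/-- The Kundt metric `ds² = 2 du (dr + H du + W_α dx^α) + g_{αβ} dx^α dx^β` in
coordinates `(u, r, x^α) = (x⁰, x¹, x^{α≥2})`. -/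
def kundtMetric {n : ℕ} (H : Pt n → ℝ) (W : Pt n → Fin n → ℝ) (hT : MetricField n) :
    MetricField n := fun x => Matrix.of fun a b =>
  if (a : ℕ) = 0 ∧ (b : ℕ) = 0 then 2 * H x
  else if ((a : ℕ) = 0 ∧ (b : ℕ) = 1) ∨ ((a : ℕ) = 1 ∧ (b : ℕ) = 0) then 1
  else if (a : ℕ) = 0 then W x b
  else if (b : ℕ) = 0 then W x a
  else if (a : ℕ) = 1 ∨ (b : ℕ) = 1 then 0
  else hT x a b

/-- A transverse (Riemannian) metric `g_{αβ}(u,x)`, stored as an `n×n` matrix padded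
by the identity on the coordinates `u, r`. -/
def IsTransverseMetric {n : ℕ} (hT : MetricField n) : Prop :=
  (∀ (x : Pt n) (a b : Fin n), ((a : ℕ) < 2 ∨ (b : ℕ) < 2) → hT x a b = (if a = b then 1 else 0)) ∧
  (∀ x, (hT x).IsSymm) ∧ (∀ a b, ContDiff ℝ (⊤ : ℕ∞) fun x => hT x a b) ∧
  IndepOfR hT ∧ (∀ x, (hT x).PosDef)

/-- Data of a degenerate Kundt metric: `W_α = r W¹_α + W⁰_α`,
`H = r² H² + r H¹ + H⁰`, transverse metric `hT`. -/
structure DegKundtData (n : ℕ) where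
  H2 : Pt n → ℝ
  H1 : Pt n → ℝ
  H0 : Pt n → ℝ
  W1 : Pt n → Fin n → ℝ
  W0 : Pt n → Fin n → ℝ
  hT : MetricField n

def DegKundtData.Hfun {n : ℕ} [NeZero n] (D : DegKundtData n) : Pt n → ℝ :=
  fun z => (z 1)^2 * D.H2 z + z 1 * D.H1 z + D.H0 z

def DegKundtData.Wfun {n : ℕ} [NeZero n] (D : DegKundtData n) : Pt n → Fin n → ℝ :=
  fun z b => z 1 * D.W1 z b + D.W0 z b

/-- The degenerate Kundt metric built from the data. -/
def DegKundtData.metric {n : ℕ} [NeZero n] (D : DegKundtData n) : MetricField n :=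
  kundtMetric D.Hfun D.Wfun D.hT

/-- Regularity and shape conditions on the degenerate Kundt data: the metric functions
depend only on `(u, x^α)` and are smooth, `W`'s are transverse. -/
def DegKundtData.Regular {n : ℕ} (D : DegKundtData n) : Prop :=
  IsTransverseMetric D.hT ∧
  IndepOfR D.H2 ∧ IndepOfR D.H1 ∧ IndepOfR D.H0 ∧ IndepOfR D.W1 ∧ IndepOfR D.W0 ∧
  ContDiff ℝ (⊤ : ℕ∞) D.H2 ∧ ContDiff ℝ (⊤ : ℕ∞) D.H1 ∧ ContDiff ℝ (⊤ : ℕ∞) D.H0 ∧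
  (∀ a, ContDiff ℝ (⊤ : ℕ∞) fun x => D.W1 x a) ∧ (∀ a, ContDiff ℝ (⊤ : ℕ∞) fun x => D.W0 x a) ∧
  (∀ (x : Pt n) (a : Fin n), (a : ℕ) < 2 → D.W1 x a = 0) ∧ (∀ (x : Pt n) (a : Fin n), (a : ℕ) < 2 → D.W0 x a = 0)

/-- The `(q+1)`-form `du ∧ f` built from a transverse `q`-form `f`. -/
def duWedge {n q : ℕ} (f : TensorField n q) : TensorField n (q+1) := fun x idx =>
  ∑ m : Fin (q+1), (-1 : ℝ) ^ (m : ℕ) * (if (idx m : ℕ) = 0 then 1 else 0) *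
    f x (fun i => idx (m.succAbove i))

/-- `f_{[α₂…α_p , α₁]} = 0`: `f` is closed in the transverse geometry. -/
def TransClosed {n q : ℕ} (f : TensorField n q) : Prop :=
  ∀ (x : Pt n) (v : Fin (q+1) → Fin n), (∀ i, 2 ≤ (v i : ℕ)) →
    (∑ m : Fin (q+1), (-1 : ℝ) ^ (m : ℕ) *
      pd (fun y => f y fun i => v (m.succAbove i)) (v m) x) = 0

/-- `(√g̃ f^{β α₁…α_{p-2}})_{,β} = 0`: `f` is co-closed in the transverse geometry. -/
def TransCoclosed {n q : ℕ} [NeZero q] (hT : MetricField n) (f : TensorField n q) : Prop :=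
  ∀ (x : Pt n) (v : Fin q → Fin n),
    (∑ b : Fin n, pd (fun y =>
      Real.sqrt (hT y).det * raiseAll hT f y (Function.update v 0 b)) b x) = 0

/-! ### Transverse curvature -/

def christoffelT {n : ℕ} (h : MetricField n) (x : Pt n) (a b c : Fin n) : ℝ :=
  (1/2) * ∑ d, (h x)⁻¹ a d *
    (pdT (fun y => h y d c) b x + pdT (fun y => h y b d) c x - pdT (fun y => h y b c) d x)

def covDT {n k : ℕ} (h : MetricField n) (T : TensorField n k) : TensorField n (k+1) :=
  fun x idx =>
    pdT (fun y => T y fun m => idx m.succ) (idx 0) x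
    - ∑ m : Fin k, ∑ e : Fin n,
        christoffelT h x e (idx 0) (idx m.succ) * T x (Function.update (fun m' => idx m'.succ) m e)

def riemannT {n : ℕ} (h : MetricField n) : TensorField n 4 := fun x idx =>
  ∑ e, h x (idx 0) e *
    (pdT (fun y => christoffelT h y e (idx 3) (idx 1)) (idx 2) x
     - pdT (fun y => christoffelT h y e (idx 2) (idx 1)) (idx 3) x
     + ∑ f', (christoffelT h x e (idx 2) f' * christoffelT h x f' (idx 3) (idx 1)
            - christoffelT h x e (idx 3) f' * christoffelT h x f' (idx 2) (idx 1)))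

def ricciT {n : ℕ} (h : MetricField n) (x : Pt n) (b d : Fin n) : ℝ :=
  ∑ a, ∑ c, (h x)⁻¹ a c * riemannT h x ![a, b, c, d]

def ricciScalarT {n : ℕ} (h : MetricField n) (x : Pt n) : ℝ :=
  ∑ b, ∑ d, (h x)⁻¹ b d * ricciT h x b d

/-- A covector field as a rank-1 tensor field. -/
def oneForm {n : ℕ} (W : Pt n → Fin n → ℝ) : TensorField n 1 := fun x idx => W x (idx 0)

/-- Transverse covariant derivative `∇̃_b V_a` (`= V_{a||b}`). -/
def nablaT {n : ℕ} (h : MetricField n) (V : TensorField n 1) (x : Pt n) (b a : Fin n) : ℝ :=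
  covDT h V x ![b, a]

/-- Second transverse covariant derivative `∇̃_c ∇̃_b V_a`. -/
def nablaT2 {n : ℕ} (h : MetricField n) (V : TensorField n 1) (x : Pt n) (c b a : Fin n) : ℝ :=
  covDT h (covDT h V) x ![c, b, a]

/-- Transverse divergence `V^{α}{}_{||α}`. -/
def divT {n : ℕ} (h : MetricField n) (V : TensorField n 1) (x : Pt n) : ℝ :=
  ∑ b, ∑ c, (h x)⁻¹ b c * nablaT h V x b c

def gradT {n : ℕ} (f : Pt n → ℝ) : TensorField n 1 := fun x idx => pdT f (idx 0) x

/-- Transverse Laplacian. -/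
def laplaceT {n : ℕ} (h : MetricField n) (f : Pt n → ℝ) (x : Pt n) : ℝ :=
  ∑ a, ∑ b, (h x)⁻¹ a b * covDT h (gradT f) x ![a, b]

def lnSqrtDet {n : ℕ} (h : MetricField n) (y : Pt n) : ℝ :=
  Real.log (Real.sqrt (h y).det)

/-! ### Electromagnetic energy-momentum tensor -/

/-- Standard energy-momentum tensor of a `(q+1)`-form Maxwell field:
`T_{ab} = (1/q!) (F_{a c⃗} F_b{}^{c⃗} - (1/(2(q+1))) g_{ab} F_{c⃗}F^{c⃗})`. -/
def emTensor {n q : ℕ} (g : MetricField n) (F : TensorField n (q+1)) (x : Pt n)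
    (a b : Fin n) : ℝ :=
  (1 / (Nat.factorial q : ℝ)) *
    ((∑ v : Fin q → Fin n, F x (Fin.cons a v) *
        ∑ w : Fin q → Fin n, (∏ i, (g x)⁻¹ (v i) (w i)) * F x (Fin.cons b w))
     - (1 / (2 * ((q : ℝ) + 1))) * g x a b *
        ∑ v : Fin (q+1) → Fin n, F x v * raiseAll g F x v)

/-! ### Coordinate transformations (for adapted coordinates) -/

/-- Jacobian `∂ψ^a/∂y^b` of a coordinate change. -/
def jac {n : ℕ} (ψ : Pt n → Pt n) (y : Pt n) (a b : Fin n) : ℝ :=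
  pd (fun z => ψ z a) b y

/-- Pullback of the metric along the coordinate change `ψ` (from new to old coords). -/
def pullMetric {n : ℕ} (g : MetricField n) (ψ : Pt n → Pt n) : MetricField n :=
  fun y => Matrix.of fun μ ν => ∑ a, ∑ b, jac ψ y a μ * jac ψ y b ν * g (ψ y) a b

/-- Pullback of a covariant tensor field along `ψ`. -/
def pullForm {n p : ℕ} (F : TensorField n p) (ψ : Pt n → Pt n) : TensorField n p :=
  fun y idx => ∑ jdx : Fin p → Fin n, (∏ m, jac ψ y (jdx m) (idx m)) * F (ψ y) jdx

/-! ### Parallelly transported adapted frames -/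

/-- A null frame field containing `ℓ`, parallelly transported along `ℓ` and adapted
(`M^i_{jk} = 0`). -/
structure AdaptedPTFrame {n : ℕ} [NeZero n] (g : MetricField n) (ℓ : VecField n) where
  fr : ∀ x : Pt n, NullFrameAt g x
  aligned : ∀ x, (fr x).e 0 = ℓ x
  parallel : ∀ (x : Pt n) (a c : Fin n),
    (∑ b, ℓ x b * (pd (fun y => (fr y).e a c) b x
      + ∑ d, christoffel g x c b d * (fr x).e a d)) = 0
  adapted : ∀ (x : Pt n) (i j k : Fin n), 2 ≤ (i : ℕ) → 2 ≤ (j : ℕ) → 2 ≤ (k : ℕ) →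
    (∑ a, ∑ b, covD g (lowerField g fun z => (fr z).e j) x ![b, a]
      * (fr x).e i a * (fr x).e k b) = 0

/-! ### Explicit Petrov type III solutions -/

/-- The type III vacuum metric of Petrov,
`ds² = 2 du (dr + ½(xr − x eˣ) du) + eˣ(dx² + e^{2u} dy²)`, in coordinates
`(u,r,x,y)`. -/
def petrovG : MetricField 4 := fun z => Matrix.of fun a b =>
  if a = 0 ∧ b = 0 then z 2 * z 1 - z 2 * Real.exp (z 2)
  else if (a = 0 ∧ b = 1) ∨ (a = 1 ∧ b = 0) then 1
  else if a = 2 ∧ b = 2 then Real.exp (z 2)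
  else if a = 3 ∧ b = 3 then Real.exp (z 2 + 2 * z 0)
  else 0

/-- The same metric with the electromagnetic backreaction term
`−2κ₀ eˣ c(u)²` included in `2H`. -/
def petrovEM (κ₀ : ℝ) (c : ℝ → ℝ) : MetricField 4 := fun z => Matrix.of fun a b =>
  if a = 0 ∧ b = 0 then z 2 * z 1 - z 2 * Real.exp (z 2) - 2 * κ₀ * Real.exp (z 2) * (c (z 0))^2
  else if (a = 0 ∧ b = 1) ∨ (a = 1 ∧ b = 0) then 1
  else if a = 2 ∧ b = 2 then Real.exp (z 2)
  else if a = 3 ∧ b = 3 then Real.exp (z 2 + 2 * z 0)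
  else 0

/-- The null direction `ℓ = ∂_r`. -/
def ellR : VecField 4 := fun _ a => if a = 1 then 1 else 0

/-- The transverse covector of the VSI Maxwell field (4). -/
def petrovA (c : ℝ → ℝ) (z : Pt 4) : Fin 4 → ℝ := fun a =>
  if a = 2 then -(Real.exp (z 2 / 2) * c (z 0) * Real.cos (z 3 * Real.exp (z 0) / 2))
  else if a = 3 then Real.exp (z 2 / 2) * c (z 0) * Real.exp (z 0) * Real.sin (z 3 * Real.exp (z 0) / 2)
  else 0

/-- The Maxwell 2-form
`F = e^{x/2} c(u) du ∧ (−cos(y eᵘ/2) dx + eᵘ sin(y eᵘ/2) dy)`. -/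
def petrovF (c : ℝ → ℝ) : TensorField 4 2 := fun z idx =>
  (if idx 0 = 0 then petrovA c z (idx 1) else 0)
  - (if idx 1 = 0 then petrovA c z (idx 0) else 0)


set_option linter.unusedSectionVars false
set_option linter.unusedSimpArgs false
set_option linter.unusedVariables false





/-! ### Partial derivatives -/

abbrev Smf {n : ℕ} (f : Pt n → ℝ) : Prop := ContDiff ℝ (⊤ : ℕ∞) f

section pdlemmas
variable {n : ℕ} {f h : Pt n → ℝ} {a : Fin n} {x : Pt n}

theorem Smf.da (hf : Smf f) : DifferentiableAt ℝ f x :=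
  (hf.differentiable (by simp)) x

theorem pd_add (hf : Smf f) (hh : Smf h) :
    pd (fun y => f y + h y) a x = pd f a x + pd h a x := by
  unfold pd
  rw [show (fun y => f y + h y) = f + h from rfl, fderiv_add hf.da hh.da]; rfl

theorem pd_sub (hf : Smf f) (hh : Smf h) :
    pd (fun y => f y - h y) a x = pd f a x - pd h a x := by
  unfold pd
  rw [show (fun y => f y - h y) = f - h from rfl, fderiv_sub hf.da hh.da]; rfl

theorem pd_mul (hf : Smf f) (hh : Smf h) :
    pd (fun y => f y * h y) a x = pd f a x * h x + f x * pd h a x := by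
  unfold pd
  rw [show (fun y => f y * h y) = f * h from rfl, fderiv_mul hf.da hh.da]
  simp [smul_eq_mul]; ring

theorem pd_const (c : ℝ) : pd (fun _ : Pt n => c) a x = 0 := by
  unfold pd; simp

theorem pd_const_mul (c : ℝ) (hf : Smf f) :
    pd (fun y => c * f y) a x = c * pd f a x := by
  rw [pd_mul contDiff_const hf, pd_const]; ring

theorem pd_neg : pd (fun y => - f y) a x = - pd f a x := by
  unfold pd
  rw [show (fun y => - f y) = - f from rfl, fderiv_neg]; rfl

theorem pd_sum {κ : Type*} (s : Finset κ) (F : κ → Pt n → ℝ) (hF : ∀ k, Smf (F k)) :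
    pd (fun y => ∑ k ∈ s, F k y) a x = ∑ k ∈ s, pd (F k) a x := by
  unfold pd
  rw [fderiv_fun_sum (fun k _ => (hF k).da)]
  simp

theorem Smf.pd (hf : Smf f) (a : Fin n) : Smf (pd f a) := by
  have : ContDiff ℝ (⊤ : ℕ∞) (fderiv ℝ f) := hf.fderiv_right (by simp)
  exact this.clm_apply contDiff_const

theorem pd_comm (hf : Smf f) (a b : Fin n) : pd (pd f a) b x = pd (pd f b) a x := by
  have h2 : ∀ a b, pd (pd f a) b x
      = fderiv ℝ (fderiv ℝ f) x (Pi.single b 1) (Pi.single a 1) := by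
    intro a b
    have hd : DifferentiableAt ℝ (fderiv ℝ f) x :=
      ((hf.fderiv_right (m := (⊤ : ℕ∞)) (by simp)).differentiable (by simp)) x
    show fderiv ℝ (fun y => fderiv ℝ f y (Pi.single a 1)) x (Pi.single b 1) = _
    rw [fderiv_clm_apply hd (by fun_prop)]
    simp
  rw [h2, h2]
  have := (hf.contDiffAt (x := x)).isSymmSndFDerivAt (by simp only [minSmoothness_of_isRCLikeNormedField]; exact WithTop.coe_le_coe.2 le_top)
  exact this _ _

theorem Smf.sum {κ : Type*} {s : Finset κ} {F : κ → Pt n → ℝ} (hF : ∀ k, Smf (F k)) :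
    Smf (fun y => ∑ k ∈ s, F k y) := ContDiff.sum (fun k _ => hF k)

theorem Smf.prod {κ : Type*} {s : Finset κ} {F : κ → Pt n → ℝ} (hF : ∀ k, Smf (F k)) :
    Smf (fun y => ∏ k ∈ s, F k y) := contDiff_prod (fun k _ => hF k)

theorem pd_prod {κ : Type*} [DecidableEq κ] (s : Finset κ) (F : κ → Pt n → ℝ) (hF : ∀ k, Smf (F k)) :
    pd (fun y => ∏ k ∈ s, F k y) a x = ∑ k ∈ s, pd (F k) a x * ∏ j ∈ s.erase k, F j x := by
  induction s using Finset.induction_on with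
  | empty => simp [pd_const]
  | insert k s hk ih =>
    simp only [Finset.prod_insert hk, Finset.sum_insert hk]
    rw [pd_mul (hF k) (Smf.prod hF), ih, Finset.erase_insert hk, Finset.mul_sum]
    congr 1
    refine Finset.sum_congr rfl fun j hj => ?_
    have hjk : j ≠ k := fun h => hk (h ▸ hj)
    rw [Finset.erase_insert_of_ne (Ne.symm hjk), Finset.prod_insert (by simp [hk])]
    ring

end pdlemmas

/-! ### Generic tensors -/

abbrev Ten (n : ℕ) (ι : Type) := Pt n → (ι → Fin n) → ℝ

def Sm {n : ℕ} {ι : Type} (T : Ten n ι) : Prop := ∀ idx, Smf fun x => T x idx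

structure MetOK {n : ℕ} (g : MetricField n) : Prop where
  sm : ∀ a b, Smf fun x => g x a b
  symm : ∀ x a b, g x a b = g x b a
  det : ∀ x, IsUnit (g x).det

theorem IsLorentzMetric.ok {n : ℕ} {g : MetricField n} (h : IsLorentzMetric g) : MetOK g := by
  refine ⟨h.1, fun x a b => (h.2.1 x).apply b a, fun x => ?_⟩
  obtain ⟨P, hP, hd⟩ := h.2.2 x
  have := congrArg Matrix.det hd
  rw [Matrix.det_mul, Matrix.det_mul, Matrix.det_diagonal] at this
  have h2 : (∏ i : Fin n, if (i : ℕ) = 0 then (-1 : ℝ) else 1) ≠ 0 := by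
    rw [Finset.prod_ne_zero_iff]; intro i _; split_ifs <;> norm_num
  rw [isUnit_iff_ne_zero]; intro h0
  rw [h0] at this; simp at this; exact h2 this.symm

namespace MetOK
variable {n : ℕ} {g : MetricField n}

theorem inv_mul (hg : MetOK g) (x : Pt n) (a c : Fin n) :
    ∑ b, (g x)⁻¹ a b * g x b c = if a = c then 1 else 0 := by
  rw [← Matrix.mul_apply, Matrix.nonsing_inv_mul _ (hg.det x), Matrix.one_apply]

theorem mul_inv (hg : MetOK g) (x : Pt n) (a c : Fin n) :
    ∑ b, g x a b * (g x)⁻¹ b c = if a = c then 1 else 0 := by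
  rw [← Matrix.mul_apply, Matrix.mul_nonsing_inv _ (hg.det x), Matrix.one_apply]

theorem inv_symm (hg : MetOK g) (x : Pt n) (a b : Fin n) : (g x)⁻¹ a b = (g x)⁻¹ b a := by
  have : (g x).transpose = g x := by ext i j; exact hg.symm x j i
  conv_lhs => rw [← this, ← Matrix.transpose_nonsing_inv]
  rfl

theorem sm_det (hg : MetOK g) : Smf fun x => (g x).det := by
  simp only [Matrix.det_apply']
  exact Smf.sum fun σ => contDiff_const.mul (Smf.prod fun i => hg.sm _ _)

theorem sm_inv (hg : MetOK g) (a b : Fin n) : Smf fun x => (g x)⁻¹ a b := by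
  have : (fun x => (g x)⁻¹ a b) = fun x => (g x).det⁻¹ * (g x).adjugate a b := by
    ext x; rw [Matrix.inv_def]; simp
  rw [this]
  refine ContDiff.mul (hg.sm_det.inv fun x => (hg.det x).ne_zero) ?_
  simp only [Matrix.adjugate_apply, Matrix.det_apply']
  refine Smf.sum fun σ => contDiff_const.mul (Smf.prod fun i => ?_)
  simp only [Matrix.updateRow_apply]
  split_ifs
  · exact contDiff_const
  · exact hg.sm _ _

theorem sm_chr (hg : MetOK g) (a b c : Fin n) : Smf fun x => christoffel g x a b c := by
  unfold christoffel
  refine contDiff_const.mul (Smf.sum fun d => (hg.sm_inv _ _).mul ?_)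
  exact (((hg.sm _ _).pd _).add ((hg.sm _ _).pd _)).sub ((hg.sm _ _).pd _)

theorem chr_symm (hg : MetOK g) (x : Pt n) (a b c : Fin n) : christoffel g x a b c = christoffel g x a c b := by
  unfold christoffel
  congr 1
  refine Finset.sum_congr rfl fun d _ => ?_
  rw [show (fun y => g y d c) = fun y => g y c d from funext fun y => hg.symm y _ _,
    show (fun y => g y b d) = fun y => g y d b from funext fun y => hg.symm y _ _,
    show (fun y => g y b c) = fun y => g y c b from funext fun y => hg.symm y _ _]
  ring

theorem low_chr (hg : MetOK g) (x : Pt n) (d b c : Fin n) : ∑ a, g x d a * christoffel g x a b c =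
    (1/2) * (pd (fun y => g y d c) b x + pd (fun y => g y b d) c x - pd (fun y => g y b c) d x) := by
  unfold christoffel
  simp_rw [Finset.mul_sum]
  rw [Finset.sum_comm]
  have : ∀ e, ∑ a, g x d a * (1 / 2 * ((g x)⁻¹ a e *
      (pd (fun y => g y e c) b x + pd (fun y => g y b e) c x - pd (fun y => g y b c) e x)))
      = (if d = e then 1 else 0) * ((1/2) *
      (pd (fun y => g y e c) b x + pd (fun y => g y b e) c x - pd (fun y => g y b c) e x)) := by
    intro e
    rw [← hg.mul_inv x d e, Finset.sum_mul]
    exact Finset.sum_congr rfl fun a _ => by ring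
  simp_rw [this]
  simp

theorem pd_g (hg : MetOK g) (x : Pt n) (c a b : Fin n) : pd (fun y => g y a b) c x =
    ∑ e, (christoffel g x e c a * g x e b + christoffel g x e c b * g x a e) := by
  rw [Finset.sum_add_distrib]
  have h1 := hg.low_chr x b c a
  have h2 := hg.low_chr x a c b
  have e1 : ∑ e, christoffel g x e c a * g x e b = ∑ e, g x b e * christoffel g x e c a :=
    Finset.sum_congr rfl fun e _ => by rw [hg.symm x e b]; ring
  have e2 : ∑ e, christoffel g x e c b * g x a e = ∑ e, g x a e * christoffel g x e c b :=
    Finset.sum_congr rfl fun e _ => by ring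
  rw [e1, e2, h1, h2,
    show (fun y => g y b a) = fun y => g y a b from funext fun y => hg.symm y _ _,
    show (fun y => g y c b) = fun y => g y b c from funext fun y => hg.symm y _ _,
    show (fun y => g y c a) = fun y => g y a c from funext fun y => hg.symm y _ _]
  ring

theorem pd_gi (hg : MetOK g) (x : Pt n) (c a b : Fin n) : pd (fun y => (g y)⁻¹ a b) c x =
    - ∑ e, (christoffel g x a c e * (g x)⁻¹ e b + christoffel g x b c e * (g x)⁻¹ a e) := by
  -- matrices
  set Gi : Matrix (Fin n) (Fin n) ℝ := (g x)⁻¹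
  set G : Matrix (Fin n) (Fin n) ℝ := g x
  set Γ : Matrix (Fin n) (Fin n) ℝ := Matrix.of fun a b => christoffel g x a c b
  set dG : Matrix (Fin n) (Fin n) ℝ := Matrix.of fun a b => pd (fun y => g y a b) c x
  set dGi : Matrix (Fin n) (Fin n) ℝ := Matrix.of fun a b => pd (fun y => (g y)⁻¹ a b) c x
  have hdG : dG = Γ.transpose * G + G * Γ := by
    ext i j
    simp only [dG, Γ, Matrix.of_apply, Matrix.add_apply, Matrix.mul_apply, Matrix.transpose_apply]
    rw [hg.pd_g, Finset.sum_add_distrib]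
    congr 1
    exact Finset.sum_congr rfl fun e _ => by ring
  have h1 : dGi * G + Gi * dG = 0 := by
    ext i j
    simp only [Matrix.add_apply, Matrix.mul_apply, dGi, dG, Matrix.of_apply, Matrix.zero_apply]
    have : pd (fun y => ∑ b, (g y)⁻¹ i b * g y b j) c x = 0 := by
      simp_rw [hg.inv_mul]; exact pd_const _
    rw [pd_sum _ _ (fun k => (hg.sm_inv _ _).mul (hg.sm _ _))] at this
    rw [← this, ← Finset.sum_add_distrib]
    exact Finset.sum_congr rfl fun b _ => by rw [pd_mul (hg.sm_inv _ _) (hg.sm _ _)]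
  have hGG : G * Gi = 1 := Matrix.mul_nonsing_inv _ (hg.det x)
  have hGG' : Gi * G = 1 := Matrix.nonsing_inv_mul _ (hg.det x)
  have h2 : dGi = - (Γ * Gi + Gi * Γ.transpose) := by
    have := congrArg (· * Gi) h1
    simp only [add_mul, zero_mul, mul_assoc, hGG, mul_one, hdG, mul_add] at this
    rw [← mul_assoc Gi G, hGG', one_mul] at this
    rw [add_comm (Γ * Gi)]
    exact eq_neg_of_add_eq_zero_left this
  have h3 := congrFun (congrFun h2 a) b
  simp only [dGi, Matrix.of_apply, Matrix.neg_apply, Matrix.add_apply, Matrix.mul_apply,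
    Matrix.transpose_apply, Γ] at h3
  rw [h3, Finset.sum_add_distrib]
  congr 2
  exact Finset.sum_congr rfl fun e _ => by ring

end MetOK

/-! ### Operations -/

def oc {ι α : Type} (a : α) (f : ι → α) : Option ι → α := fun o => Option.elim o a f

@[simp] theorem oc_none {ι α : Type} (a : α) (f : ι → α) : oc a f none = a := rfl
@[simp] theorem oc_some {ι α : Type} (a : α) (f : ι → α) (i : ι) : oc a f (some i) = f i := rfl
theorem oc_comp_some {ι α : Type} (a : α) (f : ι → α) : (fun i => oc a f (some i)) = f := rfl

theorem oc_eta {ι α : Type} (f : Option ι → α) : oc (f none) (fun i => f (some i)) = f := by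
  ext o; cases o <;> rfl

theorem update_oc_none {ι α : Type} [DecidableEq ι] (a b : α) (f : ι → α) :
    Function.update (oc a f) none b = oc b f := by
  ext o; cases o <;> simp [Function.update]

theorem update_oc_some {ι α : Type} [DecidableEq ι] (a b : α) (f : ι → α) (i : ι) :
    Function.update (oc a f) (some i) b = oc a (Function.update f i b) := by
  ext o; cases o <;> simp [Function.update]

def nab {n : ℕ} {ι : Type} [Fintype ι] [DecidableEq ι] (g : MetricField n) (a : Fin n)
    (T : Ten n ι) : Ten n ι := fun x idx =>
  pd (fun y => T y idx) a x
    - ∑ m : ι, ∑ e : Fin n, christoffel g x e a (idx m) * T x (Function.update idx m e)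

def CD {n : ℕ} {ι : Type} [Fintype ι] [DecidableEq ι] (g : MetricField n)
    (T : Ten n ι) : Ten n (Option ι) := fun x idx => nab g (idx none) T x (fun i => idx (some i))

def rl {n : ℕ} {ι κ : Type} (e : ι ≃ κ) (T : Ten n ι) : Ten n κ := fun x idx => T x (fun i => idx (e i))

def tprod {n : ℕ} {ι κ : Type} (T : Ten n ι) (S : Ten n κ) : Ten n (ι ⊕ κ) := fun x idx =>
  T x (fun i => idx (Sum.inl i)) * S x (fun i => idx (Sum.inr i))

def ptr {n : ℕ} {ι : Type} (G : Matrix (Fin n) (Fin n) ℝ) (t : (Option (Option ι) → Fin n) → ℝ) :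
    (ι → Fin n) → ℝ := fun idx => ∑ a, ∑ b, G a b * t (oc a (oc b idx))

def tr {n : ℕ} {ι : Type} (g : MetricField n) (T : Ten n (Option (Option ι))) : Ten n ι :=
  fun x => ptr (g x)⁻¹ (T x)

section leib
variable {n : ℕ} {ι κ : Type} [Fintype ι] [DecidableEq ι] [Fintype κ] [DecidableEq κ]
  {g : MetricField n}

theorem Sm.rl {T : Ten n ι} (h : Sm T) (e : ι ≃ κ) : Sm (rl e T) := fun _ => h _
theorem Sm.tprod {T : Ten n ι} {S : Ten n κ} (h : Sm T) (h' : Sm S) : Sm (tprod T S) :=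
  fun _ => (h _).mul (h' _)
theorem Sm.tr (hg : MetOK g) {T : Ten n (Option (Option ι))} (h : Sm T) : Sm (tr g T) :=
  fun idx => by
    unfold VSI.tr ptr
    exact Smf.sum fun a => Smf.sum fun b => (hg.sm_inv a b).mul (h (oc a (oc b idx)))
theorem Sm.add {T S : Ten n ι} (h : Sm T) (h' : Sm S) : Sm (T + S) := fun _ => (h _).add (h' _)
theorem Sm.sub {T S : Ten n ι} (h : Sm T) (h' : Sm S) : Sm (T - S) := fun _ => (h _).sub (h' _)
theorem Sm.neg {T : Ten n ι} (h : Sm T) : Sm (-T) := fun _ => (h _).neg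
theorem Sm.zero : Sm (0 : Ten n ι) := fun _ => contDiff_const
theorem Sm.smul {T : Ten n ι} (c : ℝ) (h : Sm T) : Sm (c • T) := fun _ => contDiff_const.mul (h _)
theorem Sm.sum {α : Type*} {s : Finset α} {T : α → Ten n ι} (h : ∀ i, Sm (T i)) :
    Sm (∑ i ∈ s, T i) := by
  intro idx
  simp only [Finset.sum_apply]
  exact Smf.sum fun k => h k idx
theorem Sm.nab (hg : MetOK g) {T : Ten n ι} (h : Sm T) (a : Fin n) : Sm (nab g a T) := fun _ =>
  ((h _).pd _).sub (Smf.sum fun _ => Smf.sum fun _ => (hg.sm_chr _ _ _).mul (h _))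
theorem Sm.CD (hg : MetOK g) {T : Ten n ι} (h : Sm T) : Sm (CD g T) := fun _ => h.nab hg _ _

theorem nab_add {T S : Ten n ι} (h : Sm T) (h' : Sm S) (a : Fin n) :
    nab g a (T + S) = nab g a T + nab g a S := by
  funext x idx
  simp only [nab, Pi.add_apply]
  rw [pd_add (h _) (h' _)]
  simp only [mul_add, Finset.sum_add_distrib]; ring

theorem nab_smul {T : Ten n ι} (h : Sm T) (c : ℝ) (a : Fin n) :
    nab g a (c • T) = c • nab g a T := by
  funext x idx
  simp only [nab, Pi.smul_apply, smul_eq_mul]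
  rw [pd_const_mul _ (h _), mul_sub, Finset.mul_sum]
  congr 1
  refine Finset.sum_congr rfl fun _ _ => ?_
  rw [Finset.mul_sum]
  exact Finset.sum_congr rfl fun _ _ => by ring

theorem nab_zero (a : Fin n) : nab g a (0 : Ten n ι) = 0 := by
  funext x idx; simp [nab, pd_const]

theorem nab_rl (e : ι ≃ κ) (T : Ten n ι) (a : Fin n) : nab g a (rl e T) = rl e (nab g a T) := by
  funext x idx
  simp only [nab, rl]
  congr 1
  rw [← e.sum_comp]
  refine Finset.sum_congr rfl fun m _ => Finset.sum_congr rfl fun c _ => ?_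
  congr 2
  ext i
  simp [Function.update_apply]

theorem nab_tprod {T : Ten n ι} {S : Ten n κ} (h : Sm T) (h' : Sm S) (a : Fin n) :
    nab g a (tprod T S) = tprod (nab g a T) S + tprod T (nab g a S) := by
  funext x idx
  simp only [nab, tprod, Pi.add_apply]
  rw [pd_mul (h _) (h' _), Fintype.sum_sum_type]
  simp only [sub_mul, mul_sub, Finset.sum_mul, Finset.mul_sum]
  have e1 : ∀ (m : ι) (c : Fin n), (fun i => Function.update idx (Sum.inl m) c (Sum.inl i))
      = Function.update (fun i => idx (Sum.inl i)) m c := by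
    intro m c; ext i; simp [Function.update_apply]
  have e2 : ∀ (m : ι) (c : Fin n), (fun i => Function.update idx (Sum.inl m) c (Sum.inr i))
      = (fun i : κ => idx (Sum.inr i)) := by
    intro m c; ext i; simp [Function.update_apply]
  have e3 : ∀ (m : κ) (c : Fin n), (fun i => Function.update idx (Sum.inr m) c (Sum.inr i))
      = Function.update (fun i => idx (Sum.inr i)) m c := by
    intro m c; ext i; simp [Function.update_apply]
  have e4 : ∀ (m : κ) (c : Fin n), (fun i => Function.update idx (Sum.inr m) c (Sum.inl i))
      = (fun i : ι => idx (Sum.inl i)) := by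
    intro m c; ext i; simp [Function.update_apply]
  simp only [e1, e2, e3, e4]
  have f1 : ∀ (m : ι) (c : Fin n), christoffel g x c a (idx (Sum.inl m)) *
      (T x (Function.update (fun i => idx (Sum.inl i)) m c) * S x fun i => idx (Sum.inr i)) =
      christoffel g x c a (idx (Sum.inl m)) *
      T x (Function.update (fun i => idx (Sum.inl i)) m c) * S x fun i => idx (Sum.inr i) :=
    fun m c => by ring
  have f2 : ∀ (m : κ) (c : Fin n), christoffel g x c a (idx (Sum.inr m)) *
      ((T x fun i => idx (Sum.inl i)) * S x (Function.update (fun i => idx (Sum.inr i)) m c)) =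
      (T x fun i => idx (Sum.inl i)) * (christoffel g x c a (idx (Sum.inr m)) *
      S x (Function.update (fun i => idx (Sum.inr i)) m c)) :=
    fun m c => by ring
  simp only [f1, f2]
  ring

theorem nab_tr (hg : MetOK g) {T : Ten n (Option (Option ι))} (h : Sm T) (a : Fin n) :
    nab g a (tr g T) = tr g (nab g a T) := by
  funext x idx
  simp only [nab, tr, ptr]
  have key : pd (fun y => ∑ b, ∑ c, (g y)⁻¹ b c * T y (oc b (oc c idx))) a x =
      ∑ b, ∑ c, (-(∑ e, (christoffel g x b a e * (g x)⁻¹ e c + christoffel g x c a e * (g x)⁻¹ b e))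
        * T x (oc b (oc c idx)) + (g x)⁻¹ b c * pd (fun y => T y (oc b (oc c idx))) a x) := by
    rw [pd_sum _ _ (fun b => Smf.sum fun c => (hg.sm_inv b c).mul (h _))]
    refine Finset.sum_congr rfl fun b _ => ?_
    rw [pd_sum _ _ (fun c => (hg.sm_inv b c).mul (h _))]
    refine Finset.sum_congr rfl fun c _ => ?_
    rw [pd_mul (hg.sm_inv b c) (h _), hg.pd_gi]
  rw [key]
  simp_rw [Fintype.sum_option, update_oc_some, update_oc_none, oc_none, oc_some, oc_none]
  simp only [mul_sub, mul_add, Finset.sum_sub_distrib, Finset.sum_add_distrib, neg_mul,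
    Finset.sum_neg_distrib, Finset.sum_add_distrib, add_mul, Finset.sum_mul, Finset.mul_sum,
    Finset.sum_add_distrib]
  have e1 : ∑ b, ∑ c, ∑ e, christoffel g x b a e * (g x)⁻¹ e c * T x (oc b (oc c idx)) =
      ∑ b, ∑ c, ∑ e, (g x)⁻¹ b c * (christoffel g x e a b * T x (oc e (oc c idx))) := by
    rw [show ∑ b, ∑ c, ∑ e, christoffel g x b a e * (g x)⁻¹ e c * T x (oc b (oc c idx)) =
      ∑ b, ∑ e, ∑ c, christoffel g x b a e * (g x)⁻¹ e c * T x (oc b (oc c idx)) from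
      Finset.sum_congr rfl fun _ _ => Finset.sum_comm]
    rw [Finset.sum_comm]
    rw [show ∑ b, ∑ c, ∑ e, (g x)⁻¹ b c * (christoffel g x e a b * T x (oc e (oc c idx))) =
      ∑ b, ∑ e, ∑ c, (g x)⁻¹ b c * (christoffel g x e a b * T x (oc e (oc c idx))) from
      Finset.sum_congr rfl fun _ _ => Finset.sum_comm]
    exact Finset.sum_congr rfl fun _ _ => Finset.sum_congr rfl fun _ _ =>
      Finset.sum_congr rfl fun _ _ => by ring
  have e2 : ∑ b, ∑ c, ∑ e, christoffel g x c a e * (g x)⁻¹ b e * T x (oc b (oc c idx)) =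
      ∑ b, ∑ c, ∑ e, (g x)⁻¹ b c * (christoffel g x e a c * T x (oc b (oc e idx))) := by
    refine Finset.sum_congr rfl fun b _ => ?_
    rw [Finset.sum_comm]
    exact Finset.sum_congr rfl fun _ _ => Finset.sum_congr rfl fun _ _ => by ring
  have e3 : ∑ m, ∑ e, ∑ b, ∑ c, christoffel g x e a (idx m) *
        ((g x)⁻¹ b c * T x (oc b (oc c (Function.update idx m e)))) =
      ∑ b, ∑ c, ∑ m, ∑ e, (g x)⁻¹ b c * (christoffel g x e a (idx m) *
        T x (oc b (oc c (Function.update idx m e)))) := by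
    calc _ = ∑ m, ∑ b, ∑ e, ∑ c, christoffel g x e a (idx m) *
        ((g x)⁻¹ b c * T x (oc b (oc c (Function.update idx m e)))) :=
          Finset.sum_congr rfl fun _ _ => Finset.sum_comm
      _ = ∑ b, ∑ m, ∑ e, ∑ c, christoffel g x e a (idx m) *
        ((g x)⁻¹ b c * T x (oc b (oc c (Function.update idx m e)))) := Finset.sum_comm
      _ = ∑ b, ∑ m, ∑ c, ∑ e, christoffel g x e a (idx m) *
        ((g x)⁻¹ b c * T x (oc b (oc c (Function.update idx m e)))) :=
          Finset.sum_congr rfl fun _ _ => Finset.sum_congr rfl fun _ _ => Finset.sum_comm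
      _ = ∑ b, ∑ c, ∑ m, ∑ e, christoffel g x e a (idx m) *
        ((g x)⁻¹ b c * T x (oc b (oc c (Function.update idx m e)))) :=
          Finset.sum_congr rfl fun _ _ => Finset.sum_comm
      _ = _ := Finset.sum_congr rfl fun _ _ => Finset.sum_congr rfl fun _ _ =>
          Finset.sum_congr rfl fun _ _ => Finset.sum_congr rfl fun _ _ => by ring
  rw [e1, e2, e3]
  ring

end leib






/-! ### Evaluation of tensors on vectors -/

section evs
variable {n : ℕ} {ι κ : Type} [Fintype ι] [DecidableEq ι] [Fintype κ] [DecidableEq κ]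

def evM (t : (ι → Fin n) → ℝ) : MultilinearMap ℝ (fun _ : ι => Fin n → ℝ) ℝ :=
  ∑ idx, t idx • (MultilinearMap.mkPiAlgebra ℝ ι ℝ).compLinearMap
    (fun m => LinearMap.proj (R := ℝ) (φ := fun _ : Fin n => ℝ) (idx m))

theorem evM_apply (t : (ι → Fin n) → ℝ) (v : ι → Fin n → ℝ) :
    evM t v = ∑ idx, t idx * ∏ m, v m (idx m) := by
  simp [evM, sum_apply]

theorem evM_add (t s : (ι → Fin n) → ℝ) (v) : evM (t + s) v = evM t v + evM s v := by
  simp [evM_apply, add_mul, Finset.sum_add_distrib]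

theorem evM_neg (t : (ι → Fin n) → ℝ) (v) : evM (-t) v = - evM t v := by
  simp [evM_apply]

theorem evM_sub (t s : (ι → Fin n) → ℝ) (v) : evM (t - s) v = evM t v - evM s v := by
  rw [sub_eq_add_neg, evM_add, evM_neg]; ring

theorem evM_smul (c : ℝ) (t : (ι → Fin n) → ℝ) (v) : evM (c • t) v = c * evM t v := by
  simp [evM_apply, Finset.mul_sum, mul_assoc]

theorem evM_zero (v : ι → Fin n → ℝ) : evM (0 : (ι → Fin n) → ℝ) v = 0 := by
  simp [evM_apply]

theorem evM_sum {α : Type*} (s : Finset α) (t : α → (ι → Fin n) → ℝ) (v) :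
    evM (∑ i ∈ s, t i) v = ∑ i ∈ s, evM (t i) v := by
  simp only [evM_apply, Finset.sum_apply, Finset.sum_mul]
  exact Finset.sum_comm

def bas (a : Fin n) : Fin n → ℝ := Pi.single a 1

theorem evM_bas (t : (ι → Fin n) → ℝ) (idx : ι → Fin n) :
    evM t (fun m => bas (idx m)) = t idx := by
  rw [evM_apply, Finset.sum_eq_single idx]
  · simp [bas]
  · intro j _ hj
    obtain ⟨m, hm⟩ := Function.ne_iff.1 hj
    rw [Finset.prod_eq_zero (Finset.mem_univ m), mul_zero]
    simp [bas, Pi.single_apply, hm]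
  · simp

theorem sum_bas (v : Fin n → ℝ) : ∑ a, v a • bas a = v := by
  funext b; simp [bas, Finset.sum_apply, Pi.single_apply]

theorem evM_rl (e : ι ≃ κ) (t : (ι → Fin n) → ℝ) (v : κ → Fin n → ℝ) :
    evM (fun idx : κ → Fin n => t (fun i => idx (e i))) v = evM t (fun i => v (e i)) := by
  rw [evM_apply, evM_apply, ← (Equiv.arrowCongr e (Equiv.refl (Fin n))).sum_comp]
  refine Finset.sum_congr rfl fun idx _ => ?_
  rw [← e.prod_comp]
  simp [Equiv.arrowCongr]

theorem evM_tprod (t : (ι → Fin n) → ℝ) (s : (κ → Fin n) → ℝ) (v : ι ⊕ κ → Fin n → ℝ) :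
    evM (fun idx : ι ⊕ κ → Fin n => t (fun i => idx (Sum.inl i)) * s (fun i => idx (Sum.inr i))) v
      = evM t (fun i => v (Sum.inl i)) * evM s (fun i => v (Sum.inr i)) := by
  rw [evM_apply, evM_apply, evM_apply, Finset.sum_mul_sum, ← Fintype.sum_prod_type',
    ← (Equiv.sumArrowEquivProdArrow ι κ (Fin n)).symm.sum_comp]
  refine Finset.sum_congr rfl fun p _ => ?_
  simp only [Fintype.prod_sum_type, Equiv.sumArrowEquivProdArrow, Equiv.coe_fn_symm_mk,
    Sum.elim_inl, Sum.elim_inr]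
  ring

theorem sum_option_fun (f : (Option ι → Fin n) → ℝ) :
    ∑ idx, f idx = ∑ a, ∑ idx : ι → Fin n, f (oc a idx) := by
  rw [← Fintype.sum_prod_type', ← (Equiv.piOptionEquivProd (β := fun _ : Option ι => Fin n)).symm.sum_comp]
  refine Finset.sum_congr rfl fun p _ => ?_
  congr 1
  funext o; cases o <;> rfl

theorem evM_oc (t : (Option ι → Fin n) → ℝ) (X : Fin n → ℝ) (v : ι → Fin n → ℝ) :
    evM t (oc X v) = ∑ a, X a * evM (fun idx => t (oc a idx)) v := by
  rw [evM_apply, sum_option_fun]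
  refine Finset.sum_congr rfl fun a _ => ?_
  rw [evM_apply, Finset.mul_sum]
  refine Finset.sum_congr rfl fun idx _ => ?_
  simp only [Fintype.prod_option, oc_none, oc_some]
  ring

theorem evM_oc_bas (t : (Option ι → Fin n) → ℝ) (a : Fin n) (v : ι → Fin n → ℝ) :
    evM t (oc (bas a) v) = evM (fun idx => t (oc a idx)) v := by
  rw [evM_oc]; simp [bas, Pi.single_apply]

theorem evM_ptr (G : Matrix (Fin n) (Fin n) ℝ) (t : (Option (Option ι) → Fin n) → ℝ)
    (v : ι → Fin n → ℝ) :
    evM (ptr G t) v = ∑ a, ∑ b, G a b * evM t (oc (bas a) (oc (bas b) v)) := by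
  have : ptr G t = ∑ a, ∑ b, G a b • (fun idx => t (oc a (oc b idx))) := by
    funext idx; simp [ptr, Finset.sum_apply]
  rw [this, evM_sum]
  refine Finset.sum_congr rfl fun a _ => ?_
  rw [evM_sum]
  refine Finset.sum_congr rfl fun b _ => ?_
  rw [evM_smul, evM_oc_bas, evM_oc_bas]

theorem evM_oc_add (t : (Option ι → Fin n) → ℝ) (X Y : Fin n → ℝ) (v : ι → Fin n → ℝ) :
    evM t (oc (X + Y) v) = evM t (oc X v) + evM t (oc Y v) := by
  simp [evM_oc, add_mul, Finset.sum_add_distrib]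

theorem evM_oc_smul (t : (Option ι → Fin n) → ℝ) (c : ℝ) (X : Fin n → ℝ) (v : ι → Fin n → ℝ) :
    evM t (oc (c • X) v) = c * evM t (oc X v) := by
  simp [evM_oc, Finset.mul_sum, mul_assoc]

theorem evM_oc_sum {α : Type*} (s : Finset α) (t : (Option ι → Fin n) → ℝ) (X : α → Fin n → ℝ)
    (v : ι → Fin n → ℝ) : evM t (oc (∑ k ∈ s, X k) v) = ∑ k ∈ s, evM t (oc (X k) v) := by
  simp only [evM_oc, Finset.sum_apply, Finset.sum_mul]
  exact Finset.sum_comm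

theorem evM_ococ (t : (Option (Option ι) → Fin n) → ℝ) (X Y : Fin n → ℝ) (v : ι → Fin n → ℝ) :
    evM t (oc X (oc Y v)) = ∑ a, ∑ b, X a * Y b * evM (fun idx => t (oc a (oc b idx))) v := by
  rw [evM_oc]
  refine Finset.sum_congr rfl fun a _ => ?_
  rw [evM_oc, Finset.mul_sum]
  exact Finset.sum_congr rfl fun b _ => by ring

end evs

/-! ### Leibniz rule on vector fields -/

def nabV {n : ℕ} (g : MetricField n) (a : Fin n) (V : VecField n) (x : Pt n) (e : Fin n) : ℝ :=
  pd (fun y => V y e) a x + ∑ b, christoffel g x e a b * V x b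

section leib2
variable {n : ℕ} {ι : Type} [Fintype ι] [DecidableEq ι] {g : MetricField n}

theorem swap_sum (m : ι) (t : (ι → Fin n) → ℝ) (V : ι → Fin n → ℝ) (C : Fin n → Fin n → ℝ) :
    ∑ idx, (∑ e, C e (idx m) * t (Function.update idx m e)) * ∏ j, V j (idx j) =
    ∑ idx, t idx * ((∑ b, C (idx m) b * V m b) * ∏ j ∈ Finset.univ.erase m, V j (idx j)) := by
  have h1 : ∀ idx : ι → Fin n, (∑ e, C e (idx m) * t (Function.update idx m e)) * ∏ j, V j (idx j)
      = ∑ e, C e (idx m) * t (Function.update idx m e) * (V m (idx m) *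
          ∏ j ∈ Finset.univ.erase m, V j (idx j)) := by
    intro idx
    rw [Finset.mul_prod_erase Finset.univ (fun j => V j (idx j)) (Finset.mem_univ m), Finset.sum_mul]
  have h2 : ∀ idx : ι → Fin n, t idx * ((∑ b, C (idx m) b * V m b) *
      ∏ j ∈ Finset.univ.erase m, V j (idx j)) = ∑ b, t idx * (C (idx m) b * V m b *
      ∏ j ∈ Finset.univ.erase m, V j (idx j)) := by
    intro idx; rw [Finset.sum_mul, Finset.mul_sum]
  simp_rw [h1, h2]
  rw [← Fintype.sum_prod_type', ← Fintype.sum_prod_type']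
  let φ : ((ι → Fin n) × Fin n) → ((ι → Fin n) × Fin n) := fun p => (Function.update p.1 m p.2, p.1 m)
  have hφ : Function.Involutive φ := by
    intro p; simp [φ]
  rw [← Equiv.sum_comp (Function.Involutive.toPerm φ hφ)]
  refine Finset.sum_congr rfl fun p _ => ?_
  simp only [Function.Involutive.coe_toPerm, φ, Function.update_idem, Function.update_eq_self,
    Function.update_self]
  have : ∏ j ∈ Finset.univ.erase m, V j (Function.update p.1 m p.2 j) =
      ∏ j ∈ Finset.univ.erase m, V j (p.1 j) := by
    refine Finset.prod_congr rfl fun j hj => ?_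
    rw [Function.update_of_ne (Finset.ne_of_mem_erase hj)]
  rw [this]; ring

theorem pd_ev {T : Ten n ι} (hT : Sm T) (V : ι → VecField n) (hV : ∀ m, IsSmoothVec (V m))
    (a : Fin n) (x : Pt n) :
    pd (fun y => evM (T y) (fun m => V m y)) a x =
      evM (nab g a T x) (fun m => V m x) +
      ∑ m, evM (T x) (Function.update (fun m => V m x) m (nabV g a (V m) x)) := by
  have h1 : pd (fun y => evM (T y) (fun m => V m y)) a x =
      ∑ idx, (pd (fun y => T y idx) a x * ∏ m, V m x (idx m) +
        T x idx * ∑ m, pd (fun y => V m y (idx m)) a x *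
          ∏ j ∈ Finset.univ.erase m, V j x (idx j)) := by
    simp only [evM_apply]
    rw [pd_sum _ _ fun idx => (hT idx).mul (Smf.prod fun m => hV m (idx m))]
    refine Finset.sum_congr rfl fun idx _ => ?_
    rw [pd_mul (hT idx) (Smf.prod fun m => hV m (idx m)),
      pd_prod _ _ (fun m => hV m (idx m))]
  have h2 : ∀ m, evM (T x) (Function.update (fun m => V m x) m (nabV g a (V m) x)) =
      ∑ idx, T x idx * (pd (fun y => V m y (idx m)) a x *
        ∏ j ∈ Finset.univ.erase m, V j x (idx j)) +
      ∑ idx, T x idx * ((∑ b, christoffel g x (idx m) a b * V m x b) *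
        ∏ j ∈ Finset.univ.erase m, V j x (idx j)) := by
    intro m
    rw [evM_apply, ← Finset.sum_add_distrib]
    refine Finset.sum_congr rfl fun idx _ => ?_
    rw [← Finset.mul_prod_erase _ _ (Finset.mem_univ m)]
    have : ∏ j ∈ Finset.univ.erase m, Function.update (fun m => V m x) m (nabV g a (V m) x) j (idx j)
      = ∏ j ∈ Finset.univ.erase m, V j x (idx j) := by
      refine Finset.prod_congr rfl fun j hj => ?_
      rw [Function.update_of_ne (Finset.ne_of_mem_erase hj)]
    rw [this, Function.update_self, nabV]; ring
  have h3 : evM (nab g a T x) (fun m => V m x) =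
      ∑ idx, pd (fun y => T y idx) a x * ∏ m, V m x (idx m) -
      ∑ m, ∑ idx, T x idx * ((∑ b, christoffel g x (idx m) a b * V m x b) *
        ∏ j ∈ Finset.univ.erase m, V j x (idx j)) := by
    rw [evM_apply]
    simp only [nab, sub_mul, Finset.sum_sub_distrib, Finset.sum_mul]
    congr 1
    rw [Finset.sum_comm]
    refine Finset.sum_congr rfl fun m _ => ?_
    have := swap_sum m (T x) (fun m => V m x) (fun e b => christoffel g x e a b)
    simp only [Finset.sum_mul] at this
    exact this
  rw [h1, h3]
  simp_rw [h2, Finset.sum_add_distrib, Finset.mul_sum]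
  rw [Finset.sum_comm (f := fun idx m => T x idx * (pd (fun y => V m y (idx m)) a x *
    ∏ j ∈ Finset.univ.erase m, V j x (idx j)))]
  ring

/-! ### Tensoring with the metric -/

def pgc (G : Matrix (Fin n) (Fin n) ℝ) (t : (ι → Fin n) → ℝ) : (Option (Option ι) → Fin n) → ℝ :=
  fun idx => G (idx none) (idx (some none)) * t (fun i => idx (some (some i)))

def gc (g : MetricField n) (T : Ten n ι) : Ten n (Option (Option ι)) := fun x => pgc (g x) (T x)

theorem Sm.gc (hg : MetOK g) {T : Ten n ι} (h : Sm T) : Sm (gc g T) := fun idx => by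
  unfold VSI.gc pgc; exact (hg.sm _ _).mul (h _)

theorem nab_gc (hg : MetOK g) {T : Ten n ι} (h : Sm T) (a : Fin n) :
    nab g a (gc g T) = gc g (nab g a T) := by
  funext x idx
  obtain ⟨i, f, rfl⟩ : ∃ i f, idx = oc i f := ⟨_, _, (oc_eta idx).symm⟩
  obtain ⟨j, f, rfl⟩ : ∃ i f', f = oc i f' := ⟨_, _, (oc_eta f).symm⟩
  simp only [nab, gc, pgc, Fintype.sum_option, update_oc_some, update_oc_none, oc_none, oc_some]
  rw [pd_mul (hg.sm _ _) (h _), hg.pd_g, Finset.sum_add_distrib, mul_sub, Finset.mul_sum, add_mul,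
    Finset.sum_mul, Finset.sum_mul]
  simp only [Finset.mul_sum]
  have e1 : ∀ m e, christoffel g x e a (f m) * (g x i j * T x (Function.update f m e)) =
    g x i j * (christoffel g x e a (f m) * T x (Function.update f m e)) := fun m e => by ring
  simp only [e1, ← mul_assoc]
  ring

theorem evM_pgc (x : Pt n) (t : (ι → Fin n) → ℝ) (X Y : Fin n → ℝ) (v : ι → Fin n → ℝ) :
    evM (pgc (g x) t) (oc X (oc Y v)) = gdot g x X Y * evM t v := by
  rw [evM_ococ, gdot, Finset.sum_mul]
  refine Finset.sum_congr rfl fun a _ => ?_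
  rw [Finset.sum_mul]
  refine Finset.sum_congr rfl fun b _ => ?_
  have : (fun idx => pgc (g x) t (oc a (oc b idx))) = g x a b • t := by
    funext idx; simp [pgc]
  rw [this, evM_smul]; ring

theorem pd_gdot (hg : MetOK g) (V W : VecField n) (hV : IsSmoothVec V) (hW : IsSmoothVec W)
    (a : Fin n) (x : Pt n) :
    pd (fun y => gdot g y (V y) (W y)) a x =
      gdot g x (nabV g a V x) (W x) + gdot g x (V x) (nabV g a W x) := by
  let one : Ten n Empty := fun _ _ => 1
  have h1 : Sm one := fun _ => contDiff_const
  have hn : nab g a one = 0 := by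
    funext x idx; simp [nab, one, pd_const]
  have hv1 : ∀ y v, evM (one y) v = 1 := by
    intro y v; rw [evM_apply]; simp [one]
  let U : Option (Option Empty) → VecField n := oc V (oc W (fun e => e.elim))
  have hU : ∀ m, IsSmoothVec (U m) := by
    intro m; rcases m with _ | _ | m
    · exact hV
    · exact hW
    · exact m.elim
  have hUy : ∀ y, (fun m => U m y) = oc (V y) (oc (W y) (fun e => e.elim)) := by
    intro y; funext m; rcases m with _ | _ | m
    · rfl
    · rfl
    · exact m.elim
  have key := pd_ev (g := g) (h1.gc hg) U hU a x
  rw [nab_gc hg h1, hn] at key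
  simp only [hUy] at key
  have e0 : evM (gc g (0 : Ten n Empty) x) (oc (V x) (oc (W x) fun e => e.elim)) = 0 := by
    rw [gc, evM_pgc]; simp [evM_zero]
  rw [e0] at key
  simp only [Fintype.sum_option, update_oc_none, update_oc_some, gc, evM_pgc, hv1] at key
  simpa [U] using key

end leib2






/-! ### Background -/

structure Bg {n : ℕ} (g : MetricField n) (ℓ : VecField n) : Prop where
  ok : MetOK g
  sml : IsSmoothVec ℓ
  ne : ∀ x, ℓ x ≠ 0
  null : ∀ x, gdot g x (ℓ x) (ℓ x) = 0
  kundt : ∀ (x : Pt n) (X Y : Fin n → ℝ), gdot g x X (ℓ x) = 0 → gdot g x Y (ℓ x) = 0 →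
    (∑ a, ∑ b, X a * Y b * nablaLow g ℓ x b a) = 0
  aff : ∀ x a, (∑ b, ℓ x b * nablaLow g ℓ x b a) = 0

section gd
variable {n : ℕ} {g : MetricField n}

theorem gdot_add_left (x : Pt n) (X Y Z : Fin n → ℝ) :
    gdot g x (X + Y) Z = gdot g x X Z + gdot g x Y Z := by
  simp [gdot, mul_add, add_mul, Finset.sum_add_distrib]

theorem gdot_smul_left (x : Pt n) (c : ℝ) (X Z : Fin n → ℝ) :
    gdot g x (c • X) Z = c * gdot g x X Z := by
  simp only [gdot, Finset.mul_sum, Pi.smul_apply, smul_eq_mul]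
  exact Finset.sum_congr rfl fun _ _ => Finset.sum_congr rfl fun _ _ => by ring

theorem gdot_sum_left {α : Type*} (s : Finset α) (x : Pt n) (X : α → Fin n → ℝ) (Z : Fin n → ℝ) :
    gdot g x (∑ k ∈ s, X k) Z = ∑ k ∈ s, gdot g x (X k) Z := by
  classical
  induction s using Finset.induction_on with
  | empty => simp [gdot]
  | insert k s hk ih => rw [Finset.sum_insert hk, Finset.sum_insert hk, gdot_add_left, ih]

theorem gdot_symm (hg : MetOK g) (x : Pt n) (X Y : Fin n → ℝ) : gdot g x X Y = gdot g x Y X := by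
  unfold gdot
  rw [Finset.sum_comm]
  exact Finset.sum_congr rfl fun b _ => Finset.sum_congr rfl fun a _ => by rw [hg.symm x a b]; ring

theorem gdot_low (x : Pt n) (X : Fin n → ℝ) (ℓ : VecField n) :
    gdot g x X (ℓ x) = ∑ a, X a * lower g ℓ x a := by
  unfold gdot lower
  refine Finset.sum_congr rfl fun a _ => ?_
  rw [Finset.mul_sum]
  exact Finset.sum_congr rfl fun b _ => by ring

theorem gdot_bas (x : Pt n) (a : Fin n) (u : Fin n → ℝ) :
    gdot g x (bas a) u = ∑ b, g x a b * u b := by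
  unfold gdot
  rw [Finset.sum_eq_single a]
  · simp [bas]
  · intro b _ hb; simp [bas, Pi.single_apply, hb]
  · simp

theorem gdot_inj (hg : MetOK g) (x : Pt n) {u v : Fin n → ℝ}
    (h : ∀ a, gdot g x (bas a) u = gdot g x (bas a) v) : u = v := by
  simp only [gdot_bas] at h
  have h' : (g x).mulVec u = (g x).mulVec v := by
    funext a; exact h a
  have := congrArg (fun w => (g x)⁻¹.mulVec w) h'
  simpa [Matrix.mulVec_mulVec, Matrix.nonsing_inv_mul _ (hg.det x)] using this

end gd

section wt
variable {n : ℕ} {g : MetricField n} {ℓ : VecField n}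

def eta (g : MetricField n) (ℓ : VecField n) (x : Pt n) (a : Fin n) : ℝ :=
  lower g ℓ x a * (∑ b, lower g ℓ x b ^ 2)⁻¹

namespace Bg

theorem sm_lower (B : Bg g ℓ) (a : Fin n) : Smf fun x => lower g ℓ x a :=
  Smf.sum fun b => (B.ok.sm a b).mul (B.sml b)

theorem sq_pos (B : Bg g ℓ) (x : Pt n) : (∑ b, lower g ℓ x b ^ 2) ≠ 0 := by
  intro h
  rw [Finset.sum_eq_zero_iff_of_nonneg (fun _ _ => sq_nonneg _)] at h
  apply B.ne x
  apply gdot_inj B.ok x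
  intro a
  rw [gdot_bas]
  have := h a (Finset.mem_univ a)
  have h2 : lower g ℓ x a = 0 := by simpa using this
  rw [show ∑ b, g x a b * ℓ x b = lower g ℓ x a from rfl, h2, gdot_bas]; simp

theorem sm_eta (B : Bg g ℓ) : IsSmoothVec (eta g ℓ) := fun a =>
  (B.sm_lower a).mul (ContDiff.inv (Smf.sum fun b => (B.sm_lower b).pow 2) B.sq_pos)

theorem eta_l (B : Bg g ℓ) (x : Pt n) : gdot g x (eta g ℓ x) (ℓ x) = 1 := by
  rw [gdot_low]
  have : ∀ a, eta g ℓ x a * lower g ℓ x a = lower g ℓ x a ^ 2 * (∑ b, lower g ℓ x b ^ 2)⁻¹ :=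
    fun a => by unfold eta; ring
  simp_rw [this]
  rw [← Finset.sum_mul, mul_inv_cancel₀ (B.sq_pos x)]

theorem pi_perp (B : Bg g ℓ) (x : Pt n) (v : Fin n → ℝ) :
    gdot g x (v + (-(gdot g x v (ℓ x))) • eta g ℓ x) (ℓ x) = 0 := by
  rw [gdot_add_left, gdot_smul_left, B.eta_l]; ring

theorem decomp (x : Pt n) (v : Fin n → ℝ) :
    v = (gdot g x v (ℓ x)) • eta g ℓ x + (v + (-(gdot g x v (ℓ x))) • eta g ℓ x) := by
  funext a; simp

theorem prop_of_perp (B : Bg g ℓ) (x : Pt n) (u : Fin n → ℝ)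
    (h : ∀ Y, gdot g x Y (ℓ x) = 0 → gdot g x Y u = 0) : ∃ c : ℝ, u = c • ℓ x := by
  refine ⟨gdot g x (eta g ℓ x) u, gdot_inj B.ok x fun a => ?_⟩
  have := h _ (B.pi_perp x (bas a))
  rw [gdot_add_left, gdot_smul_left] at this
  rw [gdot_symm B.ok x (bas a) (_ • _), gdot_smul_left, gdot_symm B.ok x (ℓ x)]
  linarith

theorem nablaLow_eq (B : Bg g ℓ) (x : Pt n) (b a : Fin n) :
    nablaLow g ℓ x b a = gdot g x (bas a) (nabV g b ℓ x) := by
  have h := pd_gdot B.ok (fun _ => bas a) ℓ (fun e => contDiff_const) B.sml b x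
  have e1 : (fun y => gdot g y (bas a) (ℓ y)) = fun y => lower g ℓ y a := by
    funext y; rw [gdot_bas]; rfl
  rw [e1] at h
  have e2 : gdot g x (nabV g b (fun _ => bas a) x) (ℓ x) =
      ∑ e, christoffel g x e b a * lower g ℓ x e := by
    rw [gdot_low]
    refine Finset.sum_congr rfl fun e _ => ?_
    congr 1
    simp [nabV, pd_const, bas, Pi.single_apply]
  rw [e2] at h
  unfold nablaLow covD lowerField
  simp only [Fin.isValue, Matrix.cons_val_zero, Finset.univ_unique, Fin.default_eq_zero,
    Finset.sum_singleton, Function.update_self, Fin.succ_zero_eq_one, Matrix.cons_val_one]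
  rw [h]; ring

/-- covariant derivative of `ℓ` along `X`. -/
theorem nX_perp (B : Bg g ℓ) (x : Pt n) (X : Fin n → ℝ) :
    gdot g x (∑ a, X a • nabV g a ℓ x) (ℓ x) = 0 := by
  rw [gdot_sum_left]
  refine Finset.sum_eq_zero fun a _ => ?_
  rw [gdot_smul_left]
  have h := pd_gdot B.ok ℓ ℓ B.sml B.sml a x
  simp only [B.null] at h
  rw [pd_const, gdot_symm B.ok x (ℓ x)] at h
  have : gdot g x (nabV g a ℓ x) (ℓ x) = 0 := by linarith
  rw [this, mul_zero]

theorem gdot_nX (B : Bg g ℓ) (x : Pt n) (X Y : Fin n → ℝ) :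
    gdot g x Y (∑ b, X b • nabV g b ℓ x) = ∑ a, ∑ b, Y a * X b * nablaLow g ℓ x b a := by
  simp_rw [B.nablaLow_eq]
  rw [gdot_symm B.ok, gdot_sum_left, Finset.sum_comm]
  refine Finset.sum_congr rfl fun b _ => ?_
  rw [gdot_smul_left, gdot_symm B.ok]
  conv_lhs => rw [← sum_bas Y, gdot_sum_left, Finset.mul_sum]
  refine Finset.sum_congr rfl fun a _ => ?_
  rw [gdot_smul_left]; ring

theorem nX_prop (B : Bg g ℓ) (x : Pt n) (X : Fin n → ℝ) (hX : gdot g x X (ℓ x) = 0) :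
    ∃ c : ℝ, (∑ a, X a • nabV g a ℓ x) = c • ℓ x := by
  refine B.prop_of_perp x _ fun Y hY => ?_
  rw [B.gdot_nX]; exact B.kundt x Y X hY hX

theorem nl_l (B : Bg g ℓ) (x : Pt n) : (∑ a, ℓ x a • nabV g a ℓ x) = 0 := by
  apply gdot_inj B.ok x
  intro a
  rw [gdot_symm B.ok, gdot_sum_left]
  have := B.aff x a
  simp_rw [B.nablaLow_eq] at this
  simp_rw [gdot_smul_left, gdot_symm B.ok x _ (bas a), this]
  rw [gdot_bas]; simp

end Bg

/-! ### Weights -/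

def Wt (g : MetricField n) (ℓ : VecField n) (x : Pt n) (w : ℤ) (v : Fin n → ℝ) : Prop :=
  (0 ≤ w → gdot g x v (ℓ x) = 0) ∧ (1 ≤ w → ∃ c : ℝ, v = c • ℓ x) ∧ (2 ≤ w → v = 0)

theorem Wt.neg_one {x : Pt n} (v : Fin n → ℝ) {w : ℤ} (hw : w ≤ -1) : Wt g ℓ x w v :=
  ⟨fun h => by omega, fun h => by omega, fun h => by omega⟩

theorem Wt.zero' {x : Pt n} (w : ℤ) : Wt g ℓ x w 0 :=
  ⟨fun _ => by simp [gdot], fun _ => ⟨0, by simp⟩, fun _ => rfl⟩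

theorem Wt.perp {x : Pt n} {v : Fin n → ℝ} (h : gdot g x v (ℓ x) = 0) : Wt g ℓ x 0 v :=
  ⟨fun _ => h, fun h => by omega, fun h => by omega⟩

theorem Wt.l (B : Bg g ℓ) {x : Pt n} (c : ℝ) : Wt g ℓ x 1 (c • ℓ x) :=
  ⟨fun _ => by rw [gdot_smul_left, B.null, mul_zero], fun _ => ⟨c, rfl⟩, fun h => by omega⟩

theorem Wt.mono {x : Pt n} {v : Fin n → ℝ} {w w' : ℤ} (h : Wt g ℓ x w v) (hw : w' ≤ w) :
    Wt g ℓ x w' v := ⟨fun h' => h.1 (by omega), fun h' => h.2.1 (by omega), fun h' => h.2.2 (by omega)⟩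

theorem Wt.ext (B : Bg g ℓ) {x : Pt n} {w : ℤ} {v : Fin n → ℝ} (h : Wt g ℓ x w v) :
    ∃ V : VecField n, IsSmoothVec V ∧ V x = v ∧ (∀ y, Wt g ℓ y w (V y)) ∧
      ∀ (X : Fin n → ℝ) (u : ℤ), u ≤ 0 → Wt g ℓ x u X →
        Wt g ℓ x (w + u) (∑ a, X a • nabV g a V x) := by
  rcases lt_or_ge w 0 with hw | hw
  · exact ⟨fun _ => v, fun e => contDiff_const, rfl, fun y => Wt.neg_one _ (by omega),
      fun X u hu _ => Wt.neg_one _ (by omega)⟩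
  rcases eq_or_lt_of_le hw with hw0 | hw1
  · subst hw0
    have hv := h.1 le_rfl
    let V : VecField n := fun y => v + (-(gdot g y v (ℓ y))) • eta g ℓ y
    have sV : IsSmoothVec V := by
      intro e
      refine ContDiff.add contDiff_const (ContDiff.mul (ContDiff.neg ?_) (B.sm_eta e))
      unfold gdot
      exact Smf.sum fun a => Smf.sum fun b =>
        ((B.ok.sm a b).mul contDiff_const).mul (B.sml b)
    have hp : ∀ y, gdot g y (V y) (ℓ y) = 0 := fun y => B.pi_perp y v
    refine ⟨V, sV, by simp [V, hv], fun y => Wt.perp (hp y), fun X u hu hX => ?_⟩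
    rcases eq_or_lt_of_le hu with h0 | h0
    · subst h0
      refine Wt.perp ?_
      rw [gdot_sum_left]
      obtain ⟨c, hc⟩ := B.nX_prop x X (hX.1 le_rfl)
      have h1 : ∀ a, gdot g x (nabV g a V x) (ℓ x) = - gdot g x (nabV g a ℓ x) (V x) := by
        intro a
        have := pd_gdot B.ok V ℓ sV B.sml a x
        simp only [hp] at this
        rw [pd_const, gdot_symm B.ok x (V x)] at this
        linarith
      simp_rw [gdot_smul_left, h1]
      have h2 : gdot g x (∑ a, X a • nabV g a ℓ x) (V x) = 0 := by
        rw [hc, gdot_smul_left, gdot_symm B.ok, hp, mul_zero]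
      rw [gdot_sum_left] at h2
      simp_rw [gdot_smul_left] at h2
      simp only [mul_neg, Finset.sum_neg_distrib, h2, neg_zero]
    · exact Wt.neg_one _ (by omega)
  rcases eq_or_lt_of_le (show 1 ≤ w by omega) with hw0 | hw2
  · subst hw0
    obtain ⟨c, rfl⟩ := h.2.1 le_rfl
    refine ⟨fun y => c • ℓ y, fun e => contDiff_const.mul (B.sml e), rfl, fun y => Wt.l B c,
      fun X u hu hX => ?_⟩
    have hn : ∀ a, nabV g a (fun y => c • ℓ y) x = c • nabV g a ℓ x := by
      intro a; funext e
      simp only [nabV, Pi.smul_apply, smul_eq_mul]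
      rw [pd_const_mul _ (B.sml e), mul_add, Finset.mul_sum]
      congr 1
      exact Finset.sum_congr rfl fun _ _ => by ring
    have : ∑ a, X a • nabV g a (fun y => c • ℓ y) x = c • ∑ a, X a • nabV g a ℓ x := by
      simp_rw [hn]; rw [Finset.smul_sum]
      exact Finset.sum_congr rfl fun _ _ => smul_comm _ _ _
    rw [this]
    rcases eq_or_lt_of_le hu with h0 | h0
    · subst h0
      obtain ⟨d, hd⟩ := B.nX_prop x X (hX.1 le_rfl)
      rw [hd, smul_smul]
      simpa using Wt.l (x := x) B (c * d)
    · refine Wt.mono (w := 0) (Wt.perp ?_) (by omega)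
      rw [gdot_smul_left, B.nX_perp, mul_zero]
  · have := h.2.2 (by omega)
    subst this
    have hn : ∀ a, nabV g a (fun _ => (0 : Fin n → ℝ)) x = 0 := by
      intro a; funext e; simp [nabV, pd_const]
    refine ⟨fun _ => 0, fun e => contDiff_const, rfl, fun y => Wt.zero' _, fun X u hu _ => ?_⟩
    simp_rw [hn]
    simpa using Wt.zero' _

end wt

/-! ### Filtration -/

section fil
variable {n : ℕ} {g : MetricField n} {ℓ : VecField n}
  {ι κ : Type} [Fintype ι] [DecidableEq ι] [Fintype κ] [DecidableEq κ]

def FilQ (g : MetricField n) (ℓ : VecField n) (x : Pt n) (Q : Set ι) (c : ℤ)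
    (t : (ι → Fin n) → ℝ) : Prop :=
  ∀ (w : ι → ℤ) (v : ι → Fin n → ℝ), (∀ m, Wt g ℓ x (w m) (v m)) → (∀ m ∈ Q, w m ≤ 0) →
    c < ∑ m, w m → evM t v = 0

variable {x : Pt n} {Q Q' : Set ι} {c c' : ℤ} {t s : (ι → Fin n) → ℝ}

theorem FilQ.add (h : FilQ g ℓ x Q c t) (h' : FilQ g ℓ x Q c s) : FilQ g ℓ x Q c (t + s) :=
  fun w v a b d => by rw [evM_add, h w v a b d, h' w v a b d, add_zero]
theorem FilQ.neg (h : FilQ g ℓ x Q c t) : FilQ g ℓ x Q c (-t) :=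
  fun w v a b d => by rw [evM_neg, h w v a b d, neg_zero]
theorem FilQ.smul (r : ℝ) (h : FilQ g ℓ x Q c t) : FilQ g ℓ x Q c (r • t) :=
  fun w v a b d => by rw [evM_smul, h w v a b d, mul_zero]
theorem FilQ.zero : FilQ g ℓ x Q c 0 := fun w v _ _ _ => by rw [evM_zero]
theorem FilQ.mono (h : FilQ g ℓ x Q c t) (hc : c ≤ c') (hQ : Q ⊆ Q') : FilQ g ℓ x Q' c' t :=
  fun w v a b d => h w v a (fun m hm => b m (hQ hm)) (lt_of_le_of_lt hc d)
theorem FilQ.rl (e : ι ≃ κ) (h : FilQ g ℓ x Q c t) :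
    FilQ g ℓ x (e '' Q) c (fun idx => t (fun i => idx (e i))) := fun w v a b d => by
  rw [evM_rl]
  refine h (fun i => w (e i)) _ (fun m => a _) (fun m hm => b _ ⟨m, hm, rfl⟩) ?_
  rwa [e.sum_comp]
theorem Fil.rl (e : ι ≃ κ) (h : FilQ g ℓ x ∅ c t) :
    FilQ g ℓ x ∅ c (fun idx => t (fun i => idx (e i))) := by
  have := h.rl e; rwa [Set.image_empty] at this
theorem Fil.tprod {t : (ι → Fin n) → ℝ} {s : (κ → Fin n) → ℝ}
    (h : FilQ g ℓ x ∅ c t) (h' : FilQ g ℓ x ∅ c' s) :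
    FilQ g ℓ x ∅ (c + c') (fun idx => t (fun i => idx (Sum.inl i)) * s (fun i => idx (Sum.inr i))) :=
  fun w v a b d => by
  rw [evM_tprod]
  rw [Fintype.sum_sum_type] at d
  rcases lt_or_ge c (∑ i, w (Sum.inl i)) with h1 | h1
  · rw [h _ _ (fun m => a _) (by simp) h1, zero_mul]
  · rw [h' (fun i => w (Sum.inr i)) _ (fun m => a _) (by simp) (by linarith), mul_zero]

theorem sum_oc (a : ℤ) (w : ι → ℤ) : ∑ m, oc a w m = a + ∑ m, w m := by
  rw [Fintype.sum_option]; rfl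

theorem Fil.ptr (B : Bg g ℓ) {t : (Option (Option ι) → Fin n) → ℝ} (h : FilQ g ℓ x ∅ c t) :
    FilQ g ℓ x ∅ c (ptr (g x)⁻¹ t) := fun w v hw _ hd => by
  have H : ∀ (i j : ℤ) (X Y : Fin n → ℝ), i + j = 0 → Wt g ℓ x i X → Wt g ℓ x j Y →
      evM t (oc X (oc Y v)) = 0 := by
    intro i j X Y hij hX hY
    refine h (oc i (oc j w)) _ ?_ (by simp) ?_
    · rintro (_ | _ | m)
      · exact hX
      · exact hY
      · exact hw m
    · rw [sum_oc, sum_oc]; omega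
  have Wη : Wt g ℓ x (-1) (eta g ℓ x) := Wt.neg_one _ le_rfl
  have Wl : Wt g ℓ x 1 (ℓ x) := by simpa using Wt.l (x := x) B 1
  rw [evM_ptr]
  set p : Fin n → Fin n → ℝ := fun a => bas a + (-(gdot g x (bas a) (ℓ x))) • eta g ℓ x with hp
  have Wp : ∀ a, Wt g ℓ x 0 (p a) := fun a => Wt.perp (B.pi_perp x _)
  have hb : ∀ a, bas a = lower g ℓ x a • eta g ℓ x + p a := by
    intro a
    have := Bg.decomp (g := g) (ℓ := ℓ) x (bas a)
    rw [gdot_bas] at this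
    simp only [hp]; rw [gdot_bas]; exact this
  have raise : ∀ b, ∑ a, (g x)⁻¹ a b * lower g ℓ x a = ℓ x b := by
    intro b
    unfold lower
    simp_rw [Finset.mul_sum]
    rw [Finset.sum_comm]
    have : ∀ d, ∑ a, (g x)⁻¹ a b * (g x a d * ℓ x d) = (if b = d then 1 else 0) * ℓ x d := by
      intro d
      rw [← B.ok.inv_mul x b d, Finset.sum_mul]
      exact Finset.sum_congr rfl fun a _ => by rw [B.ok.inv_symm x a b]; ring
    simp_rw [this]; simp
  have hl : ∑ b, ℓ x b • bas b = ℓ x := sum_bas _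
  have S0 : ∀ a b, evM t (oc (bas a) (oc (bas b) v)) =
      lower g ℓ x a * evM t (oc (eta g ℓ x) (oc (bas b) v)) +
      lower g ℓ x b * evM t (oc (p a) (oc (eta g ℓ x) v)) := by
    intro a b
    have e1 : ∀ X : Fin n → ℝ, evM t (oc X (oc (bas b) v)) =
      lower g ℓ x b * evM t (oc X (oc (eta g ℓ x) v)) + evM t (oc X (oc (p b) v)) := by
      intro X
      rw [hb b, evM_oc, evM_oc, evM_oc, Finset.mul_sum, ← Finset.sum_add_distrib]
      refine Finset.sum_congr rfl fun k _ => ?_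
      rw [evM_oc_add, evM_oc_smul]; ring
    conv_lhs => rw [hb a, evM_oc_add, evM_oc_smul]
    rw [e1 (p a), H 0 0 (p a) (p b) rfl (Wp a) (Wp b), add_zero]
  have S1 : ∑ a, ∑ b, (g x)⁻¹ a b * (lower g ℓ x a * evM t (oc (eta g ℓ x) (oc (bas b) v))) = 0 := by
    rw [Finset.sum_comm]
    have : ∀ b, ∑ a, (g x)⁻¹ a b * (lower g ℓ x a * evM t (oc (eta g ℓ x) (oc (bas b) v))) =
        ℓ x b * evM t (oc (eta g ℓ x) (oc (bas b) v)) := by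
      intro b; rw [← raise b, Finset.sum_mul]
      exact Finset.sum_congr rfl fun a _ => by ring
    simp_rw [this]
    rw [← H (-1) 1 _ _ (by norm_num) Wη Wl, evM_oc]
    simp_rw [evM_oc (X := eta g ℓ x), Finset.mul_sum]
    rw [Finset.sum_comm]
    refine Finset.sum_congr rfl fun k _ => ?_
    rw [← hl, evM_oc_sum, Finset.mul_sum]
    refine Finset.sum_congr rfl fun b _ => ?_
    rw [evM_oc_smul, hl]; ring
  have S2 : ∑ a, ∑ b, (g x)⁻¹ a b * (lower g ℓ x b * evM t (oc (p a) (oc (eta g ℓ x) v))) = 0 := by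
    have : ∀ a, ∑ b, (g x)⁻¹ a b * (lower g ℓ x b * evM t (oc (p a) (oc (eta g ℓ x) v))) =
        ℓ x a * evM t (oc (p a) (oc (eta g ℓ x) v)) := by
      intro a; rw [← raise a, Finset.sum_mul]
      exact Finset.sum_congr rfl fun b _ => by rw [B.ok.inv_symm x a b]; ring
    simp_rw [this]
    have hpl : ∑ a, ℓ x a • p a = ℓ x := by
      have h0 : ∑ a, ℓ x a • p a = ℓ x + (-(gdot g x (ℓ x) (ℓ x))) • eta g ℓ x := by
        simp only [hp, smul_add, Finset.sum_add_distrib, hl, smul_smul, ← Finset.sum_smul]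
        congr 2
        conv_rhs => rw [← hl]
        rw [gdot_sum_left, hl, ← Finset.sum_neg_distrib]
        exact Finset.sum_congr rfl fun a _ => by rw [gdot_smul_left]; ring
      rw [h0, B.null]; simp
    rw [← H 1 (-1) _ _ (by norm_num) Wl Wη]
    conv_rhs => rw [← hpl, evM_oc_sum]
    exact Finset.sum_congr rfl fun a _ => by rw [evM_oc_smul]
  simp_rw [S0, mul_add, Finset.sum_add_distrib]
  rw [S1, S2, add_zero]

theorem Fil.pgc (B : Bg g ℓ) (h : FilQ g ℓ x ∅ c t) : FilQ g ℓ x ∅ c (pgc (g x) t) := by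
  intro w v hw _ hd
  have hv : v = oc (v none) (oc (v (some none)) fun i => v (some (some i))) := by
    funext o; rcases o with _ | _ | o <;> rfl
  rw [hv, evM_pgc]
  rw [Fintype.sum_option, Fintype.sum_option] at hd
  have h1 := hw none
  have h2 := hw (some none)
  by_cases h3 : w none + w (some none) ≤ 0
  · rw [h (fun i => w (some (some i))) _ (fun m => hw _) (by simp) (by omega), mul_zero]
  · have : gdot g x (v none) (v (some none)) = 0 := by
      rcases le_or_gt (w (some none)) 0 with h4 | h4
      · rcases lt_or_ge (w (some none)) 0 with h5 | h5
        · rw [h1.2.2 (by omega)]; simp [gdot]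
        · obtain ⟨d, hd⟩ := h1.2.1 (by omega)
          rw [hd, gdot_smul_left, gdot_symm B.ok, h2.1 h5, mul_zero]
      · rcases le_or_gt (w none) (-1) with h5 | h5
        · rw [h2.2.2 (by omega)]; simp [gdot]
        · obtain ⟨d, hd⟩ := h2.2.1 (by omega)
          rw [hd, gdot_symm B.ok, gdot_smul_left, gdot_symm B.ok, h1.1 (by omega), mul_zero]
    rw [this, zero_mul]

def DD (g : MetricField n) (ℓ : VecField n) (T : Ten n ι) : Ten n ι := fun x idx =>
  ∑ a, ℓ x a * nab g a T x idx

theorem evM_CD (T : Ten n ι) (X : Fin n → ℝ) (v : ι → Fin n → ℝ) :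
    evM (CD g T x) (oc X v) = ∑ a, X a * evM (nab g a T x) v := by
  rw [evM_oc]; rfl

theorem evM_DD (T : Ten n ι) (v : ι → Fin n → ℝ) :
    evM (DD g ℓ T x) v = evM (CD g T x) (oc (ℓ x) v) := by
  rw [evM_CD]
  have : DD g ℓ T x = ∑ a, ℓ x a • nab g a T x := by
    funext idx; simp [DD, Finset.sum_apply]
  rw [this, evM_sum]
  exact Finset.sum_congr rfl fun a _ => evM_smul _ _ _

/-- Lemma 1. -/
theorem Fil.CDQ (B : Bg g ℓ) {T : Ten n ι} (hT : Sm T) (h : ∀ y, FilQ g ℓ y ∅ c (T y)) :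
    FilQ g ℓ x {none} c (CD g T x) := by
  intro w v hw hQ hd
  have hu : w none ≤ 0 := hQ none rfl
  rw [← oc_eta v, evM_CD]
  rw [Fintype.sum_option] at hd
  choose V sV hVx hVw hVn using fun m => Wt.ext B (hw (some m))
  have h0 : (fun y => evM (T y) (fun m => V m y)) = fun _ => 0 := by
    funext y
    exact h y (fun m => w (some m)) _ (fun m => hVw m y) (by simp) (by omega)
  have h1 : ∀ a, evM (nab g a T x) (fun i => v (some i)) =
      - ∑ m, evM (T x) (Function.update (fun m => v (some m)) m (nabV g a (V m) x)) := by
    intro a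
    have := pd_ev (g := g) hT V sV a x
    rw [h0, pd_const] at this
    simp only [hVx] at this
    linarith
  simp_rw [h1, mul_neg, Finset.mul_sum]
  rw [Finset.sum_neg_distrib, Finset.sum_comm, neg_eq_zero]
  refine Finset.sum_eq_zero fun m _ => ?_
  have h2 : ∑ a, v none a * evM (T x) (Function.update (fun m => v (some m)) m (nabV g a (V m) x)) =
      evM (T x) (Function.update (fun m => v (some m)) m (∑ a, v none a • nabV g a (V m) x)) := by
    rw [MultilinearMap.map_update_sum]
    exact Finset.sum_congr rfl fun a _ => by rw [MultilinearMap.map_update_smul]; rfl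
  rw [h2]
  refine h x (Function.update (fun m => w (some m)) m (w (some m) + w none)) _ ?_ (by simp) ?_
  · intro k
    by_cases hk : k = m
    · subst hk; simp only [Function.update_self]; exact hVn k _ _ hu (hw none)
    · simp only [Function.update_of_ne hk]; exact hw (some k)
  · rw [Finset.sum_update_of_mem (Finset.mem_univ m)]
    have := Finset.add_sum_erase Finset.univ (fun m => w (some m)) (Finset.mem_univ m)
    rw [Finset.erase_eq] at this
    omega

theorem Fil.DD (B : Bg g ℓ) {T : Ten n ι} (hT : Sm T) (h : ∀ y, FilQ g ℓ y ∅ c (T y)) :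
    FilQ g ℓ x ∅ c (DD g ℓ T x) := by
  intro w v hw _ hd
  rw [evM_DD]
  refine Fil.CDQ B hT h (oc 0 w) _ ?_ (by simp) (by rw [sum_oc]; omega)
  rintro (_ | m)
  · exact Wt.perp (B.null x)
  · exact hw m

theorem Fil.CD (B : Bg g ℓ) {T : Ten n ι} (hT : Sm T) (h : ∀ y, FilQ g ℓ y ∅ c (T y))
    (h' : FilQ g ℓ x ∅ (c - 1) (VSI.DD g ℓ T x)) : FilQ g ℓ x ∅ c (CD g T x) := by
  intro w v hw _ hd
  by_cases hu : w none ≤ 0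
  · exact Fil.CDQ B hT h w v hw (by rintro m rfl; exact hu) hd
  · obtain ⟨d, hd'⟩ := (hw none).2.1 (by omega)
    by_cases h2 : 2 ≤ w none
    · have := (hw none).2.2 h2
      rw [← oc_eta v, this, evM_CD]; simp
    · rw [← oc_eta v, hd', evM_oc_smul, ← evM_DD]
      rw [Fintype.sum_option] at hd
      rw [h' (fun i => w (some i)) _ (fun m => hw _) (by simp) (by omega), mul_zero]

end fil






/-! ### Derivative rules for `DD` and `CD` -/

section drules
variable {n : ℕ} {g : MetricField n} {ℓ : VecField n}
  {ι κ : Type} [Fintype ι] [DecidableEq ι] [Fintype κ] [DecidableEq κ]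

theorem rl_add (e : ι ≃ κ) (T S : Ten n ι) : rl e (T + S) = rl e T + rl e S := rfl
theorem rl_sub (e : ι ≃ κ) (T S : Ten n ι) : rl e (T - S) = rl e T - rl e S := rfl
theorem rl_neg (e : ι ≃ κ) (T : Ten n ι) : rl e (-T) = - rl e T := rfl
theorem rl_smul (e : ι ≃ κ) (c : ℝ) (T : Ten n ι) : rl e (c • T) = c • rl e T := rfl
theorem rl_zero (e : ι ≃ κ) : rl e (0 : Ten n ι) = 0 := rfl
theorem rl_sum {α : Type*} (s : Finset α) (e : ι ≃ κ) (T : α → Ten n ι) :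
    rl e (∑ i ∈ s, T i) = ∑ i ∈ s, rl e (T i) := by
  funext x idx; simp [rl, Finset.sum_apply]
theorem rl_rl {μ : Type} (e : ι ≃ κ) (f : κ ≃ μ) (T : Ten n ι) : rl f (rl e T) = rl (e.trans f) T := rfl
theorem rl_refl (T : Ten n ι) : rl (Equiv.refl ι) T = T := rfl

theorem tr_add (T S : Ten n (Option (Option ι))) : tr g (T + S) = tr g T + tr g S := by
  funext x idx; simp [tr, ptr, mul_add, Finset.sum_add_distrib]
theorem tr_smul (c : ℝ) (T : Ten n (Option (Option ι))) : tr g (c • T) = c • tr g T := by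
  funext x idx; simp only [tr, ptr, Pi.smul_apply, smul_eq_mul, Finset.mul_sum]
  exact Finset.sum_congr rfl fun _ _ => Finset.sum_congr rfl fun _ _ => by ring
theorem tr_neg (T : Ten n (Option (Option ι))) : tr g (-T) = - tr g T := by
  have := tr_smul (g := g) (-1) T; simpa using this
theorem tr_sub (T S : Ten n (Option (Option ι))) : tr g (T - S) = tr g T - tr g S := by
  rw [sub_eq_add_neg, tr_add, tr_neg, sub_eq_add_neg]
theorem tr_zero : tr g (0 : Ten n (Option (Option ι))) = 0 := by
  funext x idx; simp [tr, ptr]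
theorem tr_sum {α : Type*} (s : Finset α) (T : α → Ten n (Option (Option ι))) :
    tr g (∑ i ∈ s, T i) = ∑ i ∈ s, tr g (T i) := by
  classical
  induction s using Finset.induction_on with
  | empty => simp [tr_zero]
  | insert k s hk ih => rw [Finset.sum_insert hk, Finset.sum_insert hk, tr_add, ih]
theorem tr_rl (e : ι ≃ κ) (T : Ten n (Option (Option ι))) :
    tr g (rl e.optionCongr.optionCongr T) = rl e (tr g T) := by
  funext x idx
  simp only [tr, ptr, rl]
  refine Finset.sum_congr rfl fun a _ => Finset.sum_congr rfl fun b _ => ?_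
  congr 2
  funext o; rcases o with _ | _ | o <;> rfl

theorem nab_sum {α : Type*} (s : Finset α) {T : α → Ten n ι} (h : ∀ i, Sm (T i)) (a : Fin n) :
    nab g a (∑ i ∈ s, T i) = ∑ i ∈ s, nab g a (T i) := by
  classical
  induction s using Finset.induction_on with
  | empty => simp [nab_zero]
  | insert k s hk ih =>
    rw [Finset.sum_insert hk, Finset.sum_insert hk, nab_add (h k) (Sm.sum h), ih]

theorem DD_eq_sum (T : Ten n ι) (x : Pt n) : DD g ℓ T x = ∑ a, ℓ x a • nab g a T x := by
  funext idx; simp [DD, Finset.sum_apply]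

theorem Sm.DD (B : Bg g ℓ) {T : Ten n ι} (h : Sm T) : Sm (DD g ℓ T) := fun _ =>
  Smf.sum fun a => (B.sml a).mul (h.nab B.ok a _)
theorem DD_add {T S : Ten n ι} (h : Sm T) (h' : Sm S) : DD g ℓ (T + S) = DD g ℓ T + DD g ℓ S := by
  funext x idx; simp [DD, nab_add h h', mul_add, Finset.sum_add_distrib]
theorem DD_smul {T : Ten n ι} (h : Sm T) (c : ℝ) : DD g ℓ (c • T) = c • DD g ℓ T := by
  funext x idx; simp only [DD, nab_smul h, Pi.smul_apply, smul_eq_mul, Finset.mul_sum]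
  exact Finset.sum_congr rfl fun _ _ => by ring
theorem DD_zero : DD g ℓ (0 : Ten n ι) = 0 := by
  funext x idx; simp [DD, nab_zero]
theorem DD_rl (e : ι ≃ κ) (T : Ten n ι) : DD g ℓ (rl e T) = rl e (DD g ℓ T) := by
  funext x idx; simp [DD, nab_rl]; rfl
theorem DD_tprod {T : Ten n ι} {S : Ten n κ} (h : Sm T) (h' : Sm S) :
    DD g ℓ (tprod T S) = tprod (DD g ℓ T) S + tprod T (DD g ℓ S) := by
  funext x idx
  simp only [DD, nab_tprod h h', tprod, Pi.add_apply, mul_add, Finset.sum_add_distrib,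
    Finset.sum_mul, Finset.mul_sum]
  congr 1 <;> exact Finset.sum_congr rfl fun _ _ => by ring
theorem DD_tr (hg : MetOK g) {T : Ten n (Option (Option ι))} (h : Sm T) :
    DD g ℓ (tr g T) = tr g (DD g ℓ T) := by
  funext x idx
  simp only [DD, nab_tr hg h, tr, ptr, Finset.mul_sum]
  rw [Finset.sum_comm]
  refine Finset.sum_congr rfl fun a _ => ?_
  rw [Finset.sum_comm]
  exact Finset.sum_congr rfl fun b _ => Finset.sum_congr rfl fun c _ => by ring
theorem DD_gc (hg : MetOK g) {T : Ten n ι} (h : Sm T) : DD g ℓ (gc g T) = gc g (DD g ℓ T) := by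
  funext x idx
  simp only [DD, nab_gc hg h, gc, pgc, Finset.mul_sum]
  exact Finset.sum_congr rfl fun b _ => by ring

theorem CD_add {T S : Ten n ι} (h : Sm T) (h' : Sm S) : CD g (T + S) = CD g T + CD g S := by
  funext x idx; simp [CD, nab_add h h']
theorem CD_smul {T : Ten n ι} (h : Sm T) (c : ℝ) : CD g (c • T) = c • CD g T := by
  funext x idx; simp [CD, nab_smul h]
theorem CD_zero : CD g (0 : Ten n ι) = 0 := by
  funext x idx; simp [CD, nab_zero]
theorem CD_sum {α : Type*} (s : Finset α) {T : α → Ten n ι} (h : ∀ i, Sm (T i)) :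
    CD g (∑ i ∈ s, T i) = ∑ i ∈ s, CD g (T i) := by
  funext x idx; simp [CD, nab_sum s h, Finset.sum_apply]
theorem CD_rl (e : ι ≃ κ) (T : Ten n ι) : CD g (rl e T) = rl e.optionCongr (CD g T) := by
  funext x idx; simp only [CD, nab_rl]; rfl

/-- move the first slot past a pair. -/
def mvE (ι : Type) : Option (Option (Option ι)) ≃ Option (Option (Option ι)) where
  toFun
    | none => some (some none)
    | some none => none
    | some (some none) => some none
    | some (some (some i)) => some (some (some i))
  invFun
    | none => some none
    | some none => some (some none)
    | some (some none) => none
    | some (some (some i)) => some (some (some i))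
  left_inv := by rintro (_ | _ | _ | i) <;> rfl
  right_inv := by rintro (_ | _ | _ | i) <;> rfl

theorem CD_tr (hg : MetOK g) {T : Ten n (Option (Option ι))} (h : Sm T) :
    CD g (tr g T) = tr g (rl (mvE ι) (CD g T)) := by
  funext x idx
  simp only [CD, nab_tr hg h, tr, ptr, rl]
  refine Finset.sum_congr rfl fun a _ => Finset.sum_congr rfl fun b _ => ?_
  congr 2
  funext o; rcases o with _ | _ | o <;> rfl

theorem CD_gc (hg : MetOK g) {T : Ten n ι} (h : Sm T) :
    CD g (gc g T) = rl (mvE ι).symm (gc g (CD g T)) := by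
  funext x idx
  simp only [CD, nab_gc hg h]; rfl

end drules

/-! ### Balanced tensors -/

section bal
variable {n : ℕ} {g : MetricField n} {ℓ : VecField n}
  {ι κ : Type} [Fintype ι] [DecidableEq ι] [Fintype κ] [DecidableEq κ]

def BalQ (g : MetricField n) (ℓ : VecField n) (Q : Set ι) : ℕ → ℤ → Ten n ι → Prop
  | 0, c, T => ∀ x, FilQ g ℓ x Q c (T x)
  | j + 1, c, T => (∀ x, FilQ g ℓ x Q c (T x)) ∧ BalQ g ℓ Q j (c - 1) (DD g ℓ T)

variable {Q Q' : Set ι} {j : ℕ} {c c' : ℤ} {T S : Ten n ι}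

theorem BalQ.fil (h : BalQ g ℓ Q j c T) (x : Pt n) : FilQ g ℓ x Q c (T x) := by
  cases j with
  | zero => exact h x
  | succ j => exact h.1 x

theorem BalQ.pred (h : BalQ g ℓ Q (j+1) c T) : BalQ g ℓ Q j c T := by
  induction j generalizing c T with
  | zero => exact h.1
  | succ j ih => exact ⟨h.1, ih h.2⟩

theorem BalQ.le {i : ℕ} (h : BalQ g ℓ Q j c T) (hi : i ≤ j) : BalQ g ℓ Q i c T := by
  induction hi with
  | refl => exact h
  | step _ ih => exact ih h.pred

theorem BalQ.mono (h : BalQ g ℓ Q j c T) (hc : c ≤ c') (hQ : Q ⊆ Q') : BalQ g ℓ Q' j c' T := by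
  induction j generalizing c c' T with
  | zero => exact fun x => (h x).mono hc hQ
  | succ j ih => exact ⟨fun x => (h.1 x).mono hc hQ, ih h.2 (by omega)⟩

theorem BalQ.zero : BalQ g ℓ Q j c (0 : Ten n ι) := by
  induction j generalizing c with
  | zero => exact fun x => FilQ.zero
  | succ j ih => refine ⟨fun x => FilQ.zero, ?_⟩; rw [DD_zero]; exact ih

theorem BalQ.add (B : Bg g ℓ) (sT : Sm T) (sS : Sm S) (h : BalQ g ℓ Q j c T)
    (h' : BalQ g ℓ Q j c S) : BalQ g ℓ Q j c (T + S) := by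
  induction j generalizing c T S with
  | zero => exact fun x => (h x).add (h' x)
  | succ j ih =>
    refine ⟨fun x => (h.1 x).add (h'.1 x), ?_⟩
    rw [DD_add sT sS]; exact ih (sT.DD B) (sS.DD B) h.2 h'.2

theorem BalQ.smul (B : Bg g ℓ) (r : ℝ) (sT : Sm T) (h : BalQ g ℓ Q j c T) :
    BalQ g ℓ Q j c (r • T) := by
  induction j generalizing c T with
  | zero => exact fun x => (h x).smul r
  | succ j ih =>
    refine ⟨fun x => (h.1 x).smul r, ?_⟩
    rw [DD_smul sT]; exact ih (sT.DD B) h.2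

theorem BalQ.neg (B : Bg g ℓ) (sT : Sm T) (h : BalQ g ℓ Q j c T) :
    BalQ g ℓ Q j c (-T) := by
  have := h.smul B (-1) sT; rwa [neg_one_smul] at this

theorem BalQ.sub (B : Bg g ℓ) (sT : Sm T) (sS : Sm S) (h : BalQ g ℓ Q j c T)
    (h' : BalQ g ℓ Q j c S) : BalQ g ℓ Q j c (T - S) := by
  rw [sub_eq_add_neg]; exact h.add B sT sS.neg (h'.neg B sS)

theorem BalQ.sum (B : Bg g ℓ) {α : Type*} (s : Finset α) {T : α → Ten n ι} (sT : ∀ i, Sm (T i))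
    (h : ∀ i, BalQ g ℓ Q j c (T i)) : BalQ g ℓ Q j c (∑ i ∈ s, T i) := by
  classical
  induction s using Finset.induction_on with
  | empty => simpa using BalQ.zero
  | insert k s hk ih => rw [Finset.sum_insert hk]; exact (h k).add B (sT k) (Sm.sum sT) ih

theorem BalQ.rl (e : ι ≃ κ) (h : BalQ g ℓ Q j c T) : BalQ g ℓ (e '' Q) j c (rl e T) := by
  induction j generalizing c T with
  | zero => exact fun x => (h x).rl e
  | succ j ih => refine ⟨fun x => (h.1 x).rl e, ?_⟩; rw [DD_rl]; exact ih h.2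

theorem Bal.rl (e : ι ≃ κ) (h : BalQ g ℓ ∅ j c T) : BalQ g ℓ ∅ j c (rl e T) := by
  have := h.rl e; rwa [Set.image_empty] at this

theorem Bal.tprod (B : Bg g ℓ) {S : Ten n κ} (sT : Sm T) (sS : Sm S)
    (h : BalQ g ℓ ∅ j c T) (h' : BalQ g ℓ ∅ j c' S) : BalQ g ℓ ∅ j (c + c') (tprod T S) := by
  induction j generalizing c c' T S with
  | zero => exact fun x => Fil.tprod (h x) (h' x)
  | succ j ih =>
    refine ⟨fun x => Fil.tprod (h.1 x) (h'.1 x), ?_⟩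
    rw [DD_tprod sT sS]
    refine BalQ.add B ((sT.DD B).tprod sS) (sT.tprod (sS.DD B)) ?_ ?_
    · have := ih (sT.DD B) sS h.2 h'.pred
      rwa [show c - 1 + c' = c + c' - 1 by ring] at this
    · have := ih sT (sS.DD B) h.pred h'.2
      rwa [show c + (c' - 1) = c + c' - 1 by ring] at this

theorem Bal.tr (B : Bg g ℓ) {T : Ten n (Option (Option ι))} (sT : Sm T)
    (h : BalQ g ℓ ∅ j c T) : BalQ g ℓ ∅ j c (tr g T) := by
  induction j generalizing c T with
  | zero => exact fun x => Fil.ptr B (h x)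
  | succ j ih =>
    refine ⟨fun x => Fil.ptr B (h.1 x), ?_⟩
    rw [DD_tr B.ok sT]; exact ih (sT.DD B) h.2

theorem Bal.gc (B : Bg g ℓ) (sT : Sm T) (h : BalQ g ℓ ∅ j c T) : BalQ g ℓ ∅ j c (gc g T) := by
  induction j generalizing c T with
  | zero => exact fun x => Fil.pgc B (h x)
  | succ j ih =>
    refine ⟨fun x => Fil.pgc B (h.1 x), ?_⟩
    rw [DD_gc B.ok sT]; exact ih (sT.DD B) h.2

end bal

/-! ### Contraction with `ℓ`, the commutator -/

section comm
variable {n : ℕ} {g : MetricField n} {ℓ : VecField n}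
  {ι κ : Type} [Fintype ι] [DecidableEq ι] [Fintype κ] [DecidableEq κ]

def lf (g : MetricField n) (ℓ : VecField n) : Ten n Unit := fun x idx => lower g ℓ x (idx ())

def clE (ι : Type) : Unit ⊕ Option ι ≃ Option (Option ι) where
  toFun
    | Sum.inl _ => none
    | Sum.inr none => some none
    | Sum.inr (some i) => some (some i)
  invFun
    | none => Sum.inl ()
    | some none => Sum.inr none
    | some (some i) => Sum.inr (some i)
  left_inv := by rintro (_ | _ | i) <;> rfl
  right_inv := by rintro (_ | _ | i) <;> rfl

def cl (g : MetricField n) (ℓ : VecField n) (S : Ten n (Option ι)) : Ten n ι :=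
  tr g (rl (clE ι) (tprod (lf g ℓ) S))

theorem raise_l (hg : MetOK g) (x : Pt n) (b : Fin n) :
    ∑ a, (g x)⁻¹ a b * lower g ℓ x a = ℓ x b := by
  unfold lower
  simp_rw [Finset.mul_sum]
  rw [Finset.sum_comm]
  have : ∀ d, ∑ a, (g x)⁻¹ a b * (g x a d * ℓ x d) = (if b = d then 1 else 0) * ℓ x d := by
    intro d
    rw [← hg.inv_mul x b d, Finset.sum_mul]
    exact Finset.sum_congr rfl fun a _ => by rw [hg.inv_symm x a b]; ring
  simp_rw [this]; simp

theorem cl_apply (hg : MetOK g) (S : Ten n (Option ι)) (x : Pt n) (idx : ι → Fin n) :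
    cl g ℓ S x idx = ∑ b, ℓ x b * S x (oc b idx) := by
  simp only [cl, tr, ptr, rl, tprod, lf]
  rw [Finset.sum_comm]
  refine Finset.sum_congr rfl fun b _ => ?_
  rw [← raise_l (ℓ := ℓ) hg x b, Finset.sum_mul]
  refine Finset.sum_congr rfl fun a _ => ?_
  rw [mul_assoc]
  congr 2
  congr 1
  funext o; rcases o with _ | o <;> rfl

theorem DD_eq_cl (hg : MetOK g) (T : Ten n ι) : DD g ℓ T = cl g ℓ (CD g T) := by
  funext x idx; rw [cl_apply hg]; rfl

theorem Sm.lf (B : Bg g ℓ) : Sm (lf g ℓ) := fun idx => B.sm_lower _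

theorem Sm.cl (B : Bg g ℓ) {S : Ten n (Option ι)} (h : Sm S) : Sm (cl g ℓ S) :=
  Sm.tr B.ok (((Sm.lf B).tprod h).rl _)

theorem CD_lf (B : Bg g ℓ) (x : Pt n) (idx : Option Unit → Fin n) :
    CD g (lf g ℓ) x idx = nablaLow g ℓ x (idx none) (idx (some ())) := by
  unfold CD nab nablaLow covD lf lowerField
  simp

theorem DD_lf (B : Bg g ℓ) : DD g ℓ (lf g ℓ) = 0 := by
  funext x idx
  rw [DD_eq_cl B.ok, cl_apply B.ok]
  simp_rw [CD_lf B]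
  exact B.aff x _

theorem fil_lf (B : Bg g ℓ) (x : Pt n) : FilQ g ℓ x ∅ (-1) (lf g ℓ x) := by
  intro w v hw _ hd
  have h0 : evM (lf g ℓ x) v = gdot g x (v ()) (ℓ x) := by
    rw [gdot_low, evM_apply, ← (Equiv.funUnique Unit (Fin n)).symm.sum_comp]
    exact Finset.sum_congr rfl fun a _ => by simp [lf]; ring
  rw [h0]
  simp at hd
  exact (hw ()).1 (by have : w () = w PUnit.unit := rfl; omega)

theorem bal_lf (B : Bg g ℓ) (j : ℕ) : BalQ g ℓ ∅ j (-1) (lf g ℓ) := by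
  cases j with
  | zero => exact fil_lf B
  | succ j => refine ⟨fil_lf B, ?_⟩; rw [DD_lf B]; exact BalQ.zero

theorem Bal.cl (B : Bg g ℓ) {S : Ten n (Option ι)} {j : ℕ} {c : ℤ} (sS : Sm S)
    (h : BalQ g ℓ ∅ j c S) : BalQ g ℓ ∅ j (c - 1) (cl g ℓ S) := by
  have := Bal.tr B (((Sm.lf B).tprod sS).rl _)
    (Bal.rl (clE ι) (Bal.tprod B (Sm.lf B) sS (bal_lf B j) h))
  rwa [show -1 + c = c - 1 by ring] at this

/-- `∇ℓ` -/
def NN (g : MetricField n) (ℓ : VecField n) : Ten n (Option Unit) := CD g (lf g ℓ)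

def nsE (ι : Type) : Option Unit ⊕ Option ι ≃ Option (Option (Option ι)) where
  toFun
    | Sum.inl none => some (some none)
    | Sum.inl (some _) => none
    | Sum.inr none => some none
    | Sum.inr (some i) => some (some (some i))
  invFun
    | none => Sum.inl (some ())
    | some none => Sum.inr none
    | some (some none) => Sum.inl none
    | some (some (some i)) => Sum.inr (some i)
  left_inv := by rintro ((_ | _) | _ | i) <;> rfl
  right_inv := by rintro (_ | _ | _ | i) <;> rfl

def NS (g : MetricField n) (ℓ : VecField n) (S : Ten n (Option ι)) : Ten n (Option ι) :=
  tr g (rl (nsE ι) (tprod (NN g ℓ) S))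

theorem Sm.NN (B : Bg g ℓ) : Sm (NN g ℓ) := (Sm.lf B).CD B.ok
theorem Sm.NS (B : Bg g ℓ) {S : Ten n (Option ι)} (h : Sm S) : Sm (NS g ℓ S) :=
  Sm.tr B.ok (((Sm.NN B).tprod h).rl _)

theorem Bal.NS (B : Bg g ℓ) {S : Ten n (Option ι)} {j : ℕ} {c c' : ℤ} (sS : Sm S)
    (h' : BalQ g ℓ ∅ j c' (NN g ℓ))
    (h : BalQ g ℓ ∅ j c S) : BalQ g ℓ ∅ j (c' + c) (NS g ℓ S) :=
  Bal.tr B (((Sm.NN B).tprod sS).rl _)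
    (Bal.rl (nsE ι) (Bal.tprod B (Sm.NN B) sS h' h))

/-- derivative of a contraction with `ℓ`. -/
theorem CD_cl (B : Bg g ℓ) {S : Ten n (Option ι)} (h : Sm S) :
    CD g (cl g ℓ S) = NS g ℓ S + cl g ℓ (rl (Equiv.swap none (some none)) (CD g S)) := by
  funext x idx
  have h1 : CD g (cl g ℓ S) x idx = nab g (idx none) (cl g ℓ S) x (fun i => idx (some i)) := rfl
  rw [h1, cl, nab_tr B.ok (((Sm.lf B).tprod h).rl _), nab_rl, nab_tprod (Sm.lf B) h, rl_add, tr_add]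
  simp only [Pi.add_apply]
  congr 1
  · simp only [NS, tr, ptr, rl, tprod, NN, CD]
    refine Finset.sum_congr rfl fun a _ => Finset.sum_congr rfl fun b _ => ?_
    congr 2
    congr 1
    funext o; rcases o with _ | o <;> rfl
  · rw [cl_apply B.ok]
    have := cl_apply (ℓ := ℓ) B.ok (nab g (idx none) S) x (fun i => idx (some i))
    rw [cl] at this
    rw [this]
    refine Finset.sum_congr rfl fun b _ => ?_
    congr 1
    simp only [rl, CD]
    have e1 : (Equiv.swap none (some none) : Equiv.Perm (Option (Option ι))) none = some none :=
      Equiv.swap_apply_left _ _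
    rw [e1]
    congr 1
    funext o; rcases o with _ | o
    · simp [Equiv.swap_apply_right]
    · have : (Equiv.swap none (some none) : Equiv.Perm (Option (Option ι))) (some (some o)) = some (some o) :=
        Equiv.swap_apply_of_ne_of_ne (by simp) (by simp)
      simp [this]

end comm



section ricciid
variable {n : ℕ} {g : MetricField n} {ℓ : VecField n}
  {ι κ : Type} [Fintype ι] [DecidableEq ι] [Fintype κ] [DecidableEq κ]

/-- derivation action of a matrix on tensor components -/
def rho (B : Fin n → Fin n → ℝ) (t : (ι → Fin n) → ℝ) : (ι → Fin n) → ℝ := fun idx =>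
  ∑ m, ∑ e, B e (idx m) * t (Function.update idx m e)

theorem rho_rho (B C : Fin n → Fin n → ℝ) (t : (ι → Fin n) → ℝ) (idx : ι → Fin n) :
    rho B (rho C t) idx = rho (fun e f => ∑ h, C e h * B h f) t idx +
      ∑ m, ∑ m' ∈ Finset.univ.erase m, ∑ e, ∑ e', B e (idx m) * C e' (idx m') *
        t (Function.update (Function.update idx m e) m' e') := by
  unfold rho
  rw [← Finset.sum_add_distrib]
  refine Finset.sum_congr rfl fun m _ => ?_
  have h1 : ∀ e, ∑ m', ∑ e', C e' (Function.update idx m e m') *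
      t (Function.update (Function.update idx m e) m' e') =
      (∑ e', C e' e * t (Function.update idx m e')) +
      ∑ m' ∈ Finset.univ.erase m, ∑ e', C e' (idx m') *
      t (Function.update (Function.update idx m e) m' e') := by
    intro e
    rw [← Finset.add_sum_erase _ _ (Finset.mem_univ m)]
    congr 1
    · simp
    · refine Finset.sum_congr rfl fun m' hm' => Finset.sum_congr rfl fun e' _ => ?_
      rw [Function.update_of_ne (Finset.ne_of_mem_erase hm')]
  simp only [h1, mul_add, Finset.sum_add_distrib]
  congr 1
  · simp only [Finset.mul_sum, Finset.sum_mul]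
    rw [Finset.sum_comm]
    exact Finset.sum_congr rfl fun e _ => Finset.sum_congr rfl fun f _ => by ring
  · simp only [Finset.mul_sum]
    rw [Finset.sum_comm]
    exact Finset.sum_congr rfl fun m' _ => Finset.sum_congr rfl fun e _ =>
      Finset.sum_congr rfl fun e' _ => by ring

theorem rho_comm (B C : Fin n → Fin n → ℝ) (t : (ι → Fin n) → ℝ) (idx : ι → Fin n) :
    rho B (rho C t) idx - rho C (rho B t) idx =
      rho (fun e f => ∑ h, C e h * B h f) t idx - rho (fun e f => ∑ h, B e h * C h f) t idx := by
  rw [rho_rho, rho_rho]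
  have : ∑ m, ∑ m' ∈ Finset.univ.erase m, ∑ e, ∑ e', B e (idx m) * C e' (idx m') *
        t (Function.update (Function.update idx m e) m' e') =
      ∑ m, ∑ m' ∈ Finset.univ.erase m, ∑ e, ∑ e', C e (idx m) * B e' (idx m') *
        t (Function.update (Function.update idx m e) m' e') := by
    rw [Finset.sum_comm' (t' := Finset.univ) (s' := fun m => Finset.univ.erase m)
      (by intro a b; simp [eq_comm])]
    refine Finset.sum_congr rfl fun m _ => Finset.sum_congr rfl fun m' hm' => ?_
    rw [Finset.sum_comm]
    refine Finset.sum_congr rfl fun e _ => Finset.sum_congr rfl fun e' _ => ?_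
    rw [Function.update_comm (Finset.ne_of_mem_erase hm')]
    ring
  rw [this]; ring

/-- curvature matrix -/
def Om (g : MetricField n) (x : Pt n) (c d e f : Fin n) : ℝ :=
  pd (fun y => christoffel g y e d f) c x - pd (fun y => christoffel g y e c f) d x
    + ∑ h, (christoffel g x e c h * christoffel g x h d f
            - christoffel g x e d h * christoffel g x h c f)

theorem riemann_eq (x : Pt n) (idx : Fin 4 → Fin n) :
    riemann g x idx = ∑ e, g x (idx 0) e * Om g x (idx 2) (idx 3) e (idx 1) := rfl

theorem nab_eq (a : Fin n) (T : Ten n ι) (x : Pt n) (idx : ι → Fin n) :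
    nab g a T x idx = pd (fun y => T y idx) a x -
      rho (fun e f => christoffel g x e a f) (T x) idx := rfl

theorem nab_nab (hg : MetOK g) {T : Ten n ι} (hT : Sm T) (a b : Fin n) (x : Pt n)
    (idx : ι → Fin n) :
    nab g b (nab g a T) x idx - nab g a (nab g b T) x idx =
      - rho (Om g x b a) (T x) idx := by
  have key : ∀ a b : Fin n, nab g b (nab g a T) x idx =
      pd (pd (fun y => T y idx) a) b x
      - rho (fun e f => pd (fun y => christoffel g y e a f) b x) (T x) idx
      - rho (fun e f => christoffel g x e a f) (fun j => pd (fun y => T y j) b x) idx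
      - rho (fun e f => christoffel g x e b f) (fun j => pd (fun y => T y j) a x) idx
      + rho (fun e f => christoffel g x e b f)
          (rho (fun e f => christoffel g x e a f) (T x)) idx := by
    intro a b
    rw [nab_eq]
    have h1 : pd (fun y => nab g a T y idx) b x = pd (pd (fun y => T y idx) a) b x
      - rho (fun e f => pd (fun y => christoffel g y e a f) b x) (T x) idx
      - rho (fun e f => christoffel g x e a f) (fun j => pd (fun y => T y j) b x) idx := by
      unfold nab
      rw [pd_sub ((hT _).pd _) (Smf.sum fun _ => Smf.sum fun _ => (hg.sm_chr _ _ _).mul (hT _)),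
        pd_sum _ _ (fun _ => Smf.sum fun _ => (hg.sm_chr _ _ _).mul (hT _)), sub_sub]
      congr 1
      unfold rho
      rw [← Finset.sum_add_distrib]
      refine Finset.sum_congr rfl fun m _ => ?_
      rw [pd_sum _ _ (fun _ => (hg.sm_chr _ _ _).mul (hT _)), ← Finset.sum_add_distrib]
      exact Finset.sum_congr rfl fun e _ => pd_mul (hg.sm_chr _ _ _) (hT _)
    have h2 : rho (fun e f => christoffel g x e b f) (nab g a T x) idx =
       rho (fun e f => christoffel g x e b f) (fun j => pd (fun y => T y j) a x) idx
      - rho (fun e f => christoffel g x e b f)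
          (rho (fun e f => christoffel g x e a f) (T x)) idx := by
      unfold rho
      rw [← Finset.sum_sub_distrib]
      refine Finset.sum_congr rfl fun m _ => ?_
      rw [← Finset.sum_sub_distrib]
      refine Finset.sum_congr rfl fun e _ => ?_
      rw [nab_eq]; unfold rho; ring
    rw [h1, h2]; ring
  have hc := rho_comm (fun e f => christoffel g x e b f) (fun e f => christoffel g x e a f) (T x) idx
  have hO : rho (Om g x b a) (T x) idx =
      rho (fun e f => pd (fun y => christoffel g y e a f) b x) (T x) idx
      - rho (fun e f => pd (fun y => christoffel g y e b f) a x) (T x) idx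
      + (rho (fun e f => ∑ h, christoffel g x e b h * christoffel g x h a f) (T x) idx
      - rho (fun e f => ∑ h, christoffel g x e a h * christoffel g x h b f) (T x) idx) := by
    unfold rho
    rw [← Finset.sum_sub_distrib, ← Finset.sum_sub_distrib, ← Finset.sum_add_distrib]
    refine Finset.sum_congr rfl fun m _ => ?_
    rw [← Finset.sum_sub_distrib, ← Finset.sum_sub_distrib, ← Finset.sum_add_distrib]
    refine Finset.sum_congr rfl fun e _ => ?_
    rw [Om, Finset.sum_sub_distrib]; ring
  rw [key a b, key b a, hO, pd_comm (hT idx) a b]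
  linarith

theorem CDCD (T : Ten n ι) (a b : Fin n) (x : Pt n) (idx : ι → Fin n) :
    CD g (CD g T) x (oc b (oc a idx)) = nab g b (nab g a T) x idx -
      ∑ e, christoffel g x e b a * nab g e T x idx := by
  have : CD g (CD g T) x (oc b (oc a idx)) = nab g b (CD g T) x (oc a idx) := rfl
  rw [this, nab, Fintype.sum_option, nab]
  simp only [update_oc_none, update_oc_some, oc_none, oc_some]
  have h : ∀ e j y, CD g T y (oc e j) = nab g e T y j := fun _ _ _ => rfl
  simp only [h]
  ring

def actE0 (ι : Type) : Fin 4 ⊕ ι ≃ Option (Option (Option (Option ι))) where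
  toFun
    | Sum.inl 0 => none
    | Sum.inl 1 => some none
    | Sum.inl 2 => some (some none)
    | Sum.inl 3 => some (some (some none))
    | Sum.inr k => some (some (some (some k)))
  invFun
    | none => Sum.inl 0
    | some none => Sum.inl 1
    | some (some none) => Sum.inl 2
    | some (some (some none)) => Sum.inl 3
    | some (some (some (some k))) => Sum.inr k
  left_inv := by
    rintro (i | k)
    · fin_cases i <;> rfl
    · rfl
  right_inv := by rintro (_ | _ | _ | _ | k) <;> rfl

def actE (m : ι) : Fin 4 ⊕ ι ≃ Option (Option (Option (Option ι))) :=
  (actE0 ι).trans (Equiv.swap (some none) (some (some (some (some m)))))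

def act (g : MetricField n) (R : Ten n (Fin 4)) (T : Ten n ι) : Ten n (Option (Option ι)) :=
  ∑ m, tr g (rl (actE m) (tprod R T))

theorem act_apply (R : Ten n (Fin 4)) (T : Ten n ι) (x : Pt n) (b a : Fin n) (idx : ι → Fin n) :
    act g R T x (oc b (oc a idx)) = ∑ m, ∑ h, ∑ e, (g x)⁻¹ h e *
      (R x ![h, idx m, b, a] * T x (Function.update idx m e)) := by
  unfold act
  simp only [Finset.sum_apply]
  refine Finset.sum_congr rfl fun m _ => ?_
  unfold tr ptr rl tprod
  refine Finset.sum_congr rfl fun h _ => Finset.sum_congr rfl fun e _ => ?_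
  congr 2
  · congr 1; funext i; fin_cases i <;> simp [actE, actE0, Equiv.swap_apply_def]
  · congr 1; funext k
    by_cases hk : k = m
    · subst hk; simp [actE, actE0]
    · simp [actE, actE0, Equiv.swap_apply_def, hk]

theorem Sm.act (hg : MetOK g) {R : Ten n (Fin 4)} {T : Ten n ι} (hR : Sm R) (hT : Sm T) :
    Sm (act g R T) := Sm.sum fun m => Sm.tr hg ((hR.tprod hT).rl _)

theorem Bal.act (B : Bg g ℓ) {R : Ten n (Fin 4)} {T : Ten n ι} {j : ℕ} {c c' : ℤ}
    (sR : Sm R) (sT : Sm T) (hR : BalQ g ℓ ∅ j c R) (hT : BalQ g ℓ ∅ j c' T) :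
    BalQ g ℓ ∅ j (c + c') (act g R T) :=
  BalQ.sum B _ (fun m => Sm.tr B.ok ((sR.tprod sT).rl _))
    fun m => Bal.tr B ((sR.tprod sT).rl _) (Bal.rl _ (Bal.tprod B sR sT hR hT))

theorem act_add_left (R R' : Ten n (Fin 4)) (T : Ten n ι) :
    act g (R + R') T = act g R T + act g R' T := by
  unfold act
  rw [← Finset.sum_add_distrib]
  refine Finset.sum_congr rfl fun m _ => ?_
  rw [← tr_add, ← rl_add]
  congr 2; funext x idx; simp [tprod, add_mul]

theorem Sm.riemann (hg : MetOK g) : Sm (riemann g : Ten n (Fin 4)) := fun idx => by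
  unfold VSI.riemann
  refine Smf.sum fun e => (hg.sm _ _).mul ?_
  exact (((hg.sm_chr _ _ _).pd _).sub ((hg.sm_chr _ _ _).pd _)).add
    (Smf.sum fun f => ((hg.sm_chr _ _ _).mul (hg.sm_chr _ _ _)).sub
      ((hg.sm_chr _ _ _).mul (hg.sm_chr _ _ _)))

theorem raise_riem (hg : MetOK g) (x : Pt n) (e f b a : Fin n) :
    ∑ h, (g x)⁻¹ h e * riemann g x ![h, f, b, a] = Om g x b a e f := by
  have : ∀ h, (g x)⁻¹ h e * riemann g x ![h, f, b, a] =
      ∑ k, (g x)⁻¹ e h * g x h k * Om g x b a k f := fun h => by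
    rw [riemann_eq, Finset.mul_sum, hg.inv_symm x h e]
    exact Finset.sum_congr rfl fun k _ => by simp; ring
  simp only [this]
  rw [Finset.sum_comm]
  simp only [← Finset.sum_mul, hg.inv_mul]
  simp

theorem act_riem (hg : MetOK g) (T : Ten n ι) (x : Pt n) (b a : Fin n) (idx : ι → Fin n) :
    act g (riemann g) T x (oc b (oc a idx)) = rho (Om g x b a) (T x) idx := by
  rw [act_apply]; unfold rho
  refine Finset.sum_congr rfl fun m _ => ?_
  rw [Finset.sum_comm]
  refine Finset.sum_congr rfl fun e _ => ?_
  rw [← raise_riem hg, Finset.sum_mul]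
  exact Finset.sum_congr rfl fun h _ => by ring

theorem ricci_id (hg : MetOK g) {T : Ten n ι} (hT : Sm T) :
    CD g (CD g T) = rl (Equiv.swap none (some none)) (CD g (CD g T)) - act g (riemann g) T := by
  funext x idx
  obtain ⟨b, f, rfl⟩ : ∃ i f, idx = oc i f := ⟨_, _, (oc_eta idx).symm⟩
  obtain ⟨a, f, rfl⟩ : ∃ i f', f = oc i f' := ⟨_, _, (oc_eta f).symm⟩
  have h1 : rl (Equiv.swap none (some none)) (CD g (CD g T)) x (oc b (oc a f)) =
      CD g (CD g T) x (oc a (oc b f)) := by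
    unfold rl; congr 1; funext o
    rcases o with _ | _ | o <;> simp [Equiv.swap_apply_def]
  have h2 := nab_nab hg hT a b x f
  simp only [Pi.sub_apply]
  rw [h1, CDCD, CDCD, act_riem hg]
  have h3 : ∑ e, christoffel g x e b a * nab g e T x f = ∑ e, christoffel g x e a b * nab g e T x f :=
    Finset.sum_congr rfl fun e _ => by rw [hg.chr_symm x e a b]
  rw [h3]; linarith

theorem cl_add (S S' : Ten n (Option ι)) : cl g ℓ (S + S') = cl g ℓ S + cl g ℓ S' := by
  unfold cl; rw [← tr_add, ← rl_add]; congr 2; funext x idx; simp [tprod, mul_add]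
theorem cl_neg (S : Ten n (Option ι)) : cl g ℓ (-S) = - cl g ℓ S := by
  unfold cl; rw [← tr_neg, ← rl_neg]; congr 2; funext x idx; simp [tprod]
theorem cl_sub (S S' : Ten n (Option ι)) : cl g ℓ (S - S') = cl g ℓ S - cl g ℓ S' := by
  rw [sub_eq_add_neg, cl_add, cl_neg, sub_eq_add_neg]

theorem DD_CD (B : Bg g ℓ) {T : Ten n ι} (hT : Sm T) :
    DD g ℓ (CD g T) = CD g (DD g ℓ T) - NS g ℓ (CD g T) - cl g ℓ (act g (riemann g) T) := by
  rw [DD_eq_cl B.ok, DD_eq_cl B.ok, CD_cl B (hT.CD B.ok)]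
  conv_lhs => rw [ricci_id B.ok hT]
  rw [cl_sub]; abel

end ricciid


section riemsym
variable {n : ℕ} {g : MetricField n}

theorem Om_anti (x : Pt n) (c d e f : Fin n) : Om g x c d e f = - Om g x d c e f := by
  unfold Om
  simp only [Finset.sum_sub_distrib]; ring

theorem riem_anti23 (x : Pt n) (a b c d : Fin n) :
    riemann g x ![a, b, c, d] = - riemann g x ![a, b, d, c] := by
  rw [riemann_eq, riemann_eq, ← Finset.sum_neg_distrib]
  refine Finset.sum_congr rfl fun e _ => ?_
  have := Om_anti (g := g) x c d e b
  simp [this]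

theorem riem_anti01 (hg : MetOK g) (x : Pt n) (a b c d : Fin n) :
    riemann g x ![a, b, c, d] = - riemann g x ![b, a, c, d] := by
  let one : Ten n Empty := fun _ _ => 1
  have s1 : Sm one := fun _ => contDiff_const
  have h0 : ∀ a, nab g a one = 0 := fun a => by
    funext x idx; simp [nab, one, pd_const]
  have hz : ∀ a, nab g a (gc g one) = 0 := fun a => by
    rw [nab_gc hg s1, h0]; funext x idx; simp [gc, pgc]
  have h := nab_nab hg (s1.gc hg) d c x (oc a (oc b Empty.elim))
  rw [hz, hz, nab_zero, nab_zero] at h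
  simp only [rho, Fintype.sum_option, update_oc_none, update_oc_some, Finset.univ_eq_empty,
    Finset.sum_empty, gc, pgc, oc_none, oc_some, one] at h
  rw [riemann_eq, riemann_eq]
  simp at h ⊢
  have e1 : ∑ e, g x a e * Om g x c d e b = ∑ e, Om g x c d e b * g x a e :=
    Finset.sum_congr rfl fun e _ => by ring
  have e2 : ∑ e, g x b e * Om g x c d e a = ∑ e, Om g x c d e a * g x e b :=
    Finset.sum_congr rfl fun e _ => by rw [hg.symm x b e]; ring
  rw [e1, e2]; linarith

theorem riem_bianchi1 (hg : MetOK g) (x : Pt n) (a b c d : Fin n) :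
    riemann g x ![a, b, c, d] + riemann g x ![a, c, d, b] + riemann g x ![a, d, b, c] = 0 := by
  rw [riemann_eq, riemann_eq, riemann_eq, ← Finset.sum_add_distrib, ← Finset.sum_add_distrib]
  refine Finset.sum_eq_zero fun e _ => ?_
  have h : Om g x c d e b + Om g x d b e c + Om g x b c e d = 0 := by
    unfold Om
    have s : ∀ e a b, (fun y => christoffel g y e a b) = fun y => christoffel g y e b a :=
      fun e a b => by funext y; exact hg.chr_symm y e a b
    rw [s e d b, s e c b, s e d c]
    simp only [Finset.sum_sub_distrib]
    have t : ∀ h a b, christoffel g x h a b = christoffel g x h b a := fun h => hg.chr_symm x h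
    have u1 : ∑ h, christoffel g x e c h * christoffel g x h d b = ∑ h, christoffel g x e c h * christoffel g x h b d :=
      Finset.sum_congr rfl fun h _ => by rw [t h d b]
    have u2 : ∑ h, christoffel g x e d h * christoffel g x h c b = ∑ h, christoffel g x e d h * christoffel g x h b c :=
      Finset.sum_congr rfl fun h _ => by rw [t h c b]
    have u3 : ∑ h, christoffel g x e b h * christoffel g x h d c = ∑ h, christoffel g x e b h * christoffel g x h c d :=
      Finset.sum_congr rfl fun h _ => by rw [t h d c]
    rw [u1, u2, u3]; ring
  simp
  rw [← mul_add, ← mul_add, h, mul_zero]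

theorem riem_pair (hg : MetOK g) (x : Pt n) (a b c d : Fin n) :
    riemann g x ![a, b, c, d] = riemann g x ![c, d, a, b] := by
  have A := riem_anti01 hg x
  have D := riem_anti23 (g := g) x
  have B1 := riem_bianchi1 hg x a b c d
  have B2 := riem_bianchi1 hg x b c d a
  have B3 := riem_bianchi1 hg x c d a b
  have B4 := riem_bianchi1 hg x d a b c
  have := A a c d b
  have := D c a d b
  have := A a d b c
  have := D d a b c
  have := A b d c a
  have := D b d c a
  have := D d b c a
  have := A b c d a
  have := D b c a d
  have := D c b d a
  have := D c b a d
  have := A b a c d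
  have := D b a c d
  have := A c d a b
  have := D c d a b
  have := D d c a b
  have := A c a d b
  have := A d a b c
  have := D a c b d
  have := D a d b c
  have := D b d a c
  have := D a b c d
  linarith

def GaM (g : MetricField n) (x : Pt n) (a : Fin n) : Matrix (Fin n) (Fin n) ℝ :=
  Matrix.of fun e f => christoffel g x e a f
def dGa (g : MetricField n) (x : Pt n) (b a : Fin n) : Matrix (Fin n) (Fin n) ℝ :=
  Matrix.of fun e f => pd (fun y => christoffel g y e a f) b x
def ddGa (g : MetricField n) (x : Pt n) (c b a : Fin n) : Matrix (Fin n) (Fin n) ℝ :=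
  Matrix.of fun e f => pd (pd (fun y => christoffel g y e a f) b) c x

theorem Om_mat (x : Pt n) (c d : Fin n) : Matrix.of (Om g x c d) =
    dGa g x c d - dGa g x d c + (GaM g x c * GaM g x d - GaM g x d * GaM g x c) := by
  ext e f
  simp [Om, dGa, GaM, Matrix.mul_apply]

theorem dOm_mat (hg : MetOK g) (x : Pt n) (f c d : Fin n) :
    Matrix.of (fun e h => pd (fun y => Om g y c d e h) f x) =
    ddGa g x f c d - ddGa g x f d c + (dGa g x f c * GaM g x d + GaM g x c * dGa g x f d
      - dGa g x f d * GaM g x c - GaM g x d * dGa g x f c) := by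
  ext e h
  simp only [Om, dGa, GaM, ddGa, Matrix.mul_apply, Matrix.of_apply, Matrix.add_apply,
    Matrix.sub_apply]
  have s := fun e a f => hg.sm_chr e a f
  have s2 : ∀ k, Smf fun y => christoffel g y e c k * christoffel g y k d h
            - christoffel g y e d k * christoffel g y k c h := fun k =>
     ((s _ _ _).mul (s _ _ _)).sub ((s _ _ _).mul (s _ _ _))
  rw [pd_add (((s _ _ _).pd _).sub ((s _ _ _).pd _)) (Smf.sum s2),
    pd_sub ((s _ _ _).pd _) ((s _ _ _).pd _), pd_sum _ _ s2]
  congr 1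
  simp only [← Finset.sum_add_distrib, ← Finset.sum_sub_distrib]
  refine Finset.sum_congr rfl fun k _ => ?_
  rw [pd_sub ((s _ _ _).mul (s _ _ _)) ((s _ _ _).mul (s _ _ _)), pd_mul (s _ _ _) (s _ _ _),
    pd_mul (s _ _ _) (s _ _ _)]
  ring

def cOm (g : MetricField n) (x : Pt n) (f c d : Fin n) : Matrix (Fin n) (Fin n) ℝ :=
  Matrix.of (fun e h => pd (fun y => Om g y c d e h) f x) +
    GaM g x f * Matrix.of (Om g x c d) - Matrix.of (Om g x c d) * GaM g x f

theorem cOm_cyc (hg : MetOK g) (x : Pt n) (f c d : Fin n) :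
    cOm g x f c d + cOm g x c d f + cOm g x d f c = 0 := by
  unfold cOm
  have hs : ∀ c b a, ddGa g x c b a = ddGa g x b c a := fun c b a => by
    ext e f; simp only [ddGa, Matrix.of_apply]; exact pd_comm (hg.sm_chr _ _ _) b c
  rw [dOm_mat hg, dOm_mat hg, dOm_mat hg, Om_mat, Om_mat, Om_mat, hs d c f, hs d f c, hs c f d]
  noncomm_ring

theorem sm_Om (hg : MetOK g) (c d e h : Fin n) : Smf fun y => Om g y c d e h := by
  have s := fun e a f => hg.sm_chr e a f
  unfold Om
  exact (((s _ _ _).pd _).sub ((s _ _ _).pd _)).add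
    (Smf.sum fun k => ((s _ _ _).mul (s _ _ _)).sub ((s _ _ _).mul (s _ _ _)))

theorem nab_riem (hg : MetOK g) (x : Pt n) (f a b c d : Fin n) :
    nab g f (riemann g : Ten n (Fin 4)) x ![a, b, c, d] =
      ∑ e, g x a e * cOm g x f c d e b
      - ∑ h, christoffel g x h f c * riemann g x ![a, b, h, d]
      - ∑ h, christoffel g x h f d * riemann g x ![a, b, c, h] := by
  have u0 : ∀ h, Function.update ![a, b, c, d] 0 h = ![h, b, c, d] := fun h => by
    funext i; fin_cases i <;> simp
  have u1 : ∀ h, Function.update ![a, b, c, d] 1 h = ![a, h, c, d] := fun h => by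
    funext i; fin_cases i <;> simp
  have u2 : ∀ h, Function.update ![a, b, c, d] 2 h = ![a, b, h, d] := fun h => by
    funext i; fin_cases i <;> simp
  have u3 : ∀ h, Function.update ![a, b, c, d] 3 h = ![a, b, c, h] := fun h => by
    funext i; fin_cases i <;> simp
  rw [nab, Fin.sum_univ_four]
  simp only [u0, u1, u2, u3]
  simp only [Matrix.cons_val]
  have h1 : pd (fun y => riemann g y ![a, b, c, d]) f x =
      ∑ e, (pd (fun y => g y a e) f x * Om g x c d e b
        + g x a e * pd (fun y => Om g y c d e b) f x) := by
    have : (fun y => riemann g y ![a, b, c, d]) = fun y => ∑ e, g y a e * Om g y c d e b := rfl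
    rw [this, pd_sum _ _ (fun e => (hg.sm _ _).mul (sm_Om hg _ _ _ _))]
    exact Finset.sum_congr rfl fun e _ => pd_mul (hg.sm _ _) (sm_Om hg _ _ _ _)
  have h2 : ∑ e, g x a e * cOm g x f c d e b = ∑ e, g x a e * pd (fun y => Om g y c d e b) f x
     + ∑ e, ∑ h, g x a e * (christoffel g x e f h * Om g x c d h b)
     - ∑ e, ∑ h, g x a e * (Om g x c d e h * christoffel g x h f b) := by
    rw [← Finset.sum_add_distrib, ← Finset.sum_sub_distrib]
    refine Finset.sum_congr rfl fun e _ => ?_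
    simp only [cOm, GaM, Matrix.add_apply, Matrix.sub_apply, Matrix.of_apply, Matrix.mul_apply]
    rw [mul_sub, mul_add, Finset.mul_sum, Finset.mul_sum]
  have h3 : ∑ e, pd (fun y => g y a e) f x * Om g x c d e b =
      ∑ h, christoffel g x h f a * riemann g x ![h, b, c, d] +
      ∑ e, ∑ h, g x a e * (christoffel g x e f h * Om g x c d h b) := by
    have : ∀ e, pd (fun y => g y a e) f x * Om g x c d e b =
       ∑ h, christoffel g x h f a * (g x h e * Om g x c d e b) +
       ∑ h, g x a h * (christoffel g x h f e * Om g x c d e b) := fun e => by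
      rw [hg.pd_g, Finset.sum_mul, ← Finset.sum_add_distrib]
      exact Finset.sum_congr rfl fun h _ => by ring
    simp only [this, Finset.sum_add_distrib]
    congr 1
    · rw [Finset.sum_comm]
      refine Finset.sum_congr rfl fun h _ => ?_
      rw [riemann_eq, Finset.mul_sum]; rfl
    · rw [Finset.sum_comm]
  have h4 : ∑ h, christoffel g x h f b * riemann g x ![a, h, c, d] =
      ∑ e, ∑ h, g x a e * (Om g x c d e h * christoffel g x h f b) := by
    rw [Finset.sum_comm]
    refine Finset.sum_congr rfl fun h _ => ?_
    rw [riemann_eq, Finset.mul_sum]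
    exact Finset.sum_congr rfl fun e _ => by simp; ring
  rw [h1, Finset.sum_add_distrib, h2, h3, h4]
  ring

theorem riem_bianchi2 (hg : MetOK g) (x : Pt n) (f a b c d : Fin n) :
    nab g f (riemann g : Ten n (Fin 4)) x ![a, b, c, d] +
    nab g c (riemann g : Ten n (Fin 4)) x ![a, b, d, f] +
    nab g d (riemann g : Ten n (Fin 4)) x ![a, b, f, c] = 0 := by
  rw [nab_riem hg, nab_riem hg, nab_riem hg]
  have h : ∑ e, g x a e * cOm g x f c d e b + ∑ e, g x a e * cOm g x c d f e b +
      ∑ e, g x a e * cOm g x d f c e b = 0 := by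
    rw [← Finset.sum_add_distrib, ← Finset.sum_add_distrib]
    refine Finset.sum_eq_zero fun e _ => ?_
    have := congrFun (congrFun (cOm_cyc hg x f c d) e) b
    simp only [Matrix.add_apply, Matrix.zero_apply] at this
    rw [← mul_add, ← mul_add, this, mul_zero]
  have k : ∀ c d f, ∑ h, christoffel g x h f c * riemann g x ![a, b, h, d] =
      - ∑ h, christoffel g x h c f * riemann g x ![a, b, d, h] := fun c d f => by
    rw [← Finset.sum_neg_distrib]
    refine Finset.sum_congr rfl fun h _ => ?_
    rw [riem_anti23, hg.chr_symm x h f c]; ring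
  rw [k c d f, k d f c, k f c d]
  linarith

end riemsym


section frame

theorem gdot_mulVec {n : ℕ} (g : MetricField n) (x : Pt n) (P : Matrix (Fin n) (Fin n) ℝ)
    (a b : Fin n → ℝ) : gdot g x (P.mulVec a) (P.mulVec b) =
      a ⬝ᵥ ((P.transpose * g x * P).mulVec b) := by
  have h : ∀ X Y, gdot g x X Y = X ⬝ᵥ ((g x).mulVec Y) := fun X Y => by
    simp only [gdot, dotProduct, Matrix.mulVec, Finset.mul_sum]
    exact Finset.sum_congr rfl fun i _ => Finset.sum_congr rfl fun j _ => by ring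
  rw [h, Matrix.mulVec_mulVec, Matrix.dotProduct_mulVec, ← Matrix.vecMul_transpose,
    Matrix.vecMul_vecMul, ← Matrix.dotProduct_mulVec, Matrix.mul_assoc]

theorem exists_frame {n : ℕ} [NeZero n] (hn3 : 3 ≤ n) (g : MetricField n) (hg : IsLorentzMetric g)
    (x : Pt n) (u : Fin n → ℝ) (hu : u ≠ 0) (h0 : gdot g x u u = 0) :
    ∃ fr : NullFrameAt g x, fr.e 0 = u := by
  obtain ⟨P, hP, hd⟩ := hg.2.2 x
  obtain ⟨k, rfl⟩ : ∃ k, n = k + 1 := ⟨n - 1, by omega⟩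
  have hk : 2 ≤ k := by omega
  have : NeZero k := ⟨by omega⟩
  have G : ∀ (s t : ℝ) (a b : EuclideanSpace ℝ (Fin k)),
      gdot g x (P.mulVec (Fin.cons s (fun i => a i))) (P.mulVec (Fin.cons t (fun i => b i))) =
        - (s * t) + inner ℝ a b := by
    intro s t a b
    rw [gdot_mulVec, hd]
    simp only [dotProduct, Matrix.mulVec_diagonal]
    rw [Fin.sum_univ_succ]
    simp [PiLp.inner_apply]
    exact Finset.sum_congr rfl fun i _ => by ring
  obtain ⟨c, hc⟩ : ∃ c, u = P.mulVec c := ⟨P⁻¹.mulVec u, by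
    rw [Matrix.mulVec_mulVec, Matrix.mul_nonsing_inv _ hP, Matrix.one_mulVec]⟩
  obtain ⟨s, a, hsa⟩ : ∃ (s : ℝ) (a : EuclideanSpace ℝ (Fin k)), c = Fin.cons s (fun i => a i) :=
    ⟨c 0, WithLp.toLp 2 (fun i => c i.succ), by
      funext i; refine Fin.cases ?_ ?_ i
      · rfl
      · intro j; rfl⟩
  rw [hsa] at hc
  have hn : - (s * s) + inner ℝ a a = 0 := by rw [← G, ← hc]; exact h0
  have hs : s ≠ 0 := by
    rintro rfl
    simp at hn
    apply hu
    rw [hc, hn]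
    have : (Fin.cons (0:ℝ) (fun i => (0 : EuclideanSpace ℝ (Fin k)) i) : Fin (k+1) → ℝ) = 0 := by
      funext i; refine Fin.cases ?_ ?_ i
      · rfl
      · intro j; rfl
    rw [this, Matrix.mulVec_zero]
  have hf0 : inner ℝ (s⁻¹ • a) (s⁻¹ • a) = (1 : ℝ) := by
    rw [inner_smul_left, inner_smul_right]
    have : inner ℝ a a = s * s := by linarith
    rw [this]; simp; field_simp
  obtain ⟨f, hf⟩ := Orthonormal.exists_orthonormalBasis_extension_of_card_eq (𝕜 := ℝ)
    (E := EuclideanSpace ℝ (Fin k)) (ι := Fin k) (by simp) (v := fun _ => s⁻¹ • a) (s := {0}) (by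
      rw [orthonormal_iff_ite]
      rintro ⟨i, rfl⟩ ⟨j, rfl⟩
      simpa using hf0)
  have hf' : f 0 = s⁻¹ • a := hf 0 rfl
  have ho := orthonormal_iff_ite.mp f.orthonormal
  let e : Fin (k+1) → Fin (k+1) → ℝ := fun i =>
    if (i : ℕ) = 0 then u else if (i : ℕ) = 1 then
      P.mulVec (Fin.cons (- (2 * s)⁻¹) (fun j => ((2 * s)⁻¹ • f 0) j))
    else P.mulVec (Fin.cons 0 (fun j => f (Fin.ofNat k (i - 1)) j))
  have hu' : u = P.mulVec (Fin.cons s (fun j => (s • f 0) j)) := by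
    rw [hc, hf', smul_smul, mul_inv_cancel₀ hs, one_smul]
  have e0 : e 0 = u := rfl
  have hone : (((1 : Fin (k+1))) : ℕ) = 1 := by
    exact Nat.mod_eq_of_lt (a := 1) (by omega)
  have e1 : e 1 = P.mulVec (Fin.cons (- (2 * s)⁻¹) (fun j => ((2 * s)⁻¹ • f 0) j)) := by
    simp only [e, hone]; rfl
  have ei : ∀ i : Fin (k+1), 2 ≤ (i : ℕ) →
      e i = P.mulVec (Fin.cons 0 (fun j => f (Fin.ofNat k (i - 1)) j)) := fun i hi => by
    simp only [e]; rw [if_neg (by omega), if_neg (by omega)]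
  have hne : ∀ i : Fin (k+1), 2 ≤ (i : ℕ) → (0 : Fin k) ≠ Fin.ofNat k (i - 1) := fun i hi h => by
    have := congrArg Fin.val h
    have hi' := i.2
    simp [Fin.ofNat] at this
    rw [Nat.mod_eq_of_lt (by omega)] at this; omega
  refine ⟨⟨e, ?_, ?_, ?_, ?_, ?_, ?_⟩, e0⟩
  · rw [e0]; exact h0
  · rw [e1, G, inner_smul_left, inner_smul_right, ho]; simp
  · rw [e0, e1, hu', G, inner_smul_left, inner_smul_right, ho]; simp; field_simp; norm_num
  · intro i hi
    rw [e0, hu', ei i hi, G, inner_smul_left, ho, if_neg (hne i hi)]; simp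
  · intro i hi
    rw [e1, ei i hi, G, inner_smul_left, ho, if_neg (hne i hi)]; simp
  · intro i j hi hj
    rw [ei i hi, ei j hj, G, ho]
    have hi' := i.2
    have hj' := j.2
    have : (Fin.ofNat k (i - 1) = Fin.ofNat k (j - 1)) ↔ i = j := by
      rw [Fin.ext_iff, Fin.ext_iff]
      simp only [Fin.ofNat]
      rw [Nat.mod_eq_of_lt (by omega), Nat.mod_eq_of_lt (by omega)]; omega
    rw [zero_mul, neg_zero, zero_add]
    exact if_congr this rfl rfl

variable {n : ℕ} [NeZero n] {g : MetricField n} {ℓ : VecField n}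

/-- frame weight -/
def fw (a : Fin n) : ℤ := if (a : ℕ) = 0 then 1 else if (a : ℕ) = 1 then -1 else 0

theorem bw_eq {k : ℕ} (a : Fin k → Fin n) : bw a = ∑ m, fw (a m) := by
  unfold bw
  rw [Finset.card_filter, Finset.card_filter]
  push_cast
  rw [← Finset.sum_sub_distrib]
  refine Finset.sum_congr rfl fun m _ => ?_
  unfold fw
  split_ifs with h1 h2 <;> first | rfl | omega

theorem frame_exp (hn3 : 3 ≤ n) (B : Bg g ℓ) (x : Pt n) (fr : NullFrameAt g x) (h : fr.e 0 = ℓ x)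
    {w : ℤ} {v : Fin n → ℝ} (hv : Wt g ℓ x w v) :
    ∃ c : Fin n → ℝ, v = ∑ a, c a • fr.e a ∧ ∀ a, fw a < w → c a = 0 := by
  have hone : (((1 : Fin n)) : ℕ) = 1 := by
    exact Nat.mod_eq_of_lt (a := 1) (by omega)
  have hzero : (((0 : Fin n)) : ℕ) = 0 := rfl
  have hge : ∀ a : Fin n, a ≠ 0 → a ≠ 1 → 2 ≤ (a : ℕ) := fun a h0 h1 => by
    have h0' : (a : ℕ) ≠ 0 := fun h => h0 (Fin.ext h)
    have h1' : (a : ℕ) ≠ 1 := fun h => h1 (Fin.ext (h.trans hone.symm))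
    omega
  have h01 : (0 : Fin n) ≠ 1 := fun h => by have := congrArg Fin.val h; rw [hone] at this; simp at this
  let J : Matrix (Fin n) (Fin n) ℝ := Matrix.of fun a b => if b = Equiv.swap 0 1 a then 1 else 0
  have hJ : ∀ a b, gdot g x (fr.e a) (fr.e b) = J a b := by
    intro a b
    simp only [J, Matrix.of_apply]
    by_cases ha0 : a = 0
    · subst ha0
      rw [Equiv.swap_apply_left]
      by_cases hb0 : b = 0
      · subst hb0; rw [if_neg h01, fr.h00]
      by_cases hb1 : b = 1
      · subst hb1; rw [if_pos rfl, fr.h01]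
      rw [if_neg hb1, fr.h0i b (hge b hb0 hb1)]
    by_cases ha1 : a = 1
    · subst ha1
      rw [Equiv.swap_apply_right]
      by_cases hb0 : b = 0
      · subst hb0; rw [if_pos rfl, gdot_symm B.ok, fr.h01]
      by_cases hb1 : b = 1
      · subst hb1; rw [if_neg h01.symm, fr.h11]
      rw [if_neg hb0, fr.h1i b (hge b hb0 hb1)]
    rw [Equiv.swap_apply_of_ne_of_ne ha0 ha1]
    by_cases hb0 : b = 0
    · subst hb0; rw [if_neg (Ne.symm ha0), gdot_symm B.ok, fr.h0i a (hge a ha0 ha1)]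
    by_cases hb1 : b = 1
    · subst hb1; rw [if_neg (Ne.symm ha1), gdot_symm B.ok, fr.h1i a (hge a ha0 ha1)]
    rw [fr.hij a b (hge a ha0 ha1) (hge b hb0 hb1)]
    simp only [eq_comm]
  let E : Matrix (Fin n) (Fin n) ℝ := Matrix.of fr.e
  have hEJ : E * g x * E.transpose = J := by
    ext a b
    rw [← hJ]
    simp only [Matrix.mul_apply, gdot, Matrix.transpose_apply, E, Matrix.of_apply, Finset.sum_mul]
    rw [Finset.sum_comm]
    exact Finset.sum_congr rfl fun i _ => Finset.sum_congr rfl fun j _ => by ring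
  have hJJ : J * J = 1 := by
    ext a b
    simp only [J, Matrix.mul_apply, Matrix.one_apply, Matrix.of_apply]
    rw [Finset.sum_eq_single (Equiv.swap 0 1 a)]
    · simp [eq_comm]
    · intro c _ hc; rw [if_neg hc, zero_mul]
    · simp
  have hE : (g x * E.transpose * J) * E = 1 := by
    rw [mul_eq_one_comm, ← mul_assoc, ← mul_assoc, hEJ, hJJ]
  refine ⟨Matrix.vecMul v (g x * E.transpose * J), ?_, ?_⟩
  · have : v = Matrix.vecMul (Matrix.vecMul v (g x * E.transpose * J)) E := by
      rw [Matrix.vecMul_vecMul, hE, Matrix.vecMul_one]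
    conv_lhs => rw [this]
    funext b
    simp [Matrix.vecMul, dotProduct, E, Finset.sum_apply]
  · have hc : ∀ a, Matrix.vecMul v (g x * E.transpose * J) a =
        gdot g x v (fr.e (Equiv.swap 0 1 a)) := by
      intro a
      rw [← Matrix.vecMul_vecMul, ← Matrix.vecMul_vecMul]
      have : ∀ b, Matrix.vecMul (Matrix.vecMul v (g x)) E.transpose b = gdot g x v (fr.e b) := by
        intro b
        simp only [Matrix.vecMul, dotProduct, gdot, E, Matrix.transpose_apply, Matrix.of_apply, Finset.sum_mul]
        rw [Finset.sum_comm]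
        exact Finset.sum_congr rfl fun i _ => Finset.sum_congr rfl fun j _ => by ring
      rw [Matrix.vecMul]
      simp only [dotProduct, this, J, Matrix.of_apply]
      rw [Finset.sum_eq_single (Equiv.swap 0 1 a)]
      · simp
      · intro b _ hb
        rw [if_neg (fun h => hb (by rw [h, Equiv.swap_apply_self])), mul_zero]
      · simp
    intro a ha
    rw [hc]
    by_cases h2 : 2 ≤ w
    · rw [hv.2.2 h2]; simp [gdot]
    unfold fw at ha
    by_cases ha0 : a = 0
    · subst ha0; rw [if_pos hzero] at ha; omega
    by_cases ha1 : a = 1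
    · subst ha1; rw [Equiv.swap_apply_right, h]
      rw [hone] at ha; simp at ha
      exact hv.1 (by omega)
    · have := hge a ha0 ha1
      rw [if_neg (by omega), if_neg (by omega)] at ha
      obtain ⟨r, rfl⟩ := hv.2.1 (by omega)
      rw [Equiv.swap_apply_of_ne_of_ne ha0 ha1, gdot_smul_left, ← h, fr.h0i a this, mul_zero]

theorem fil_of_boost (hn3 : 3 ≤ n) (hg : IsLorentzMetric g) (B : Bg g ℓ) {k : ℕ} {T : TensorField n k} {b : ℤ}
    (hT : BoostOrderLE g ℓ T b) (x : Pt n) : FilQ g ℓ x ∅ b (T x : (Fin k → Fin n) → ℝ) := by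
  intro w v hw _ hd
  obtain ⟨fr, hfr⟩ := exists_frame hn3 g hg x (ℓ x) (B.ne x) (B.null x)
  choose c hc hc0 using fun m => frame_exp hn3 B x fr hfr (hw m)
  have : v = fun m => ∑ a, c m a • fr.e a := funext hc
  rw [this, MultilinearMap.map_sum]
  refine Finset.sum_eq_zero fun a _ => ?_
  rw [MultilinearMap.map_smul_univ]
  by_cases hex : ∃ m, fw (a m) < w m
  · obtain ⟨m, hm⟩ := hex
    rw [Finset.prod_eq_zero (Finset.mem_univ m) (hc0 m _ hm), zero_smul]
  · push Not at hex
    have h1 := hT x fr hfr a (by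
      rw [bw_eq]; exact lt_of_lt_of_le hd (Finset.sum_le_sum fun m _ => hex m))
    rw [evM_apply]
    unfold frameComp at h1
    rw [h1, smul_zero]

end frame


section ball
variable {n : ℕ} {g : MetricField n} {ℓ : VecField n}
  {ι κ : Type} [Fintype ι] [DecidableEq ι] [Fintype κ] [DecidableEq κ]

theorem fil_NN (B : Bg g ℓ) (x : Pt n) : FilQ g ℓ x ∅ (-1) (NN g ℓ x) := by
  intro w v hw _ hd
  have hev : evM (NN g ℓ x) v = gdot g x (v (some ())) (∑ b, v none b • nabV g b ℓ x) := by
    rw [B.gdot_nX]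
    have hv : v = oc (v none) (oc (v (some ())) Empty.elim ∘ fun _ => none) := by
      funext o; rcases o with _ | _ <;> rfl
    have : evM (NN g ℓ x) v = ∑ b, v none b * ∑ a, v (some ()) a * nablaLow g ℓ x b a := by
      conv_lhs => rw [← oc_eta v]
      rw [evM_oc]
      refine Finset.sum_congr rfl fun b _ => ?_
      congr 1
      rw [evM_apply, ← (Equiv.funUnique Unit (Fin n)).symm.sum_comp]
      refine Finset.sum_congr rfl fun a _ => ?_
      have h := CD_lf B x (oc b ((Equiv.funUnique Unit (Fin n)).symm a))
      simp only [NN]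
      rw [h]; simp; ring
    rw [this]
    simp only [Finset.mul_sum]
    rw [Finset.sum_comm]
    exact Finset.sum_congr rfl fun b _ => Finset.sum_congr rfl fun a _ => by ring
  rw [hev]
  rw [Fintype.sum_option] at hd
  have hd' : -1 < w none + w (some ()) := by simpa using hd
  have hX := hw none
  have hY := hw (some ())
  by_cases h1 : 1 ≤ w none
  · obtain ⟨c, hc⟩ := hX.2.1 h1
    have : ∑ b, v none b • nabV g b ℓ x = 0 := by
      rw [hc]
      have : ∀ b, (c • ℓ x) b • nabV g b ℓ x = c • (ℓ x b • nabV g b ℓ x) := fun b => by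
        rw [smul_smul]; rfl
      simp only [this, ← Finset.smul_sum, B.nl_l, smul_zero]
    rw [this]; simp [gdot]
  by_cases h0 : 0 ≤ w none
  · obtain ⟨c, hc⟩ := B.nX_prop x (v none) (hX.1 h0)
    rw [hc, gdot_symm B.ok, gdot_smul_left, gdot_symm B.ok, hY.1 (by omega), mul_zero]
  · obtain ⟨c, hc⟩ := hY.2.1 (by omega)
    rw [hc, gdot_smul_left, gdot_symm B.ok, B.nX_perp, mul_zero]

theorem balA (B : Bg g ℓ) {T : Ten n ι} {j : ℕ} {c : ℤ} (sT : Sm T)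
    (hN : BalQ g ℓ ∅ j (-1) (NN g ℓ)) (hR : BalQ g ℓ ∅ j 0 (riemann g : Ten n (Fin 4)))
    (h : BalQ g ℓ ∅ (j+1) c T) : BalQ g ℓ ∅ j c (CD g T) := by
  induction j generalizing c T with
  | zero => exact fun x => Fil.CD B sT h.1 (h.2 x)
  | succ j ih =>
    refine ⟨fun x => Fil.CD B sT h.1 (h.2.fil x), ?_⟩
    rw [DD_CD B sT]
    have sR := Sm.riemann B.ok
    have h1 := ih (sT.DD B) hN.pred hR.pred h.2
    have h2 := Bal.NS B (sT.CD B.ok) hN.pred (ih sT hN.pred hR.pred h.pred)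
    have h3 := Bal.cl B (Sm.act B.ok sR sT) (Bal.act B sR sT hR.pred h.pred.pred)
    refine ((h1.sub B ((sT.DD B).CD B.ok) (Sm.NS B (sT.CD B.ok))
      (h2.mono (by omega) (le_refl _))).sub B (((sT.DD B).CD B.ok).sub (Sm.NS B (sT.CD B.ok)))
      (Sm.cl B (Sm.act B.ok sR sT)) (h3.mono (by omega) (le_refl _)))

theorem balB (B : Bg g ℓ) {T : Ten n ι} {j : ℕ} {c : ℤ} (sT : Sm T)
    (hN : BalQ g ℓ ∅ j (-1) (NN g ℓ)) (hR : BalQ g ℓ ∅ j 0 (riemann g : Ten n (Fin 4)))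
    (h : BalQ g ℓ ∅ j c T) : BalQ g ℓ {none} j c (CD g T) := by
  induction j generalizing c T with
  | zero => exact fun x => Fil.CDQ B sT h
  | succ j ih =>
    refine ⟨fun x => Fil.CDQ B sT h.1, ?_⟩
    rw [DD_CD B sT]
    have sR := Sm.riemann B.ok
    have h1 := ih (sT.DD B) hN.pred hR.pred h.2
    have h2 := Bal.NS B (sT.CD B.ok) hN.pred (balA B sT hN.pred hR.pred h)
    have h3 := Bal.cl B (Sm.act B.ok sR sT) (Bal.act B sR sT hR.pred h.pred)
    refine ((h1.sub B ((sT.DD B).CD B.ok) (Sm.NS B (sT.CD B.ok))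
      (h2.mono (by omega) (Set.empty_subset _))).sub B (((sT.DD B).CD B.ok).sub (Sm.NS B (sT.CD B.ok)))
      (Sm.cl B (Sm.act B.ok sR sT)) (h3.mono (by omega) (Set.empty_subset _)))

theorem lemC (x : Pt n) (t : (Fin 4 → Fin n) → ℝ) {c : ℤ}
    (hs : ∀ idx, t (fun i => idx ((Equiv.swap 0 2 * Equiv.swap 1 3 : Equiv.Perm (Fin 4)) i)) = t idx)
    (h1 : FilQ g ℓ x ∅ (-1) t) (h2 : FilQ g ℓ x {0, 1} c t) : FilQ g ℓ x ∅ c t := by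
  intro w v hw _ hd
  by_cases hbig : ∃ m, 2 ≤ w m
  · obtain ⟨m, hm⟩ := hbig
    exact (evM t).map_coord_zero m ((hw m).2.2 hm)
  push Not at hbig
  let w' : Fin 4 → ℤ := fun m => max (w m) (-1)
  have hw' : ∀ m, Wt g ℓ x (w' m) (v m) := fun m => by
    by_cases h : -1 ≤ w m
    · simp only [w']; rw [max_eq_left h]; exact hw m
    · exact Wt.neg_one _ (by simp only [w']; omega)
  have hb : ∀ m, -1 ≤ w' m ∧ w' m ≤ 1 := fun m => by
    have := hbig m; simp only [w']; omega
  have hd' : c < ∑ m, w' m :=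
    lt_of_lt_of_le hd (Finset.sum_le_sum fun m _ => le_max_left _ _)
  rw [Fin.sum_univ_four] at hd'
  have b0 := hb 0
  have b1 := hb 1
  have b2 := hb 2
  have b3 := hb 3
  by_cases hA : w' 0 ≤ 0 ∧ w' 1 ≤ 0
  · refine h2 w' v hw' ?_ (by rw [Fin.sum_univ_four]; exact hd')
    rintro m (rfl | rfl)
    · exact hA.1
    · exact hA.2
  by_cases hB : w' 2 ≤ 0 ∧ w' 3 ≤ 0
  · have he : evM t v = evM t (fun i => v ((Equiv.swap 0 2 * Equiv.swap 1 3 : Equiv.Perm (Fin 4)) i)) := by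
      rw [← evM_rl]; congr 1; congr 1; funext idx; exact (hs idx).symm
    rw [he]
    refine h2 (fun i => w' ((Equiv.swap 0 2 * Equiv.swap 1 3 : Equiv.Perm (Fin 4)) i)) _
      (fun m => hw' _) ?_ ?_
    · rintro m (rfl | rfl)
      · exact hB.1
      · exact hB.2
    · rw [Fin.sum_univ_four]
      change c < w' 2 + w' 3 + w' 0 + w' 1
      omega
  · refine h1 w' v hw' (by simp) ?_
    rw [Fin.sum_univ_four]
    rw [not_and_or] at hA hB
    omega

def tau : Fin 4 ≃ Fin 4 := Equiv.swap 0 2 * Equiv.swap 1 3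

theorem lemC' (B : Bg g ℓ) {T : Ten n (Fin 4)} {j : ℕ} {c : ℤ} (sT : Sm T) (hs : rl tau T = T)
    (h1 : ∀ x, FilQ g ℓ x ∅ (-1) (T x)) (h2 : BalQ g ℓ {0, 1} j c T) : BalQ g ℓ ∅ j c T := by
  have hp : ∀ (T : Ten n (Fin 4)), rl tau T = T → ∀ x idx,
      T x (fun i => idx ((Equiv.swap 0 2 * Equiv.swap 1 3 : Equiv.Perm (Fin 4)) i)) = T x idx :=
    fun T h x idx => congrFun (congrFun h x) idx
  induction j generalizing c T with
  | zero => exact fun x => lemC x (T x) (hp T hs x) (h1 x) (h2 x)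
  | succ j ih =>
    refine ⟨fun x => lemC x (T x) (hp T hs x) (h1 x) (h2.1 x), ?_⟩
    refine ih (sT.DD B) ?_ (fun x => Fil.DD B sT h1) h2.2
    rw [← DD_rl, hs]

/-! curvature decomposition -/

def Kt (g : MetricField n) : Ten n Empty := fun x _ => ricciScalar g x / ((n : ℝ) * ((n : ℝ) - 1))

def E4 : Option (Option (Option (Option Empty))) ≃ Fin 4 where
  toFun
    | none => 0
    | some none => 2
    | some (some none) => 1
    | some (some (some none)) => 3
  invFun i := ![none, some (some none), some none, some (some (some none))] i
  left_inv := by rintro (_ | _ | _ | _ | k) <;> first | rfl | exact k.elim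
  right_inv := by intro i; fin_cases i <;> rfl

def KG (g : MetricField n) : Ten n (Fin 4) :=
  rl E4 (gc g (gc g (Kt g))) - rl (E4.trans (Equiv.swap 2 3)) (gc g (gc g (Kt g)))

def PP (g : MetricField n) : Ten n (Fin 4) := riemann g - KG g

theorem KG_apply (x : Pt n) (a b c d : Fin n) : KG g x ![a, b, c, d] =
    ricciScalar g x / ((n : ℝ) * ((n : ℝ) - 1)) * (g x a c * g x b d - g x a d * g x b c) := by
  simp only [KG, Pi.sub_apply, rl, gc, pgc, E4, Kt]
  simp [Equiv.swap_apply_def]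
  ring

theorem Sm.ricci (hg : MetOK g) (b d : Fin n) : Smf fun x => ricci g x b d := by
  unfold VSI.ricci
  exact Smf.sum fun _ => Smf.sum fun _ => (hg.sm_inv _ _).mul (Sm.riemann hg _)

theorem Sm.rscal (hg : MetOK g) : Smf fun x => ricciScalar g x := by
  unfold ricciScalar
  exact Smf.sum fun _ => Smf.sum fun _ => (hg.sm_inv _ _).mul (Sm.ricci hg _ _)

theorem Sm.Kt (hg : MetOK g) : Sm (Kt g) := fun idx => (Sm.rscal hg).div_const _

theorem Sm.KG (hg : MetOK g) : Sm (KG g) :=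
  ((((Sm.Kt hg).gc hg).gc hg).rl _).sub ((((Sm.Kt hg).gc hg).gc hg).rl _)

theorem Sm.PP (hg : MetOK g) : Sm (PP g) := (Sm.riemann hg).sub (Sm.KG hg)

theorem fin4_eta (idx : Fin 4 → Fin n) : idx = ![idx 0, idx 1, idx 2, idx 3] := by
  funext i; fin_cases i <;> rfl

theorem PP_pair (hg : MetOK g) : rl tau (PP g) = PP g := by
  have h1 : rl tau (riemann g : Ten n (Fin 4)) = riemann g := by
    funext x idx
    rw [fin4_eta idx, riem_pair hg]
    unfold rl; congr 1; funext i; fin_cases i <;> rfl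
  have h2 : rl tau (KG g) = KG g := by
    funext x idx
    rw [fin4_eta idx, KG_apply]
    have : rl tau (KG g) x ![idx 0, idx 1, idx 2, idx 3] = KG g x ![idx 2, idx 3, idx 0, idx 1] := by
      unfold rl; congr 1; funext i; fin_cases i <;> rfl
    rw [this, KG_apply, hg.symm x (idx 2) (idx 0), hg.symm x (idx 3) (idx 1), hg.symm x (idx 2) (idx 1),
      hg.symm x (idx 3) (idx 0)]
    ring
  unfold PP; rw [rl_sub, h1, h2]

def E2 : Option (Option (Fin 2)) ≃ Fin 4 where
  toFun
    | none => 0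
    | some none => 2
    | some (some 0) => 3
    | some (some 1) => 1
  invFun i := ![none, some (some 1), some none, some (some 0)] i
  left_inv := by
    rintro (_ | _ | k)
    · rfl
    · rfl
    · fin_cases k <;> rfl
  right_inv := by intro i; fin_cases i <;> rfl

theorem ricci_symm (hg : MetOK g) (x : Pt n) (b d : Fin n) : ricci g x b d = ricci g x d b := by
  unfold ricci
  rw [Finset.sum_comm]
  refine Finset.sum_congr rfl fun a _ => Finset.sum_congr rfl fun c _ => ?_
  rw [riem_pair hg, hg.inv_symm]

theorem PP_decomp (hn3 : 3 ≤ n) (hg : MetOK g) (x : Pt n) :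
    PP g x = (weyl g x : (Fin 4 → Fin n) → ℝ) + (1 / ((n : ℝ) - 2)) •
      ((rl E2 (gc g (tracelessRicci g : Ten n (Fin 2))) x
      - rl (E2.trans (Equiv.swap 2 3)) (gc g (tracelessRicci g : Ten n (Fin 2))) x)
      - (rl (E2.trans (Equiv.swap 0 1)) (gc g (tracelessRicci g : Ten n (Fin 2))) x
      - rl (E2.trans (Equiv.swap 0 1 * Equiv.swap 2 3)) (gc g (tracelessRicci g : Ten n (Fin 2))) x)) := by
  funext idx
  rw [fin4_eta idx]
  generalize idx 0 = a
  generalize idx 1 = b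
  generalize idx 2 = c
  generalize idx 3 = d
  have hn : (3 : ℝ) ≤ n := by exact_mod_cast hn3
  have e1 : (n : ℝ) - 2 ≠ 0 := by intro h; linarith
  have e2 : (n : ℝ) - 1 ≠ 0 := by intro h; linarith
  have e3 : (n : ℝ) ≠ 0 := by intro h; linarith
  simp only [PP, Pi.sub_apply, KG_apply, Pi.add_apply, Pi.smul_apply, smul_eq_mul]
  have r1 : rl E2 (gc g (tracelessRicci g : Ten n (Fin 2))) x ![a,b,c,d] =
    g x a c * (ricci g x d b - ricciScalar g x / (n : ℝ) * g x d b) := rfl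
  have r2 : rl (E2.trans (Equiv.swap 2 3)) (gc g (tracelessRicci g : Ten n (Fin 2))) x ![a,b,c,d] =
    g x a d * (ricci g x c b - ricciScalar g x / (n : ℝ) * g x c b) := rfl
  have r3 : rl (E2.trans (Equiv.swap 0 1)) (gc g (tracelessRicci g : Ten n (Fin 2))) x ![a,b,c,d] =
    g x b c * (ricci g x d a - ricciScalar g x / (n : ℝ) * g x d a) := rfl
  have r4 : rl (E2.trans (Equiv.swap 0 1 * Equiv.swap 2 3)) (gc g (tracelessRicci g : Ten n (Fin 2))) x ![a,b,c,d] =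
    g x b d * (ricci g x c a - ricciScalar g x / (n : ℝ) * g x c a) := rfl
  have w : weyl g x ![a,b,c,d] = riemann g x ![a,b,c,d]
  - (1 / ((n : ℝ) - 2)) *
      (g x a c * ricci g x d b - g x a d * ricci g x c b - g x b c * ricci g x d a
       + g x b d * ricci g x c a)
  + (1 / (((n : ℝ) - 1) * ((n : ℝ) - 2))) * ricciScalar g x *
      (g x a c * g x d b - g x a d * g x c b) := rfl
  rw [r1, r2, r3, r4, w, hg.symm x d b, hg.symm x c b, hg.symm x d a, hg.symm x c a]
  field_simp
  ring

end ball


section bal9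
variable {n : ℕ} {g : MetricField n} {ℓ : VecField n}
  {ι κ : Type} [Fintype ι] [DecidableEq ι] [Fintype κ] [DecidableEq κ]

structure Bg2 (g : MetricField n) (ℓ : VecField n) : Prop extends Bg g ℓ where
  filP : ∀ x, FilQ g ℓ x ∅ (-1) (PP g x)
  hK : ∀ (x : Pt n) (X : Fin n → ℝ), gdot g x X (ℓ x) = 0 →
      (∑ a, X a * pd (fun y => Kt g y Empty.elim) a x) = 0

theorem mk_Bg2 [NeZero n] (hn3 : 3 ≤ n) (hg : IsLorentzMetric g) (B : Bg g ℓ)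
    (hWeyl : BoostOrderLE g ℓ (weyl g) (-1))
    (hTRic : BoostOrderLE g ℓ (tracelessRicci g) (-1))
    (hR : ∀ (x : Pt n) (X : Fin n → ℝ), gdot g x X (ℓ x) = 0 →
      (∑ a, X a * pd (fun y => ricciScalar g y) a x) = 0) : Bg2 g ℓ where
  toBg := B
  filP x := by
    rw [PP_decomp hn3 B.ok x]
    have h1 := fil_of_boost hn3 hg B hWeyl x
    have h2 := Fil.pgc B (fil_of_boost hn3 hg B hTRic x)
    refine h1.add (FilQ.smul _ ?_)
    rw [sub_eq_add_neg, sub_eq_add_neg, sub_eq_add_neg]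
    exact ((Fil.rl E2 h2).add (Fil.rl _ h2).neg).add ((Fil.rl _ h2).add (Fil.rl _ h2).neg).neg
  hK x X hX := by
    have h := hR x X hX
    have : ∀ a, pd (fun y => Kt g y Empty.elim) a x =
        (1 / ((n : ℝ) * ((n : ℝ) - 1))) * pd (fun y => ricciScalar g y) a x := fun a => by
      have e : (fun y => Kt g y Empty.elim) =
        fun y => (1 / ((n : ℝ) * ((n : ℝ) - 1))) * ricciScalar g y := by
        funext y; simp only [Kt]; ring
      rw [e, pd_const_mul]
      exact Sm.rscal B.ok
    simp only [this]
    rw [show ∑ a, X a * (1 / ((n : ℝ) * ((n : ℝ) - 1)) * pd (fun y => ricciScalar g y) a x) =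
      (1 / ((n : ℝ) * ((n : ℝ) - 1))) * ∑ a, X a * pd (fun y => ricciScalar g y) a x by
        rw [Finset.mul_sum]; exact Finset.sum_congr rfl fun _ _ => by ring, h, mul_zero]

theorem nab_Kt (x : Pt n) (a : Fin n) (idx : Empty → Fin n) :
    nab g a (Kt g) x idx = pd (fun y => Kt g y Empty.elim) a x := by
  rw [Subsingleton.elim idx Empty.elim]; simp [nab]

theorem DD_Kt (B : Bg2 g ℓ) : DD g ℓ (Kt g) = 0 := by
  funext x idx
  simp only [DD, nab_Kt]
  exact B.hK x _ (B.null x)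

theorem fil_dK (B : Bg2 g ℓ) (x : Pt n) : FilQ g ℓ x ∅ (-1) (CD g (Kt g) x) := by
  intro w v hw _ hd
  have hd' : -1 < w none := by rw [Fintype.sum_option] at hd; simpa using hd
  rw [← oc_eta v, evM_CD]
  have : ∀ a, evM (nab g a (Kt g) x) (fun i => v (some i)) = pd (fun y => Kt g y Empty.elim) a x := by
    intro a; rw [evM_apply]; simp [nab_Kt]
  simp only [this]
  exact B.hK x _ ((hw none).1 (by omega))

theorem bal_Kt (B : Bg2 g ℓ) (j : ℕ) : BalQ g ℓ ∅ j 0 (Kt g) := by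
  have h0 : ∀ x, FilQ g ℓ x ∅ 0 (Kt g x) := fun x w v _ _ hd => by simp at hd
  cases j with
  | zero => exact h0
  | succ j => exact ⟨h0, by rw [DD_Kt B]; exact BalQ.zero⟩

theorem bal_KG (B : Bg2 g ℓ) (j : ℕ) : BalQ g ℓ ∅ j 0 (KG g) := by
  have s := Sm.Kt B.ok
  have h := Bal.gc B.toBg (s.gc B.ok) (Bal.gc B.toBg s (bal_Kt B j))
  have s2 := (s.gc B.ok).gc B.ok
  exact (Bal.rl _ h).sub B.toBg (s2.rl _) (s2.rl _) (Bal.rl _ h)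

theorem DD_KG (B : Bg2 g ℓ) : DD g ℓ (KG g) = 0 := by
  have s := Sm.Kt B.ok
  have s2 := (s.gc B.ok).gc B.ok
  have h : DD g ℓ (gc g (gc g (Kt g))) = 0 := by
    rw [DD_gc B.ok (s.gc B.ok), DD_gc B.ok s, DD_Kt B]
    funext x idx; simp [gc, pgc]
  unfold KG
  rw [sub_eq_add_neg, ← neg_one_smul ℝ, DD_add (s2.rl _) ((s2.rl _).smul _), DD_smul (s2.rl _),
    DD_rl, DD_rl, h, rl_zero, rl_zero]; simp

theorem bal_CDKG (B : Bg2 g ℓ) {j : ℕ} (h : BalQ g ℓ ∅ j (-1) (CD g (Kt g))) :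
    BalQ g ℓ ∅ j (-1) (CD g (KG g)) := by
  have s := Sm.Kt B.ok
  have s1 := s.gc B.ok
  have s2 := s1.gc B.ok
  have sd := s.CD B.ok
  have h2 : BalQ g ℓ ∅ j (-1) (CD g (gc g (gc g (Kt g)))) := by
    rw [CD_gc B.ok s1, CD_gc B.ok s]
    exact Bal.rl _ (Bal.gc B.toBg ((sd.gc B.ok).rl _) (Bal.rl _ (Bal.gc B.toBg sd h)))
  unfold KG
  rw [sub_eq_add_neg, ← neg_one_smul ℝ (rl (E4.trans (Equiv.swap 2 3)) _), CD_add (s2.rl _) ((s2.rl _).smul _), CD_smul (s2.rl _),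
    CD_rl, CD_rl]
  have s3 := s2.CD B.ok
  exact (Bal.rl _ h2).add B.toBg (s3.rl _) ((s3.rl _).smul _) ((Bal.rl _ h2).smul B.toBg _ (s3.rl _))

def EE (g : MetricField n) (ℓ : VecField n) : Ten n (Option (Fin 3)) :=
  cl g ℓ (rl (Equiv.swap none (some none)) (CD g (rl (finSuccEquiv 3) (riemann g : Ten n (Fin 4)))))

theorem nab_riem_pair (hg : MetOK g) (x : Pt n) (f a b c d : Fin n) :
    nab g f (riemann g : Ten n (Fin 4)) x ![a, b, c, d] =
      nab g f (riemann g : Ten n (Fin 4)) x ![c, d, a, b] := by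
  have h1 : rl tau (riemann g : Ten n (Fin 4)) = riemann g := by
    funext x idx
    rw [fin4_eta idx, riem_pair hg]
    unfold rl; congr 1; funext i; fin_cases i <;> rfl
  conv_lhs => rw [← h1, nab_rl]
  unfold rl; congr 1; funext i; fin_cases i <;> rfl

theorem nab_riem_anti (hg : MetOK g) (x : Pt n) (f a b c d : Fin n) :
    nab g f (riemann g : Ten n (Fin 4)) x ![a, b, c, d] =
      - nab g f (riemann g : Ten n (Fin 4)) x ![b, a, c, d] := by
  have h1 : (-1 : ℝ) • rl (Equiv.swap 0 1) (riemann g : Ten n (Fin 4)) = riemann g := by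
    funext x idx
    rw [fin4_eta idx, riem_anti01 hg]
    simp only [Pi.smul_apply, smul_eq_mul, neg_one_mul]
    rfl
  conv_lhs => rw [← h1, nab_smul ((Sm.riemann hg).rl _), nab_rl]
  simp only [Pi.smul_apply, smul_eq_mul, neg_one_mul]
  rfl

theorem EE_apply (hg : MetOK g) (x : Pt n) (a b c d : Fin n) :
    EE g ℓ x (oc a ![b, c, d]) = ∑ f, ℓ x f * nab g a (riemann g : Ten n (Fin 4)) x ![f, b, c, d] := by
  unfold EE
  rw [cl_apply hg]
  refine Finset.sum_congr rfl fun f _ => ?_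
  congr 1

theorem DD_riem (hg : MetOK g) : DD g ℓ (riemann g : Ten n (Fin 4)) =
    rl (finSuccEquiv 3).symm (EE g ℓ) - rl ((finSuccEquiv 3).symm.trans (Equiv.swap 0 1)) (EE g ℓ) := by
  funext x idx
  rw [fin4_eta idx]
  generalize idx 0 = a
  generalize idx 1 = b
  generalize idx 2 = c
  generalize idx 3 = d
  have h1 : rl (finSuccEquiv 3).symm (EE g ℓ) x ![a, b, c, d] = EE g ℓ x (oc a ![b, c, d]) := by
    unfold rl; congr 1; funext o; rcases o with _ | o
    · rfl
    · fin_cases o <;> rfl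
  have h2 : rl ((finSuccEquiv 3).symm.trans (Equiv.swap 0 1)) (EE g ℓ) x ![a, b, c, d] =
      EE g ℓ x (oc b ![a, c, d]) := by
    unfold rl; congr 1; funext o; rcases o with _ | o
    · rfl
    · fin_cases o <;> rfl
  rw [Pi.sub_apply, Pi.sub_apply, h1, h2, EE_apply hg, EE_apply hg, ← Finset.sum_sub_distrib]
  refine Finset.sum_congr rfl fun f _ => ?_
  have b2 := riem_bianchi2 hg x f c d a b
  rw [nab_riem_pair hg x f c d a b, nab_riem_pair hg x a c d b f, nab_riem_pair hg x b c d f a,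
    nab_riem_anti hg x a b f] at b2
  rw [← mul_sub]; congr 1; linarith

theorem bal_all (B : Bg2 g ℓ) (j : ℕ) : BalQ g ℓ ∅ j (-1) (NN g ℓ) ∧ BalQ g ℓ ∅ j (-1) (PP g) ∧
    BalQ g ℓ ∅ j (-1) (CD g (Kt g)) := by
  have sR := Sm.riemann B.ok
  have sP := Sm.PP B.ok
  have sK := Sm.Kt B.ok
  have sdK := sK.CD B.ok
  have sN := Sm.NN B.toBg
  have sKG := Sm.KG B.ok
  have hRP : (riemann g : Ten n (Fin 4)) = PP g + KG g := by unfold PP; simp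
  induction j with
  | zero => exact ⟨fil_NN B.toBg, B.filP, fil_dK B⟩
  | succ j ih =>
    obtain ⟨hN, hP, hd⟩ := ih
    have hR : BalQ g ℓ ∅ j 0 (riemann g : Ten n (Fin 4)) := by
      rw [hRP]
      exact (hP.mono (by omega) (le_refl _)).add B.toBg sP sKG (bal_KG B j)
    refine ⟨⟨fil_NN B.toBg, ?_⟩, ⟨B.filP, ?_⟩, ⟨fil_dK B, ?_⟩⟩
    · have := DD_CD B.toBg (Sm.lf B.toBg)
      unfold NN
      rw [this, DD_lf B.toBg, CD_zero, zero_sub]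
      have h1 := Bal.NS B.toBg sN hN hN
      have h2 := Bal.cl B.toBg (Sm.act B.ok sR (Sm.lf B.toBg))
        (Bal.act B.toBg sR (Sm.lf B.toBg) hR (bal_lf B.toBg j))
      exact (h1.neg B.toBg (Sm.NS B.toBg sN)).sub B.toBg (Sm.NS B.toBg sN).neg
        (Sm.cl B.toBg (Sm.act B.ok sR (Sm.lf B.toBg))) h2
    · -- Weyl-like part
      have hDP : DD g ℓ (PP g) = DD g ℓ (riemann g : Ten n (Fin 4)) := by
        rw [hRP, DD_add sP sKG, DD_KG B, add_zero]
      refine lemC' B.toBg (sP.DD B.toBg) (by rw [← DD_rl, PP_pair B.ok])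
        (fun x => Fil.DD B.toBg sP B.filP) ?_
      rw [hDP, DD_riem B.ok]
      set P' := rl (finSuccEquiv 3) (PP g) with hP'
      set K' := rl (finSuccEquiv 3) (KG g) with hK'
      have sP' : Sm P' := sP.rl _
      have sK' : Sm K' := sKG.rl _
      have hE : EE g ℓ = CD g (cl g ℓ P') - NS g ℓ P'
          + cl g ℓ (rl (Equiv.swap none (some none)) (CD g K')) := by
        unfold EE
        rw [hRP, rl_add, CD_add sP' sK', rl_add, cl_add, CD_cl B.toBg sP']
        abel
      have bP' : BalQ g ℓ ∅ j (-1) P' := Bal.rl _ hP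
      have b1 : BalQ g ℓ {none} j (-2) (CD g (cl g ℓ P')) :=
        balB B.toBg (Sm.cl B.toBg sP') hN hR (Bal.cl B.toBg sP' bP')
      have b2 : BalQ g ℓ ∅ j (-2) (NS g ℓ P') := Bal.NS B.toBg sP' hN bP'
      have bK : BalQ g ℓ ∅ j (-1) (CD g K') := by
        rw [hK', CD_rl]; exact Bal.rl _ (bal_CDKG B hd)
      have b3 : BalQ g ℓ ∅ j (-2) (cl g ℓ (rl (Equiv.swap none (some none)) (CD g K'))) :=
        Bal.cl B.toBg ((sK'.CD B.ok).rl _) (Bal.rl _ bK)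
      have q1 := (Sm.cl B.toBg sP').CD B.ok
      have q2 := Sm.NS B.toBg sP'
      have q3 := Sm.cl B.toBg ((sK'.CD B.ok).rl (Equiv.swap none (some none)))
      have bE : BalQ g ℓ {none} j (-2) (EE g ℓ) := by
        rw [hE]
        exact (b1.sub B.toBg q1 q2 (b2.mono (le_refl _) (Set.empty_subset _))).add B.toBg
          (q1.sub q2) q3 (b3.mono (le_refl _) (Set.empty_subset _))
      have sE : Sm (EE g ℓ) := by rw [hE]; exact (q1.sub q2).add q3
      refine ((bE.rl (finSuccEquiv 3).symm).mono (le_refl _) ?_).sub B.toBg (sE.rl _) (sE.rl _)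
        ((bE.rl ((finSuccEquiv 3).symm.trans (Equiv.swap 0 1))).mono (le_refl _) ?_)
      · rintro _ ⟨_, rfl, rfl⟩; left; rfl
      · rintro _ ⟨_, rfl, rfl⟩; right; rfl
    · rw [DD_CD B.toBg sK, DD_Kt B, CD_zero, zero_sub]
      have h0 : act g (riemann g) (Kt g) = 0 := by unfold act; simp
      have h1 : cl g ℓ (0 : Ten n (Option (Option Empty))) = 0 := by
        funext x idx; rw [cl_apply B.ok]; simp
      rw [h0, h1, sub_zero]
      exact (Bal.NS B.toBg sdK hN hd).neg B.toBg (Sm.NS B.toBg sdK)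

/-! the class of balanced tensors -/

def Good (g : MetricField n) (ℓ : VecField n) (c : ℤ) (T : Ten n ι) : Prop :=
  Sm T ∧ ∀ j, BalQ g ℓ ∅ j c T

theorem good_PP (B : Bg2 g ℓ) : Good g ℓ (-1) (PP g) := ⟨Sm.PP B.ok, fun j => (bal_all B j).2.1⟩
theorem good_dK (B : Bg2 g ℓ) : Good g ℓ (-1) (CD g (Kt g)) :=
  ⟨(Sm.Kt B.ok).CD B.ok, fun j => (bal_all B j).2.2⟩
theorem good_Kt (B : Bg2 g ℓ) : Good g ℓ 0 (Kt g) := ⟨Sm.Kt B.ok, bal_Kt B⟩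

variable {c c' : ℤ} {T S : Ten n ι}

theorem Good.CD (B : Bg2 g ℓ) (h : Good g ℓ c T) : Good g ℓ c (CD g T) := by
  refine ⟨h.1.CD B.ok, fun j => ?_⟩
  obtain ⟨hN, hP, _⟩ := bal_all B j
  have hRP : (riemann g : Ten n (Fin 4)) = PP g + KG g := by unfold PP; simp
  refine balA B.toBg h.1 hN ?_ (h.2 (j+1))
  rw [hRP]
  exact (hP.mono (by omega) (le_refl _)).add B.toBg (Sm.PP B.ok) (Sm.KG B.ok) (bal_KG B j)

theorem Good.add (B : Bg2 g ℓ) (h : Good g ℓ c T) (h' : Good g ℓ c S) : Good g ℓ c (T + S) :=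
  ⟨h.1.add h'.1, fun j => (h.2 j).add B.toBg h.1 h'.1 (h'.2 j)⟩
theorem Good.smul (B : Bg2 g ℓ) (r : ℝ) (h : Good g ℓ c T) : Good g ℓ c (r • T) :=
  ⟨h.1.smul r, fun j => (h.2 j).smul B.toBg r h.1⟩
theorem Good.zero : Good g ℓ c (0 : Ten n ι) := ⟨Sm.zero, fun j => BalQ.zero⟩
theorem Good.mono (h : Good g ℓ c T) (hc : c ≤ c') : Good g ℓ c' T :=
  ⟨h.1, fun j => (h.2 j).mono hc (le_refl _)⟩
theorem Good.rl (e : ι ≃ κ) (h : Good g ℓ c T) : Good g ℓ c (rl e T) :=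
  ⟨h.1.rl e, fun j => Bal.rl e (h.2 j)⟩
theorem Good.tprod (B : Bg2 g ℓ) {S : Ten n κ} (h : Good g ℓ c T) (h' : Good g ℓ c' S) :
    Good g ℓ (c + c') (tprod T S) :=
  ⟨h.1.tprod h'.1, fun j => Bal.tprod B.toBg h.1 h'.1 (h.2 j) (h'.2 j)⟩
theorem Good.tr (B : Bg2 g ℓ) {T : Ten n (Option (Option ι))} (h : Good g ℓ c T) :
    Good g ℓ c (tr g T) := ⟨Sm.tr B.ok h.1, fun j => Bal.tr B.toBg h.1 (h.2 j)⟩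
theorem Good.gc (B : Bg2 g ℓ) (h : Good g ℓ c T) : Good g ℓ c (gc g T) :=
  ⟨h.1.gc B.ok, fun j => Bal.gc B.toBg h.1 (h.2 j)⟩
theorem Good.act (B : Bg2 g ℓ) {R : Ten n (Fin 4)} (hR : Good g ℓ c R) (h : Good g ℓ c' T) :
    Good g ℓ (c + c') (act g R T) :=
  ⟨Sm.act B.ok hR.1 h.1, fun j => Bal.act B.toBg hR.1 h.1 (hR.2 j) (h.2 j)⟩
theorem Good.fil (h : Good g ℓ c T) (x : Pt n) : FilQ g ℓ x ∅ c (T x) := (h.2 0).fil x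

end bal9


section p10
variable {n : ℕ} {g : MetricField n} {ℓ : VecField n}
  {ι κ : Type} [Fintype ι] [DecidableEq ι] [Fintype κ] [DecidableEq κ]

/-- antisymmetry under transpositions -/
def Alt (t : (ι → Fin n) → ℝ) : Prop :=
  ∀ i j : ι, i ≠ j → ∀ idx, t (fun k => idx (Equiv.swap i j k)) = - t idx

theorem Alt.ev {t : (ι → Fin n) → ℝ} (h : Alt t) {i j : ι} (hij : i ≠ j) (v : ι → Fin n → ℝ) :
    evM t (fun k => v (Equiv.swap i j k)) = - evM t v := by
  rw [← evM_rl, ← evM_neg]; congr 2; funext idx; exact h i j hij idx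

theorem Alt.eq_zero {t : (ι → Fin n) → ℝ} (h : Alt t) {i j : ι} (hij : i ≠ j) (v : ι → Fin n → ℝ)
    (hv : v i = v j) : evM t v = 0 := by
  have := h.ev hij v
  have e : (fun k => v (Equiv.swap i j k)) = v := by
    funext k; rw [Equiv.swap_apply_def]; split_ifs with h1 h2
    · rw [h1, hv]
    · rw [h2, hv]
    · rfl
  rw [e] at this; linarith

theorem Alt.eq_zero' {t : (ι → Fin n) → ℝ} (h : Alt t) {i j : ι} (hij : i ≠ j) (v : ι → Fin n → ℝ)
    (u : Fin n → ℝ) (a b : ℝ) (hi : v i = a • u) (hj : v j = b • u) : evM t v = 0 := by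
  have e1 : v = Function.update v i (a • u) := by rw [← hi, Function.update_eq_self]
  rw [e1, MultilinearMap.map_update_smul]
  set v' := Function.update v i u with hv'
  have e2 : v' = Function.update v' j (b • u) := by
    rw [← hj, hv', Function.update_comm hij, Function.update_eq_self]
  rw [e2, MultilinearMap.map_update_smul, h.eq_zero hij, smul_zero, smul_zero]
  rw [Function.update_self, Function.update_of_ne hij, hv', Function.update_self]

theorem alt_zero (B : Bg g ℓ) {x : Pt n} {t : (ι → Fin n) → ℝ} (h : Alt t)
    (hf : FilQ g ℓ x ∅ (-2) t) : t = 0 := by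
  have key : ∀ v, evM t v = 0 := by
    intro v
    have hv : v = (fun m => (gdot g x (v m) (ℓ x)) • eta g ℓ x) +
        fun m => (v m + (-(gdot g x (v m) (ℓ x))) • eta g ℓ x) := by
      funext m; exact Bg.decomp x (v m)
    rw [hv, MultilinearMap.map_add_univ]
    refine Finset.sum_eq_zero fun s _ => ?_
    by_cases hs : 1 < s.card
    · obtain ⟨i, hi, j, hj, hij⟩ := Finset.one_lt_card.mp hs
      exact h.eq_zero' hij _ _ _ _ (Finset.piecewise_eq_of_mem _ _ _ hi)
        (Finset.piecewise_eq_of_mem _ _ _ hj)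
    · refine hf (fun m => if m ∈ s then -1 else 0) _ (fun m => ?_) (by simp) ?_
      · by_cases hm : m ∈ s
        · rw [if_pos hm]; exact Wt.neg_one _ (le_refl _)
        · rw [if_neg hm, Finset.piecewise_eq_of_notMem _ _ _ hm]
          exact Wt.perp (B.pi_perp x (v m))
      · rw [Finset.sum_ite_mem]; simp; omega
  funext idx
  rw [← evM_bas t idx, key]; rfl

theorem evM_rho (C : Fin n → Fin n → ℝ) (t : (ι → Fin n) → ℝ) (v : ι → Fin n → ℝ) :
    evM (rho C t) v = ∑ m, evM t (Function.update v m (fun e => ∑ b, C e b * v m b)) := by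
  rw [evM_apply]
  unfold rho
  simp only [Finset.sum_mul]
  rw [Finset.sum_comm]
  refine Finset.sum_congr rfl fun m _ => ?_
  have := swap_sum m t v C
  simp only [Finset.sum_mul] at this ⊢
  rw [this, evM_apply]
  refine Finset.sum_congr rfl fun idx _ => ?_
  congr 1
  rw [← Finset.mul_prod_erase Finset.univ _ (Finset.mem_univ m), Function.update_self, Finset.sum_mul]
  have e : ∏ j ∈ Finset.univ.erase m, v j (idx j) = ∏ j ∈ Finset.univ.erase m,
      Function.update v m (fun e => ∑ b, C e b * v m b) j (idx j) :=
    Finset.prod_congr rfl fun j hj => by rw [Function.update_of_ne (Finset.ne_of_mem_erase hj)]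
  rw [← e]

theorem nX_wt (B : Bg g ℓ) {x : Pt n} {w : ℤ} {v : Fin n → ℝ} (h : Wt g ℓ x w v) :
    Wt g ℓ x (w + 1) (∑ a, v a • nabV g a ℓ x) := by
  by_cases h1 : 1 ≤ w
  · obtain ⟨c, hc⟩ := h.2.1 h1
    have : ∑ b, v b • nabV g b ℓ x = 0 := by
      rw [hc]
      have : ∀ b, (c • ℓ x) b • nabV g b ℓ x = c • (ℓ x b • nabV g b ℓ x) := fun b => by
        rw [smul_smul]; rfl
      simp only [this, ← Finset.smul_sum, B.nl_l, smul_zero]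
    rw [this]; exact Wt.zero' _
  by_cases h0 : 0 ≤ w
  · obtain ⟨c, hc⟩ := B.nX_prop x v (h.1 h0)
    rw [hc]; exact (Wt.l B c).mono (by omega)
  · exact (Wt.perp (B.nX_perp x v)).mono (by omega)

variable {p : ℕ}

theorem alt_of_isAlt {F : TensorField n p} (h : IsAlternating F) (x : Pt n) :
    Alt (F x : (Fin p → Fin n) → ℝ) := by
  intro i j hij idx
  have := h x idx (Equiv.swap i j)
  rw [Equiv.Perm.sign_swap hij] at this
  simpa [Function.comp_def] using this

theorem evM_sign {F : TensorField n p} (h : IsAlternating F) (x : Pt n) (σ : Equiv.Perm (Fin p))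
    (v : Fin p → Fin n → ℝ) : evM (F x : (Fin p → Fin n) → ℝ) (fun k => v (σ k)) =
      ((Equiv.Perm.sign σ : ℤ) : ℝ) * evM (F x : (Fin p → Fin n) → ℝ) v := by
  rw [← evM_rl σ, ← evM_smul]; congr 2; funext idx; exact h x idx σ

theorem F_l [NeZero p] {F : TensorField n p} (h : IsAlternating F) (hc : ContractsFirstZero ℓ F)
    (x : Pt n) (v : Fin p → Fin n → ℝ) (m : Fin p) (c : ℝ) (hm : v m = c • ℓ x) :
    evM (F x : (Fin p → Fin n) → ℝ) v = 0 := by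
  have h0 : ∀ v : Fin p → Fin n → ℝ, evM (F x : (Fin p → Fin n) → ℝ) (Function.update v 0 (ℓ x)) = 0 := by
    intro v
    have hz : ∀ v : Fin p → Fin n → ℝ, evM (fun idx : Fin p → Fin n => ∑ e, ℓ x e * F x (Function.update idx 0 e)) v = 0 := by
      intro v
      have : (fun idx : Fin p → Fin n => ∑ e, ℓ x e * F x (Function.update idx 0 e)) = 0 := by
        funext idx; exact hc x idx
      rw [this, evM_zero]
    obtain ⟨u, hu⟩ : ∃ u : Fin n → ℝ, u = Function.update v 0 (ℓ x) 0 := ⟨_, rfl⟩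
    by_cases hn : Nonempty (Fin n)
    · obtain ⟨b0⟩ := hn
      have hh := hz (Function.update v 0 (bas b0))
      rw [evM_apply] at hh
      have := swap_sum (0 : Fin p) (F x) (Function.update v 0 (bas b0)) (fun e _ => ℓ x e)
      rw [this] at hh
      rw [evM_apply, ← hh]
      refine Finset.sum_congr rfl fun idx _ => ?_
      congr 1
      rw [← Finset.mul_prod_erase Finset.univ _ (Finset.mem_univ (0 : Fin p)), Function.update_self]
      congr 1
      · simp [bas, Pi.single_apply]
      · exact Finset.prod_congr rfl fun j hj => by
          rw [Function.update_of_ne (Finset.ne_of_mem_erase hj), Function.update_of_ne (Finset.ne_of_mem_erase hj)]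
    · rw [evM_apply]
      refine Finset.sum_eq_zero fun idx _ => (hn ⟨idx 0⟩).elim
  have e1 : v = Function.update v m (c • ℓ x) := by rw [← hm, Function.update_eq_self]
  rw [e1, MultilinearMap.map_update_smul]
  by_cases hm0 : m = 0
  · rw [hm0, h0, smul_zero]
  · have a := alt_of_isAlt h x
    have := a.ev (i := m) (j := 0) hm0 (Function.update v m (ℓ x))
    have h2 := h0 (fun k => (Function.update v m (ℓ x)) (Equiv.swap m 0 k))
    have e2 : Function.update (fun k => (Function.update v m (ℓ x)) (Equiv.swap m 0 k)) 0 (ℓ x) =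
        (fun k => (Function.update v m (ℓ x)) (Equiv.swap m 0 k)) := by
      funext k
      by_cases hk : k = 0
      · rw [hk, Function.update_self, Equiv.swap_apply_right, Function.update_self]
      · rw [Function.update_of_ne hk]
    rw [e2, this] at h2
    rw [neg_eq_zero.mp h2, smul_zero]

def sucE (p : ℕ) : Unit ⊕ Fin p ≃ Fin (p+1) where
  toFun
    | Sum.inl _ => 0
    | Sum.inr i => i.succ
  invFun := Fin.cases (Sum.inl ()) Sum.inr
  left_inv := by rintro (_ | i) <;> simp
  right_inv := by intro i; refine Fin.cases ?_ (fun i => ?_) i <;> simp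

theorem evM_lf (x : Pt n) (v : Unit → Fin n → ℝ) : evM (lf g ℓ x) v = gdot g x (v ()) (ℓ x) := by
  rw [gdot_low, evM_apply, ← (Equiv.funUnique Unit (Fin n)).symm.sum_comp]
  exact Finset.sum_congr rfl fun a _ => by simp [lf]; ring

theorem F_perp (B : Bg g ℓ) {F : TensorField n p} (h : IsAlternating F) (hw : WedgeWithZero g ℓ F)
    (x : Pt n) (v : Fin p → Fin n → ℝ) (hv : ∀ m, gdot g x (v m) (ℓ x) = 0) :
    evM (F x : (Fin p → Fin n) → ℝ) v = 0 := by
  let V : Fin (p+1) → Fin n → ℝ := Fin.cons (eta g ℓ x) v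
  let t : (Fin (p+1) → Fin n) → ℝ := fun idx => lower g ℓ x (idx 0) * F x (fun m => idx m.succ)
  have ht : ∀ v : Fin (p+1) → Fin n → ℝ, evM t v =
      gdot g x (v 0) (ℓ x) * evM (F x : (Fin p → Fin n) → ℝ) (fun m => v m.succ) := by
    intro v
    have : t = fun idx => (fun idx : Unit ⊕ Fin p → Fin n => lf g ℓ x (fun i => idx (Sum.inl i)) *
      F x (fun i => idx (Sum.inr i))) (fun i => idx (sucE p i)) := rfl
    rw [this]
    refine (evM_rl (sucE p) (fun idx : Unit ⊕ Fin p → Fin n => lf g ℓ x (fun i => idx (Sum.inl i)) *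
      F x (fun i => idx (Sum.inr i))) v).trans ?_
    rw [evM_tprod (lf g ℓ x) (F x), evM_lf]; rfl
  have hz : evM (∑ σ : Equiv.Perm (Fin (p+1)), ((Equiv.Perm.sign σ : ℤ) : ℝ) •
      (fun idx : Fin (p+1) → Fin n => t (fun i => idx (σ i)))) V = 0 := by
    have : (∑ σ : Equiv.Perm (Fin (p+1)), ((Equiv.Perm.sign σ : ℤ) : ℝ) •
      (fun idx : Fin (p+1) → Fin n => t (fun i => idx (σ i)))) = 0 := by
      funext idx
      rw [Finset.sum_apply]
      simpa using hw x idx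
    rw [this, evM_zero]
  rw [evM_sum] at hz
  have hs : ∀ σ : Equiv.Perm (Fin (p+1)), evM (((Equiv.Perm.sign σ : ℤ) : ℝ) •
      (fun idx : Fin (p+1) → Fin n => t (fun i => idx (σ i)))) V = ((Equiv.Perm.sign σ : ℤ) : ℝ) *
      (gdot g x (V (σ 0)) (ℓ x) * evM (F x : (Fin p → Fin n) → ℝ) (fun m => V (σ m.succ))) := by
    intro σ; rw [evM_smul, evM_rl, ht]
  simp only [hs] at hz
  rw [← Equiv.Perm.decomposeFin.symm.sum_comp, Fintype.sum_prod_type, Fin.sum_univ_succ] at hz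
  have h2 : ∀ (i : Fin p) (σ : Equiv.Perm (Fin p)),
      gdot g x (V ((Equiv.Perm.decomposeFin.symm (i.succ, σ)) 0)) (ℓ x) = 0 := by
    intro i σ; rw [Equiv.Perm.decomposeFin_symm_apply_zero]; exact hv i
  have h3 : ∀ σ : Equiv.Perm (Fin p), ((Equiv.Perm.sign (Equiv.Perm.decomposeFin.symm (0, σ)) : ℤ) : ℝ) *
      (gdot g x (V ((Equiv.Perm.decomposeFin.symm (0, σ)) 0)) (ℓ x) * evM (F x : (Fin p → Fin n) → ℝ)
        (fun m => V ((Equiv.Perm.decomposeFin.symm (0, σ)) m.succ))) = evM (F x : (Fin p → Fin n) → ℝ) v := by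
    intro σ
    rw [Equiv.Perm.decomposeFin_symm_apply_zero]
    have e1 : gdot g x (V 0) (ℓ x) = 1 := B.eta_l x
    have e2 : (fun m : Fin p => V ((Equiv.Perm.decomposeFin.symm (0, σ)) m.succ)) = fun m => v (σ m) := by
      funext m; rw [Equiv.Perm.decomposeFin_symm_apply_succ]; simp [V]
    rw [e1, e2, one_mul, evM_sign h, ← mul_assoc]
    have : Equiv.Perm.sign (Equiv.Perm.decomposeFin.symm (0, σ)) = Equiv.Perm.sign σ := by simp
    rw [this]
    rcases Int.units_eq_one_or (Equiv.Perm.sign σ) with h | h <;> simp [h]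
  simp only [h2, h3, zero_mul, mul_zero, Finset.sum_const_zero, add_zero, Finset.sum_const,
    nsmul_eq_mul, mul_eq_zero] at hz
  rcases hz with hz | hz
  · exfalso
    have : (Finset.univ : Finset (Equiv.Perm (Fin p))).card = 0 := by exact_mod_cast hz
    rw [Finset.card_eq_zero] at this
    exact Finset.univ_nonempty.ne_empty this
  · exact hz

theorem fil_F [NeZero p] (B : Bg g ℓ) {F : TensorField n p} (h : IsAlternating F)
    (hc : ContractsFirstZero ℓ F) (hw : WedgeWithZero g ℓ F) (x : Pt n) :
    FilQ g ℓ x ∅ (-1) (F x : (Fin p → Fin n) → ℝ) := by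
  intro w v hwt _ hd
  by_cases hb : ∃ m, 1 ≤ w m
  · obtain ⟨m, hm⟩ := hb
    obtain ⟨c, hcc⟩ := (hwt m).2.1 hm
    exact F_l h hc x v m c hcc
  · push Not at hb
    refine F_perp B h hw x v fun m => (hwt m).1 ?_
    by_contra hlt
    have h1 : ∑ i, w i ≤ ∑ i, (if i = m then (-1 : ℤ) else 0) := by
      refine Finset.sum_le_sum fun i _ => ?_
      have := hb i
      split_ifs with h
      · rw [h]; omega
      · omega
    simp at h1; omega

theorem DD_F (B : Bg g ℓ) [NeZero p] {F : TensorField n p} (hF : IsFormField F)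
    (hc : ContractsFirstZero ℓ F) (hw : WedgeWithZero g ℓ F) (hL : ∀ x idx, lieD ℓ F x idx = 0) :
    DD g ℓ (F : Ten n (Fin p)) = 0 := by
  have e : ∀ x, DD g ℓ (F : Ten n (Fin p)) x = - rho (fun e f => nabV g f ℓ x e) (F x) := by
    intro x
    funext idx
    have h := hL x idx
    simp only [lieD] at h
    simp only [DD, nab_eq, mul_sub, Finset.sum_sub_distrib, Pi.neg_apply]
    have h1 : rho (fun e f => nabV g f ℓ x e) (F x) idx =
        ∑ m : Fin p, ∑ a, pd (fun y => ℓ y a) (idx m) x * F x (Function.update idx m a) +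
        ∑ a, ℓ x a * rho (fun e f => christoffel g x e a f) (F x) idx := by
      unfold rho nabV
      simp only [Finset.mul_sum, add_mul, Finset.sum_add_distrib, Finset.sum_mul]
      congr 1
      rw [Finset.sum_comm]
      conv_rhs => rw [Finset.sum_comm]
      rw [Finset.sum_comm]
      refine Finset.sum_congr rfl fun m _ => ?_
      rw [Finset.sum_comm]
      refine Finset.sum_congr rfl fun a _ => Finset.sum_congr rfl fun b _ => ?_
      rw [B.ok.chr_symm]; ring
    rw [h1]; linarith
  funext x
  apply alt_zero B (x := x)
  · intro i j hij idx
    have h0 : (rl (Equiv.swap i j) (F : Ten n (Fin p))) = (-1 : ℝ) • (F : Ten n (Fin p)) := by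
      funext y idx
      have := alt_of_isAlt hF.2 y i j hij idx
      rw [Pi.smul_apply, Pi.smul_apply, smul_eq_mul, neg_one_mul]; exact this
    have h1 := DD_rl (g := g) (ℓ := ℓ) (Equiv.swap i j) (F : Ten n (Fin p))
    rw [h0, DD_smul hF.1] at h1
    have := congrFun (congrFun h1 x) idx
    simp at this
    exact this.symm
  · rw [e]
    apply FilQ.neg
    intro w v hwt _ hd
    rw [evM_rho]
    refine Finset.sum_eq_zero fun m _ => ?_
    refine fil_F B hF.2 hc hw x (Function.update w m (w m + 1)) _ (fun k => ?_) (by simp) ?_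
    · by_cases hk : k = m
      · rw [hk, Function.update_self, Function.update_self]
        have := nX_wt B (hwt m)
        convert this using 1
        funext e; simp [Finset.sum_apply, mul_comm]
      · rw [Function.update_of_ne hk, Function.update_of_ne hk]; exact hwt k
    · rw [Finset.sum_update_of_mem (Finset.mem_univ m)]
      have := Finset.sum_erase_add Finset.univ w (Finset.mem_univ m)
      rw [Finset.sdiff_singleton_eq_erase]; omega

theorem good_F (B : Bg g ℓ) [NeZero p] {F : TensorField n p} (hF : IsFormField F)
    (hc : ContractsFirstZero ℓ F) (hw : WedgeWithZero g ℓ F) (hL : ∀ x idx, lieD ℓ F x idx = 0) :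
    Good g ℓ (-1) (F : Ten n (Fin p)) := by
  refine ⟨hF.1, fun j => ?_⟩
  cases j with
  | zero => exact fil_F B hF.2 hc hw
  | succ j => exact ⟨fil_F B hF.2 hc hw, by rw [DD_F B hF hc hw hL]; exact BalQ.zero⟩

end p10


section p11
variable {n : ℕ} {g : MetricField n} {ℓ : VecField n}
  {ι κ : Type} [Fintype ι] [DecidableEq ι] [Fintype κ] [DecidableEq κ]

/-- multiplication by the curvature constant -/
def KM (g : MetricField n) (T : Ten n ι) : Ten n ι := rl (Equiv.emptySum Empty ι) (tprod (Kt g) T)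

theorem KM_apply (T : Ten n ι) (x : Pt n) (idx : ι → Fin n) :
    KM g T x idx = ricciScalar g x / ((n : ℝ) * ((n : ℝ) - 1)) * T x idx := rfl

theorem KM_rl (e : ι ≃ κ) (T : Ten n ι) : KM g (rl e T) = rl e (KM g T) := rfl

theorem KM_tr (T : Ten n (Option (Option ι))) : tr g (KM g T) = KM g (tr g T) := by
  funext x idx
  rw [KM_apply]
  unfold tr ptr
  simp only [Finset.mul_sum]
  refine Finset.sum_congr rfl fun a _ => Finset.sum_congr rfl fun b _ => ?_
  rw [KM_apply]; ring

theorem Good.KM (B : Bg2 g ℓ) {c : ℤ} {T : Ten n ι} (h : Good g ℓ c T) : Good g ℓ c (KM g T) := by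
  have := ((good_Kt B).tprod B h).rl (Equiv.emptySum Empty ι)
  rwa [zero_add] at this

def kmE (ι : Type) : Option Empty ⊕ ι ≃ Option ι where
  toFun
    | Sum.inl _ => none
    | Sum.inr i => some i
  invFun
    | none => Sum.inl none
    | some i => Sum.inr i
  left_inv := by rintro (_ | i) <;> simp <;> (rename_i o; cases o; rfl; rename_i o; exact o.elim)
  right_inv := by rintro (_ | i) <;> rfl

theorem CD_KM (B : Bg2 g ℓ) {T : Ten n ι} (h : Sm T) :
    CD g (KM g T) = KM g (CD g T) + rl (kmE ι) (tprod (CD g (Kt g)) T) := by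
  funext x idx
  have h1 : CD g (KM g T) x idx = nab g (idx none) (KM g T) x (fun i => idx (some i)) := rfl
  rw [h1, KM, nab_rl, nab_tprod (Sm.Kt B.ok) h, rl_add, Pi.add_apply, Pi.add_apply, add_comm]
  simp only [Pi.add_apply]
  congr 1

theorem gc_rl (e : ι ≃ κ) (T : Ten n ι) :
    gc g (rl e T) = rl e.optionCongr.optionCongr (gc g T) := rfl

inductive Cl {n p : ℕ} (g : MetricField n) (ℓ : VecField n) (F : TensorField n p) (J : ℕ) :
    (X : Type) → [Fintype X] → [DecidableEq X] → Ten n X → Prop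
  | good {X : Type} [Fintype X] [DecidableEq X] {T : Ten n X} (h : Good g ℓ (-2) T) : Cl g ℓ F J X T
  | base {X : Type} [Fintype X] [DecidableEq X] (J' : ℕ) (h : J' + 2 ≤ J) (e : Fin (p+J') ≃ X) :
      Cl g ℓ F J X (rl e (covDIter g F J'))
  | km {X : Type} [Fintype X] [DecidableEq X] {T : Ten n X} (h : Cl g ℓ F J X T) : Cl g ℓ F J X (KM g T)
  | gcl {X Y : Type} [Fintype X] [DecidableEq X] [Fintype Y] [DecidableEq Y]
      (e : Option (Option X) ≃ Y) {T : Ten n X} (h : Cl g ℓ F J X T) : Cl g ℓ F J Y (rl e (gc g T))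
  | add {X : Type} [Fintype X] [DecidableEq X] {T S : Ten n X} (h : Cl g ℓ F J X T)
      (h' : Cl g ℓ F J X S) : Cl g ℓ F J X (T + S)
  | smul {X : Type} [Fintype X] [DecidableEq X] {T : Ten n X} (r : ℝ) (h : Cl g ℓ F J X T) :
      Cl g ℓ F J X (r • T)

variable {p : ℕ} {F : TensorField n p} {J : ℕ}

theorem Tj_succ (J : ℕ) : (covDIter g F (J+1) : Ten n (Fin (p+J+1))) =
    rl (finSuccEquiv (p+J)).symm (CD g (covDIter g F J : Ten n (Fin (p+J)))) := by
  funext x idx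
  simp only [covDIter, covD, rl, CD, nab]
  rfl

theorem CD_Tj (J : ℕ) : CD g (covDIter g F J : Ten n (Fin (p+J))) =
    rl (finSuccEquiv (p+J)) (covDIter g F (J+1)) := by
  have := congrArg (rl (finSuccEquiv (p+J))) (Tj_succ (g := g) (F := F) J)
  rw [rl_rl, Equiv.symm_trans_self, rl_refl] at this
  exact this.symm

theorem good_Tj (B : Bg2 g ℓ) (hF : Good g ℓ (-1) (F : Ten n (Fin p))) (J : ℕ) :
    Good g ℓ (-1) (covDIter g F J : Ten n (Fin (p+J))) := by
  induction J with
  | zero => exact hF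
  | succ J ih => 
    have := (ih.CD B).rl (finSuccEquiv (p+J)).symm
    rw [← Tj_succ] at this
    exact this

theorem Cl.good1 (B : Bg2 g ℓ) (hF : Good g ℓ (-1) (F : Ten n (Fin p))) {T : Ten n ι}
    (h : Cl g ℓ F J ι T) : Good g ℓ (-1) T := by
  induction h with
  | good h => exact h.mono (by norm_num)
  | base J' h e => exact (good_Tj B hF J').rl e
  | km h ih => exact ih.KM B
  | gcl e h ih => exact (ih.gc B).rl e
  | add h h' ih ih' => exact ih.add B ih'
  | smul r h ih => exact ih.smul B r

theorem Cl.mono {J' : ℕ} (hJ : J ≤ J') {T : Ten n ι} (h : Cl g ℓ F J ι T) : Cl g ℓ F J' ι T := by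
  induction h with
  | good h => exact .good h
  | base J' h e => exact .base J' (by omega) e
  | km h ih => exact ih.km
  | gcl e h ih => exact ih.gcl e
  | add h h' ih ih' => exact ih.add ih'
  | smul r h ih => exact ih.smul r

theorem Cl.rl {T : Ten n ι} (h : Cl g ℓ F J ι T) {κ : Type} [Fintype κ] [DecidableEq κ] (e : ι ≃ κ) :
    Cl g ℓ F J κ (rl e T) := by
  induction h generalizing κ with
  | good h => exact .good (h.rl e)
  | base J' h e' => exact .base J' h (e'.trans e)
  | km h ih => exact (ih e).km
  | gcl e' h ih => exact h.gcl (e'.trans e)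
  | add h h' ih ih' => exact (ih e).add (ih' e)
  | smul r h ih => exact (ih e).smul r

theorem Cl.zero : Cl g ℓ F J ι 0 := .good Good.zero
theorem Cl.neg {T : Ten n ι} (h : Cl g ℓ F J ι T) : Cl g ℓ F J ι (-T) := by
  have := h.smul (-1); rwa [neg_one_smul] at this
theorem Cl.sub {T S : Ten n ι} (h : Cl g ℓ F J ι T) (h' : Cl g ℓ F J ι S) : Cl g ℓ F J ι (T - S) := by
  rw [sub_eq_add_neg]; exact h.add h'.neg
theorem Cl.sum {α : Type*} (s : Finset α) {T : α → Ten n ι} (h : ∀ a ∈ s, Cl g ℓ F J ι (T a)) :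
    Cl g ℓ F J ι (∑ a ∈ s, T a) := by
  classical
  induction s using Finset.induction_on with
  | empty => simpa using Cl.zero
  | insert a s ha ih =>
    rw [Finset.sum_insert ha]
    exact (h a (Finset.mem_insert_self _ _)).add (ih fun b hb => h b (Finset.mem_insert_of_mem hb))

theorem Cl.CD (B : Bg2 g ℓ) (hF : Good g ℓ (-1) (F : Ten n (Fin p))) {T : Ten n ι}
    (h : Cl g ℓ F J ι T) : Cl g ℓ F (J+1) (Option ι) (CD g T) := by
  induction h with
  | good h => exact .good (h.CD B)
  | base J' h e =>
    rw [CD_rl, CD_Tj, rl_rl]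
    exact .base (J'+1) (by omega) _
  | @km X _ _ T h ih =>
    have h1 := h.good1 B hF
    rw [CD_KM B h1.1]
    refine ih.km.add (.good ?_)
    have := ((good_dK B).tprod B h1).rl (kmE X)
    norm_num at this; exact this
  | gcl e h ih =>
    have h1 := h.good1 B hF
    rw [CD_rl, CD_gc B.ok h1.1, rl_rl]
    exact ih.gcl _
  | add h h' ih ih' => rw [CD_add (h.good1 B hF).1 (h'.good1 B hF).1]; exact ih.add ih'
  | smul r h ih => rw [CD_smul (h.good1 B hF).1]; exact ih.smul r

theorem Cl.good2 (B : Bg2 g ℓ) {T : Ten n ι}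
    (h : Cl g ℓ F J ι T) (hc : Fintype.card ι < p) : Good g ℓ (-2) T := by
  induction h with
  | good h => exact h
  | base J' h e => 
    have := Fintype.card_congr e
    simp at this; omega
  | km h ih => exact (ih hc).KM B
  | gcl e h ih => 
    have := Fintype.card_congr e
    simp at this
    exact ((ih (by omega)).gc B).rl e
  | add h h' ih ih' => exact (ih hc).add B (ih' hc)
  | smul r h ih => exact (ih hc).smul B r

/-! ### traces over a pair of slots -/

/-- all traces over the slots `i`, `j` are in the class. -/
def TP (g : MetricField n) (ℓ : VecField n) (F : TensorField n p) (J : ℕ) (i j : ι) (T : Ten n ι) : Prop :=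
  ∀ (Y : Type) [Fintype Y] [DecidableEq Y] (e : ι ≃ Option (Option Y)), e i = none → e j = some none →
    Cl g ℓ F J Y (tr g (VSI.rl e T))

theorem oo_of_fix {Z Y : Type} (k : Option (Option Z) ≃ Option (Option Y)) (h0 : k none = none)
    (h1 : k (some none) = some none) : ∃ h : Z ≃ Y, k = h.optionCongr.optionCongr := by
  have h0' : k.symm none = none := by rw [Equiv.symm_apply_eq, h0]
  have h1' : k.symm (some none) = some none := by rw [Equiv.symm_apply_eq, h1]
  have hf : ∀ z, ∃ y, k (some (some z)) = some (some y) := by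
    intro z
    rcases h : k (some (some z)) with _ | _ | y
    · rw [← h0] at h; simpa using k.injective h
    · rw [← h1] at h; simpa using k.injective h
    · exact ⟨y, rfl⟩
  have hg : ∀ z, ∃ y, k.symm (some (some z)) = some (some y) := by
    intro z
    rcases h : k.symm (some (some z)) with _ | _ | y
    · rw [← h0'] at h; simpa using k.symm.injective h
    · rw [← h1'] at h; simpa using k.symm.injective h
    · exact ⟨y, rfl⟩
  choose f hf using hf
  choose f' hg using hg
  refine ⟨⟨f, f', fun z => ?_, fun y => ?_⟩, ?_⟩
  · have := hg (f z); rw [← hf] at this; simpa using this.symm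
  · have := hf (f' y); rw [← hg] at this; simpa using this.symm
  · ext1 o; rcases o with _ | _ | z
    · simp [h0]
    · simp [h1]
    · simp [hf]

theorem TP.of_one {i j : ι} {T : Ten n ι} {Z : Type} [Fintype Z] [DecidableEq Z] (e0 : ι ≃ Option (Option Z))
    (h0 : e0 i = none) (h1 : e0 j = some none) (h : Cl g ℓ F J Z (tr g (VSI.rl e0 T))) :
    TP g ℓ F J i j T := by
  intro Y _ _ e h0' h1'
  obtain ⟨k, hk⟩ := oo_of_fix (e0.symm.trans e) (by simp [← h0, h0']) (by simp [← h1, h1'])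
  have : e = e0.trans k.optionCongr.optionCongr := by rw [← hk]; ext; simp
  rw [this, ← rl_rl, tr_rl]
  exact h.rl k

theorem tr_swap (hg : MetOK g) (T : Ten n (Option (Option ι))) :
    tr g (VSI.rl (Equiv.swap none (some none)) T) = tr g T := by
  funext x idx
  simp only [tr, ptr, VSI.rl]
  rw [Finset.sum_comm]
  refine Finset.sum_congr rfl fun a _ => Finset.sum_congr rfl fun b _ => ?_
  rw [hg.inv_symm x b a]
  congr 2
  funext o; rcases o with _ | _ | o <;> simp [Equiv.swap_apply_def]

theorem TP.symm (hg : MetOK g) {i j : ι} {T : Ten n ι} (h : TP g ℓ F J i j T) : TP g ℓ F J j i T := by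
  intro Y _ _ e h0 h1
  have := h Y (e.trans (Equiv.swap none (some none))) (by simp [h1]) (by simp [h0])
  rwa [← rl_rl, tr_swap hg] at this

theorem TP.rl {i j : ι} {T : Ten n ι} (h : TP g ℓ F J i j T) (f : ι ≃ κ) :
    TP g ℓ F J (f i) (f j) (rl f T) := by
  intro Y _ _ e h0 h1
  exact h Y (f.trans e) h0 h1

theorem TP.rl' {i j : ι} {i' j' : κ} {T : Ten n ι} (h : TP g ℓ F J i j T) (f : ι ≃ κ) (hi : f i = i')
    (hj : f j = j') : TP g ℓ F J i' j' (VSI.rl f T) := by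
  subst hi hj; exact h.rl f

theorem TP.of_rl {i j : ι} {i' j' : κ} {T : Ten n ι} (f : ι ≃ κ) (hi : f i = i')
    (hj : f j = j') (h : TP g ℓ F J i' j' (VSI.rl f T)) : TP g ℓ F J i j T := by
  have := h.rl' f.symm (i' := i) (j' := j) (by simp [← hi]) (by simp [← hj])
  rwa [rl_rl, Equiv.self_trans_symm, rl_refl] at this

theorem TP.add {i j : ι} {T S : Ten n ι} (h : TP g ℓ F J i j T) (h' : TP g ℓ F J i j S) :
    TP g ℓ F J i j (T + S) := by
  intro Y _ _ e h0 h1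
  rw [rl_add, tr_add]; exact (h Y e h0 h1).add (h' Y e h0 h1)
theorem TP.sub {i j : ι} {T S : Ten n ι} (h : TP g ℓ F J i j T) (h' : TP g ℓ F J i j S) :
    TP g ℓ F J i j (T - S) := by
  intro Y _ _ e h0 h1
  rw [rl_sub, tr_sub]; exact (h Y e h0 h1).sub (h' Y e h0 h1)
theorem TP.sum {α : Type*} (s : Finset α) {i j : ι} {T : α → Ten n ι} (h : ∀ a ∈ s, TP g ℓ F J i j (T a)) :
    TP g ℓ F J i j (∑ a ∈ s, T a) := by
  intro Y _ _ e h0 h1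
  rw [rl_sum, tr_sum]; exact Cl.sum _ fun a ha => h a ha Y e h0 h1
theorem TP.mono {J' : ℕ} (hJ : J ≤ J') {i j : ι} {T : Ten n ι} (h : TP g ℓ F J i j T) :
    TP g ℓ F J' i j T := fun Y _ _ e h0 h1 => (h Y e h0 h1).mono hJ

theorem exists_oo {i j : ι} (hij : i ≠ j) : ∃ (Z : Type) (_ : Fintype Z) (_ : DecidableEq Z)
    (e : ι ≃ Option (Option Z)), e i = none ∧ e j = some none := by
  refine ⟨{y : {x : ι // x ≠ i} // y ≠ ⟨j, hij.symm⟩}, inferInstance, inferInstance,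
    (Equiv.optionSubtypeNe i).symm.trans (Equiv.optionSubtypeNe (⟨j, hij.symm⟩ : {x : ι // x ≠ i})).symm.optionCongr, ?_, ?_⟩
  · simp
  · simp only [Equiv.trans_apply, Equiv.optionSubtypeNe_symm_of_ne hij.symm]
    simp [-Equiv.optionCongr_symm]

theorem TP.CD (B : Bg2 g ℓ) (hF : Good g ℓ (-1) (F : Ten n (Fin p))) {i j : ι} (hij : i ≠ j) {T : Ten n ι}
    (sT : Sm T) (h : TP g ℓ F J i j T) : TP g ℓ F (J+1) (some i) (some j) (VSI.CD g T) := by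
  obtain ⟨Z, _, _, e, h0, h1⟩ := exists_oo hij
  refine TP.of_one (e.optionCongr.trans (mvE Z)) (by simp [h0]; rfl) (by simp [h1]; rfl) ?_
  have := (h Z e h0 h1).CD B hF
  rwa [CD_tr B.ok (sT.rl e), CD_rl, rl_rl] at this

end p11


section p12
variable {n : ℕ} {g : MetricField n} {ℓ : VecField n}
  {ι κ : Type} [Fintype ι] [DecidableEq ι] [Fintype κ] [DecidableEq κ]
  {p : ℕ} {F : TensorField n p} {J : ℕ}

theorem tr_gc (hg : MetOK g) (T : Ten n ι) : tr g (gc g T) = (n : ℝ) • T := by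
  funext x idx
  have h1 : tr g (gc g T) x idx = ∑ a, ∑ b, (g x)⁻¹ a b * (g x a b * T x idx) := rfl
  rw [h1]
  have h2 : ∀ a, ∑ b, (g x)⁻¹ a b * (g x a b * T x idx) = T x idx := by
    intro a
    have := hg.inv_mul x a a
    simp only [if_true] at this
    calc _ = (∑ b, (g x)⁻¹ a b * g x b a) * T x idx := by
          rw [Finset.sum_mul]; exact Finset.sum_congr rfl fun b _ => by rw [hg.symm x b a]; ring
      _ = _ := by rw [this, one_mul]
  simp [h2]

theorem tr_gc_one (hg : MetOK g) (T : Ten n ι) (z : ι) :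
    tr g (rl (Equiv.swap (some none) (some (some z))) (gc g T)) = T := by
  funext x idx
  have h1 : tr g (rl (Equiv.swap (some none) (some (some z))) (gc g T)) x idx =
      ∑ a, ∑ b, (g x)⁻¹ a b * (g x a (idx z) * T x (Function.update idx z b)) := by
    simp only [tr, ptr, rl, gc, pgc]
    refine Finset.sum_congr rfl fun a _ => Finset.sum_congr rfl fun b _ => ?_
    congr 2
    · congr 1; funext i
      by_cases h : i = z
      · subst h; simp
      · rw [Equiv.swap_apply_of_ne_of_ne (by simp) (by simpa using h), Function.update_of_ne h]; rfl
  rw [h1, Finset.sum_comm]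
  have h2 : ∀ b, ∑ a, (g x)⁻¹ a b * (g x a (idx z) * T x (Function.update idx z b)) =
      if b = idx z then T x (Function.update idx z b) else 0 := by
    intro b
    have := hg.inv_mul x b (idx z)
    calc _ = (∑ a, (g x)⁻¹ b a * g x a (idx z)) * T x (Function.update idx z b) := by
          rw [Finset.sum_mul]; exact Finset.sum_congr rfl fun a _ => by rw [hg.inv_symm x a b]; ring
      _ = _ := by rw [this, ite_mul, one_mul, zero_mul]
  simp only [h2]
  simp

theorem gc_swap (hg : MetOK g) (T : Ten n ι) :
    rl (Equiv.swap none (some none)) (gc g T) = gc g T := by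
  funext x idx
  simp only [rl, gc, pgc]
  rw [hg.symm]
  congr 2

def mv2 (ι : Type) : Option (Option (Option (Option ι))) ≃ Option (Option (Option (Option ι))) where
  toFun
    | none => some (some none)
    | some none => some (some (some none))
    | some (some none) => none
    | some (some (some none)) => some none
    | some (some (some (some i))) => some (some (some (some i)))
  invFun
    | none => some (some none)
    | some none => some (some (some none))
    | some (some none) => none
    | some (some (some none)) => some none
    | some (some (some (some i))) => some (some (some (some i)))
  left_inv := by rintro (_ | _ | _ | _ | i) <;> rfl
  right_inv := by rintro (_ | _ | _ | _ | i) <;> rfl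

theorem tr_mv2 (S : Ten n (Option (Option ι))) :
    tr g (rl (mv2 ι) (gc g S)) = gc g (tr g S) := by
  funext x idx
  simp only [tr, ptr, rl, gc, pgc, Finset.mul_sum]
  refine Finset.sum_congr rfl fun a _ => Finset.sum_congr rfl fun b _ => ?_
  have : (fun i => oc a (oc b idx) (mv2 ι (some (some i)))) = oc a (oc b fun i => idx (some (some i))) := by
    funext o; rcases o with _ | _ | o <;> rfl
  rw [this]
  change _ * (g x (idx none) (idx (some none)) * _) = _
  ring

theorem TP.gc_all (B : Bg2 g ℓ) {T : Ten n ι} (hT : Cl g ℓ F J ι T)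
    (h : ∀ i j : ι, i ≠ j → TP g ℓ F J i j T) (i j : Option (Option ι)) (hij : i ≠ j) :
    TP g ℓ F J i j (gc g T) := by
  have c01 : TP g ℓ F J none (some none) (gc g T) := by
    refine TP.of_one (Equiv.refl _) rfl rfl ?_
    rw [rl_refl, tr_gc B.ok]; exact hT.smul _
  have c0z : ∀ z, TP g ℓ F J none (some (some z)) (gc g T) := by
    intro z
    refine TP.of_one (Equiv.swap (some none) (some (some z))) ?_ (by simp) ?_
    · rw [Equiv.swap_apply_of_ne_of_ne (by simp) (by simp)]
    · rw [tr_gc_one B.ok]; exact hT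
  have c1z : ∀ z, TP g ℓ F J (some none) (some (some z)) (gc g T) := by
    intro z
    have := (c0z z).rl' (Equiv.swap none (some none)) (i' := some none) (j' := some (some z)) (by simp)
      (by rw [Equiv.swap_apply_of_ne_of_ne (by simp) (by simp)])
    rwa [gc_swap B.ok] at this
  rcases i with _ | _ | i <;> rcases j with _ | _ | j
  · exact absurd rfl hij
  · exact c01
  · exact c0z j
  · exact c01.symm B.ok
  · exact absurd rfl hij
  · exact c1z j
  · exact (c0z i).symm B.ok
  · exact (c1z i).symm B.ok
  · have hij' : i ≠ j := fun h => hij (by rw [h])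
    obtain ⟨Z, _, _, e, h0, h1⟩ := exists_oo hij'
    refine TP.of_one (e.optionCongr.optionCongr.trans (mv2 Z)) (by simp [h0]; rfl) (by simp [h1]; rfl) ?_
    rw [← rl_rl, ← gc_rl, tr_mv2]
    exact (h i j hij' Z e h0 h1).gcl (Equiv.refl _)

theorem Cl.tp (B : Bg2 g ℓ)
    (HS : ∀ J', J' + 2 ≤ J → ∀ i j : Fin (p+J'), i ≠ j → TP g ℓ F J' i j (covDIter g F J'))
    {T : Ten n ι} (h : Cl g ℓ F J ι T) (i j : ι) (hij : i ≠ j) : TP g ℓ F J i j T := by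
  induction h with
  | good h => exact fun Y _ _ e _ _ => .good ((h.rl e).tr B)
  | base J' h e =>
    exact ((HS J' h (e.symm i) (e.symm j) (by simpa using hij)).mono (by omega)).rl' e (by simp) (by simp)
  | km h ih =>
    intro Y _ _ e h0 h1
    rw [← KM_rl, KM_tr]
    exact (ih i j hij Y e h0 h1).km
  | gcl e h ih =>
    exact (TP.gc_all B h ih (e.symm i) (e.symm j) (by simpa using hij)).rl' e (by simp) (by simp)
  | add h h' ih ih' => exact (ih i j hij).add (ih' i j hij)
  | smul r h ih =>
    intro Y _ _ e h0 h1
    rw [rl_smul, tr_smul]; exact (ih i j hij Y e h0 h1).smul r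

theorem act_KG (hg : MetOK g) (T : Ten n ι) : act g (KG g) T =
    ∑ m, (KM g (rl (Equiv.swap none (some (some m))) (gc g T)) -
      KM g (rl ((Equiv.swap none (some (some m))).trans (Equiv.swap none (some none))) (gc g T))) := by
  funext x idx
  obtain ⟨b, f, rfl⟩ : ∃ i f, idx = oc i f := ⟨_, _, (oc_eta idx).symm⟩
  obtain ⟨a, idx, rfl⟩ : ∃ i f', f = oc i f' := ⟨_, _, (oc_eta f).symm⟩
  rw [act_apply]
  simp only [Finset.sum_apply]
  refine Finset.sum_congr rfl fun m _ => ?_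
  simp only [Pi.sub_apply, KM_apply]
  set K := ricciScalar g x / ((n : ℝ) * ((n : ℝ) - 1)) with hK
  have e1 : rl (Equiv.swap none (some (some m))) (gc g T) x (oc b (oc a idx)) =
      g x (idx m) a * T x (Function.update idx m b) := by
    simp only [rl, gc, pgc]
    congr 2
    funext i
    by_cases h : i = m
    · subst h; simp
    · rw [Equiv.swap_apply_of_ne_of_ne (by simp) (by simpa using h), Function.update_of_ne h]; rfl
  have e2 : rl ((Equiv.swap none (some (some m))).trans (Equiv.swap none (some none))) (gc g T) x
      (oc b (oc a idx)) = g x (idx m) b * T x (Function.update idx m a) := by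
    simp only [rl, gc, pgc, Equiv.trans_apply]
    congr 2
    · funext i
      by_cases h : i = m
      · subst h; simp
      · have h3 : Equiv.swap none (some (some m)) (some (some i)) = some (some i) :=
          Equiv.swap_apply_of_ne_of_ne (by simp) (by simpa using h)
        rw [h3, Equiv.swap_apply_of_ne_of_ne (by simp) (by simp), Function.update_of_ne h]; rfl
  rw [e1, e2, Finset.sum_comm]
  have h2 : ∀ e, ∑ h, (g x)⁻¹ h e * (KG g x ![h, idx m, b, a] * T x (Function.update idx m e)) =
      (if e = b then K * (g x (idx m) a * T x (Function.update idx m e)) else 0)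
      - (if e = a then K * (g x (idx m) b * T x (Function.update idx m e)) else 0) := by
    intro e
    have hb := hg.inv_mul x e b
    have ha := hg.inv_mul x e a
    calc _ = (∑ h, (g x)⁻¹ e h * g x h b) * (K * (g x (idx m) a * T x (Function.update idx m e)))
        - (∑ h, (g x)⁻¹ e h * g x h a) * (K * (g x (idx m) b * T x (Function.update idx m e))) := by
          rw [Finset.sum_mul, Finset.sum_mul, ← Finset.sum_sub_distrib]
          refine Finset.sum_congr rfl fun h _ => ?_
          rw [hg.inv_symm x h e, KG_apply]; ring
      _ = _ := by rw [ha, hb]; simp only [ite_mul, one_mul, zero_mul]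
  simp only [h2, Finset.sum_sub_distrib]
  simp

theorem Cl.act (B : Bg2 g ℓ) {T : Ten n ι} (hT : Good g ℓ (-1) T) (h : Cl g ℓ F J ι T) :
    Cl g ℓ F J (Option (Option ι)) (act g (riemann g) T) := by
  have hRP : (riemann g : Ten n (Fin 4)) = PP g + KG g := by unfold PP; simp
  rw [hRP, act_add_left]
  refine (Cl.good ?_).add ?_
  · have := (good_PP B).act B hT; norm_num at this; exact this
  · rw [act_KG B.ok]
    exact Cl.sum _ fun m _ => (h.gcl _).km.sub (h.gcl _).km

structure FOK (g : MetricField n) (ℓ : VecField n) (F : TensorField n p) : Prop where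
  good : Good g ℓ (-1) (F : Ten n (Fin p))
  alt : ∀ x, Alt (F x : (Fin p → Fin n) → ℝ)
  hdiv : ∀ x (idx : Fin p → Fin n) k, ∑ a, ∑ b, (g x)⁻¹ a b * CD g (F : Ten n (Fin p)) x
    (oc a (Function.update idx k b)) = 0
  hd : CD g (F : Ten n (Fin p)) = ∑ k : Fin p, rl (Equiv.swap none (some k)) (CD g (F : Ten n (Fin p)))

theorem alt_tp (hg : MetOK g) {T : Ten n ι} (h : ∀ x, Alt (T x)) (i j : ι) (hij : i ≠ j) :
    TP g ℓ F J i j T := by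
  intro Y _ _ e h0 h1
  have e1 : rl (Equiv.swap i j) T = - T := by
    funext x idx; exact h x i j hij idx
  have e2 : (Equiv.swap i j).trans e = e.trans (Equiv.swap none (some none)) := by
    rw [← h0, ← h1]
    ext1 k
    simp [Equiv.swap_apply_def]
    split_ifs <;> rfl
  have e3 : tr g (rl e (rl (Equiv.swap i j) T)) = tr g (rl e T) := by
    rw [rl_rl, e2, ← rl_rl, tr_swap hg]
  rw [e1, rl_neg, tr_neg] at e3
  have : tr g (rl e T) = 0 := by
    funext x idx
    have := congrFun (congrFun e3 x) idx
    simp only [Pi.neg_apply] at this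
    simp only [Pi.zero_apply]; linarith
  rw [this]; exact Cl.zero

theorem div_tp (H : FOK g ℓ F) (k : Fin p) : TP g ℓ F J none (some k) (CD g (F : Ten n (Fin p))) := by
  intro Y _ _ e h0 h1
  have : tr g (rl e (CD g (F : Ten n (Fin p)))) = 0 := by
    funext x idx
    rcases isEmpty_or_nonempty (Fin n) with hn | ⟨⟨b0⟩⟩
    · simp [tr, ptr]
    · have := H.hdiv x (fun i => oc b0 (oc b0 idx) (e (some i))) k
      rw [Pi.zero_apply, Pi.zero_apply, ← this]
      simp only [tr, ptr, rl]
      refine Finset.sum_congr rfl fun a _ => Finset.sum_congr rfl fun b _ => ?_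
      congr 2
      funext o
      rcases o with _ | i
      · rw [h0]; rfl
      · by_cases hi : i = k
        · subst hi; rw [h1]; simp
        · rw [oc_some, Function.update_of_ne hi]
          rcases h : e (some i) with _ | _ | y
          · rw [← h0] at h; simpa using e.injective h
          · rw [← h1] at h; have := e.injective h; simp at this; exact absurd this hi
          · rfl
  rw [this]; exact Cl.zero

theorem S_all (B : Bg2 g ℓ) (H : FOK g ℓ F) : ∀ J, ∀ i j : Fin (p+J), i ≠ j →
    TP g ℓ F J i j (covDIter g F J) := by
  intro J
  induction J using Nat.strong_induction_on with
  | _ J IH =>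
  have gT := good_Tj B H.good
  -- traces of the class available at level J
  have htp : ∀ {X : Type} [Fintype X] [DecidableEq X] {T : Ten n X}, Cl g ℓ F J X T → ∀ i j : X, i ≠ j →
      TP g ℓ F J i j T := fun h => h.tp B fun J' hJ' => IH J' (by omega)
  rcases J with _ | K
  · exact alt_tp B.ok H.alt
  have IHC : ∀ L, L < K → ∀ i j : Option (Fin (p+L)), i ≠ j →
      TP g ℓ F (L+1) i j (CD g (covDIter g F L : Ten n (Fin (p+L)))) := by
    intro L hL i j hij
    rw [CD_Tj]
    exact (IH (L+1) (by omega) ((finSuccEquiv (p+L)).symm i) ((finSuccEquiv (p+L)).symm j)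
      (by simpa using hij)).rl' _ (by simp) (by simp)
  have main : ∀ k, TP g ℓ F (K+1) none (some k) (CD g (covDIter g F K : Ten n (Fin (p+K)))) := by
    rcases K with _ | K
    · exact div_tp H
    have b1 : ∀ q, TP g ℓ F (K+2) none (some (some q)) (CD g (CD g (covDIter g F K : Ten n (Fin (p+K))))) := by
      intro q
      rw [ricci_id B.ok (gT K).1]
      refine TP.sub ?_ (htp (Cl.act B (gT K) (Cl.base K (by omega) (Equiv.refl _))) _ _ (by simp))
      refine TP.rl' (i := some none) (j := some (some q)) ?_ _ (by simp)
        (by rw [Equiv.swap_apply_of_ne_of_ne (by simp) (by simp)])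
      exact (IHC K (by omega) none (some q) (by simp)).CD B H.good (by simp) ((gT K).1.CD B.ok)
    have b2 : TP g ℓ F (K+2) none (some none) (CD g (CD g (covDIter g F K : Ten n (Fin (p+K))))) := by
      rcases K with _ | L
      · have e1 : CD g (CD g (covDIter g F 0 : Ten n (Fin (p+0)))) = ∑ k : Fin p,
            rl (Equiv.swap none (some k)).optionCongr (CD g (CD g (covDIter g F 0 : Ten n (Fin (p+0))))) := by
          have := congrArg (CD g) H.hd
          rw [CD_sum _ fun k => (H.good.1.CD B.ok).rl _] at this
          simp only [CD_rl] at this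
          exact this
        rw [e1]
        refine TP.sum _ fun k _ => ?_
        exact (b1 k).rl' _ rfl (by simp)
      · have e0 : CD g (covDIter g F (L+1) : Ten n (Fin (p+(L+1)))) =
            rl (finSuccEquiv (p+L)).symm.optionCongr (CD g (CD g (covDIter g F L : Ten n (Fin (p+L))))) := by
          rw [← CD_rl]; exact congrArg (CD g) (Tj_succ L)
        have e1 := congrArg (CD g) e0
        rw [CD_rl] at e1
        have c1 := b1 ((finSuccEquiv (p+L)).symm none)
        rw [e1] at c1 ⊢
        have c2 := TP.of_rl (i := none) (j := some (some none)) (finSuccEquiv (p+L)).symm.optionCongr.optionCongr rfl rfl c1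
        refine TP.rl' (i := none) (j := some none) ?_ _ rfl rfl
        have e2 := congrArg (CD g) (ricci_id B.ok (gT L).1)
        have sR : Sm (act g (riemann g) (covDIter g F L : Ten n (Fin (p+L)))) :=
          Sm.act B.ok (Sm.riemann B.ok) (gT L).1
        rw [sub_eq_add_neg, CD_add ((((gT L).1.CD B.ok).CD B.ok).rl _) sR.neg, CD_rl, ← neg_one_smul ℝ,
          CD_smul sR, neg_one_smul, ← sub_eq_add_neg] at e2
        rw [e2]
        refine TP.sub (c2.rl' _ rfl (by simp)) (htp ?_ _ _ (by simp))
        exact (Cl.act B (gT L) (Cl.base L (by omega) (Equiv.refl _))).CD B H.good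
    intro k
    have e0 : CD g (covDIter g F (K+1) : Ten n (Fin (p+(K+1)))) =
        rl (finSuccEquiv (p+K)).symm.optionCongr (CD g (CD g (covDIter g F K : Ten n (Fin (p+K))))) := by
      rw [← CD_rl]; exact congrArg (CD g) (Tj_succ K)
    rw [e0]
    obtain ⟨o, rfl⟩ := (finSuccEquiv (p+K)).symm.surjective k
    refine TP.rl' (i := none) (j := some o) ?_ _ rfl rfl
    rcases o with _ | q
    · exact b2
    · exact b1 q
  intro i j hij
  refine TP.of_rl (finSuccEquiv (p+K)) rfl rfl ?_
  have : rl (finSuccEquiv (p+K)) (covDIter g F (K+1)) = CD g (covDIter g F K : Ten n (Fin (p+K))) :=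
    (CD_Tj K).symm
  have goal : ∀ i j : Option (Fin (p+K)), i ≠ j →
      TP g ℓ F (K+1) i j (CD g (covDIter g F K : Ten n (Fin (p+K)))) := by
    intro i j hij
    rcases i with _ | i <;> rcases j with _ | j
    · exact absurd rfl hij
    · exact main j
    · exact (main i).symm B.ok
    · have hij' : i ≠ j := fun h => hij (by rw [h])
      exact (IH K (by omega) i j hij').CD B H.good hij' (gT K).1
  have h2 := goal (finSuccEquiv (p+K) i) (finSuccEquiv (p+K) j) (by simpa using hij)
  rw [← this] at h2
  exact h2

def IsCl (g : MetricField n) (ℓ : VecField n) (F : TensorField n p) (T : Ten n ι) : Prop :=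
  ∃ J, Cl g ℓ F J ι T

theorem IsCl.tr (B : Bg2 g ℓ) (H : FOK g ℓ F) {T : Ten n (Option (Option ι))} (h : IsCl g ℓ F T) :
    IsCl g ℓ F (tr g T) := by
  obtain ⟨J, h⟩ := h
  refine ⟨J, ?_⟩
  have := h.tp B (fun J' _ => S_all B H J') none (some none) (by simp) ι (Equiv.refl _) rfl rfl
  rwa [rl_refl] at this

theorem IsCl.rl {T : Ten n ι} (h : IsCl g ℓ F T) (e : ι ≃ κ) : IsCl g ℓ F (rl e T) := by
  obtain ⟨J, h⟩ := h; exact ⟨J, h.rl e⟩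
theorem IsCl.add {T S : Ten n ι} (h : IsCl g ℓ F T) (h' : IsCl g ℓ F S) : IsCl g ℓ F (T + S) := by
  obtain ⟨J, h⟩ := h; obtain ⟨J', h'⟩ := h'
  exact ⟨max J J', (h.mono (le_max_left _ _)).add (h'.mono (le_max_right _ _))⟩
theorem IsCl.smul {T : Ten n ι} (h : IsCl g ℓ F T) (r : ℝ) : IsCl g ℓ F (r • T) := by
  obtain ⟨J, h⟩ := h; exact ⟨J, h.smul r⟩
theorem IsCl.zero : IsCl g ℓ F (0 : Ten n ι) := ⟨0, Cl.zero⟩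
theorem IsCl.CD (B : Bg2 g ℓ) (H : FOK g ℓ F) {T : Ten n ι} (h : IsCl g ℓ F T) :
    IsCl g ℓ F (CD g T) := by
  obtain ⟨J, h⟩ := h; exact ⟨J+1, h.CD B H.good⟩

end p12


section p13
variable {n : ℕ} {g : MetricField n} {ℓ : VecField n}
  {ι κ : Type} [Fintype ι] [DecidableEq ι] [Fintype κ] [DecidableEq κ]
  {p : ℕ} {F : TensorField n p} {J : ℕ}

/-- product of a finite family of tensors -/
def bp {N : ℕ} {s : Fin N → ℕ} (T : ∀ j, Ten n (Fin (s j))) : Ten n (Σ j, Fin (s j)) := fun x idx =>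
  ∏ j, T j x (fun i => idx ⟨j, i⟩)

def bpE {N : ℕ} (s : Fin (N+1) → ℕ) : Fin (s 0) ⊕ (Σ j : Fin N, Fin (s j.succ)) ≃ Σ j, Fin (s j) where
  toFun
    | Sum.inl i => ⟨0, i⟩
    | Sum.inr ⟨j, i⟩ => ⟨j.succ, i⟩
  invFun q := Fin.cases (motive := fun j => Fin (s j) → Fin (s 0) ⊕ (Σ j : Fin N, Fin (s j.succ)))
    (fun i => Sum.inl i) (fun j i => Sum.inr ⟨j, i⟩) q.1 q.2
  left_inv := by rintro (i | ⟨j, i⟩) <;> rfl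
  right_inv := by
    rintro ⟨j, i⟩
    induction j using Fin.cases <;> rfl

theorem bp_succ {N : ℕ} {s : Fin (N+1) → ℕ} (T : ∀ j, Ten n (Fin (s j))) :
    bp T = rl (bpE s) (tprod (T 0) (bp fun j : Fin N => T j.succ)) := by
  funext x idx
  simp only [bp, rl, tprod, Fin.prod_univ_succ]
  rfl

def bpE1 (s : Fin 1 → ℕ) : Fin (s 0) ≃ Σ j, Fin (s j) where
  toFun i := ⟨0, i⟩
  invFun q := Fin.cases (motive := fun j => Fin (s j) → Fin (s 0)) (fun i => i) (fun j i => j.elim0) q.1 q.2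
  left_inv := fun i => rfl
  right_inv := by
    rintro ⟨j, i⟩
    obtain rfl : j = 0 := Subsingleton.elim _ _
    rfl

theorem bp_one {s : Fin 1 → ℕ} (T : ∀ j, Ten n (Fin (s j))) : bp T = rl (bpE1 s) (T 0) := by
  funext x idx
  simp only [bp, rl, Fin.prod_univ_one]
  rfl

theorem good_bp (B : Bg2 g ℓ) (N : ℕ) {s : Fin (N+1) → ℕ} (T : ∀ j, Ten n (Fin (s j)))
    (h : ∀ j, Good g ℓ (-1) (T j)) : Good g ℓ (-(N+1 : ℕ) : ℤ) (bp T) := by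
  induction N with
  | zero => rw [bp_one]; exact ((h 0).rl _)
  | succ N ih =>
    rw [bp_succ]
    have := ((h 0).tprod B (ih (fun j => T j.succ) fun j => h _)).rl (bpE s)
    refine this.mono ?_
    push_cast; linarith

theorem isCl_bp (B : Bg2 g ℓ) (hF : Good g ℓ (-1) (F : Ten n (Fin p))) (N : ℕ) (hN : 0 < N) (ord : Fin N → ℕ) :
    IsCl g ℓ F (bp (s := fun j => p + ord j) fun j => (covDIter g F (ord j) : Ten n (Fin (p + ord j)))) := by
  obtain ⟨N, rfl⟩ : ∃ M, N = M + 1 := ⟨N - 1, by omega⟩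
  rcases N with _ | N
  · rw [bp_one]
    exact ⟨ord 0 + 2, .base (ord 0) le_rfl _⟩
  · exact ⟨0, .good ((good_bp B (N+1) _ fun j => good_Tj B hF _).mono (by push_cast; linarith))⟩

/-- trace over several pairs -/
def mtr {m r : ℕ} (g : MetricField n) (U : Ten n ((Fin m × Bool) ⊕ Fin r)) : Ten n (Fin r) := fun x free =>
  ∑ φ : Fin m × Bool → Fin n, (∏ i : Fin m, (g x)⁻¹ (φ (i, false)) (φ (i, true))) * U x (Sum.elim φ free)

def mtE0 (m : ℕ) : (Fin (m+1) × Bool) ≃ Option (Option (Fin m × Bool)) where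
  toFun q := Fin.cases (motive := fun _ => Option (Option (Fin m × Bool)))
    (if q.2 then some none else none) (fun i => some (some (i, q.2))) q.1
  invFun
    | none => (0, false)
    | some none => (0, true)
    | some (some (i, c)) => (i.succ, c)
  left_inv := by
    rintro ⟨i, c⟩
    induction i using Fin.cases <;> cases c <;> rfl
  right_inv := by rintro (_ | _ | ⟨i, c⟩) <;> rfl

def mtE (m r : ℕ) : ((Fin (m+1) × Bool) ⊕ Fin r) ≃ Option (Option ((Fin m × Bool) ⊕ Fin r)) where
  toFun
    | Sum.inl q => (mtE0 m q).map (Option.map Sum.inl)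
    | Sum.inr k => some (some (Sum.inr k))
  invFun
    | none => Sum.inl (0, false)
    | some none => Sum.inl (0, true)
    | some (some (Sum.inl (i, c))) => Sum.inl (i.succ, c)
    | some (some (Sum.inr k)) => Sum.inr k
  left_inv := by
    rintro (⟨i, c⟩ | k)
    · induction i using Fin.cases <;> cases c <;> rfl
    · rfl
  right_inv := by rintro (_ | _ | ⟨i, c⟩ | k) <;> rfl

theorem mtr_succ {m r : ℕ} (U : Ten n ((Fin (m+1) × Bool) ⊕ Fin r)) :
    mtr g U = mtr g (tr g (rl (mtE m r) U)) := by
  funext x free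
  have h1 : mtr g U x free = ∑ ψ : Option (Option (Fin m × Bool)) → Fin n,
      (∏ i : Fin (m+1), (g x)⁻¹ (ψ (mtE0 m (i, false))) (ψ (mtE0 m (i, true)))) *
        U x (Sum.elim (fun q => ψ (mtE0 m q)) free) := by
    unfold mtr
    exact ((Equiv.arrowCongr (mtE0 m) (Equiv.refl (Fin n))).symm.sum_comp _).symm
  rw [h1, sum_option_fun]
  simp only [sum_option_fun (ι := Fin m × Bool), Fin.prod_univ_succ]
  simp only [mtr, tr, ptr, rl, Finset.mul_sum]
  rw [Finset.sum_comm (s := (Finset.univ : Finset (Fin m × Bool → Fin n)))]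
  refine Finset.sum_congr rfl fun a _ => ?_
  rw [Finset.sum_comm (s := (Finset.univ : Finset (Fin m × Bool → Fin n)))]
  refine Finset.sum_congr rfl fun b _ => Finset.sum_congr rfl fun φ _ => ?_
  have e1 : (Sum.elim (fun q => oc a (oc b φ) (mtE0 m q)) free : (Fin (m+1) × Bool) ⊕ Fin r → Fin n) =
      fun i => oc a (oc b (Sum.elim φ free)) (mtE m r i) := by
    funext o
    rcases o with ⟨i, c⟩ | k
    · induction i using Fin.cases <;> cases c <;> rfl
    · rfl
  rw [e1]
  change ((g x)⁻¹ a b * ∏ i : Fin m, (g x)⁻¹ (φ (i, false)) (φ (i, true))) * _ = _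
  ring

theorem IsCl.mtr (B : Bg2 g ℓ) (H : FOK g ℓ F) {m r : ℕ} {U : Ten n ((Fin m × Bool) ⊕ Fin r)}
    (h : IsCl g ℓ F U) : IsCl g ℓ F (mtr g U) := by
  induction m with
  | zero =>
    have : VSI.mtr g U = VSI.rl (Equiv.emptySum (Fin 0 × Bool) (Fin r)) U := by
      funext x free
      simp only [VSI.mtr, VSI.rl]
      simp
      congr 1; funext o; rcases o with ⟨i, _⟩ | k
      · exact i.elim0
      · rfl
    rw [this]; exact h.rl _
  | succ m ih => rw [mtr_succ]; exact ih ((h.rl _).tr B H)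

theorem isCl_value (B : Bg2 g ℓ) (H : FOK g ℓ F) {r : ℕ} (S : ConcomScheme p r) :
    IsCl g ℓ F (S.value g F : Ten n (Fin r)) :=
  ((isCl_bp B H.good S.N S.hN S.ord).rl S.slots.symm).mtr B H

theorem isCl_constr (B : Bg2 g ℓ) (H : FOK g ℓ F) {r : ℕ} {G : TensorField n r}
    (hG : IsConstructedFrom g F G) : IsCl g ℓ F (G : Ten n (Fin r)) := by
  unfold IsConstructedFrom at hG
  induction hG using Submodule.span_induction with
  | mem G h => obtain ⟨S, rfl⟩ := h; exact isCl_value B H S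
  | zero => exact IsCl.zero
  | add a b _ _ ha hb => exact ha.add hb
  | smul r a _ ha => exact ha.smul r

theorem div_zero (B : Bg2 g ℓ) (H : FOK g ℓ F) {G : TensorField n p}
    (hG : IsCl g ℓ F (G : Ten n (Fin p))) (hA : ∀ x, Alt (G x : (Fin p → Fin n) → ℝ))
    (x : Pt n) (idx : Fin p → Fin n) (k : Fin p) :
    ∑ a, ∑ b, (g x)⁻¹ a b * CD g (G : Ten n (Fin p)) x (oc a (Function.update idx k b)) = 0 := by
  let e : Option (Fin p) ≃ Option (Option {i : Fin p // i ≠ k}) := (Equiv.optionSubtypeNe k).symm.optionCongr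
  let D : Ten n {i : Fin p // i ≠ k} := tr g (rl e (CD g (G : Ten n (Fin p))))
  have hD : IsCl g ℓ F D := ((hG.CD B H).rl e).tr B H
  have hp : 0 < p := k.pos
  have gD : Good g ℓ (-2) D := by
    obtain ⟨J, h⟩ := hD
    refine h.good2 B ?_
    simp; omega
  have aD : Alt (D x) := by
    intro i j hij idx
    have e1 : rl (Equiv.swap i.1 j.1) (G : Ten n (Fin p)) = (-1 : ℝ) • (G : Ten n (Fin p)) := by
      funext x idx
      rw [neg_one_smul]
      exact hA x i.1 j.1 (fun h => hij (Subtype.ext h)) idx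
    have e2 : (Equiv.swap i.1 j.1).optionCongr.trans e = e.trans (Equiv.swap i j).optionCongr.optionCongr := by
      ext1 o
      rcases o with _ | o
      · rfl
      · show some ((Equiv.optionSubtypeNe k).symm _) = some (Option.map _ ((Equiv.optionSubtypeNe k).symm o))
        congr 1
        by_cases hi : o = i.1
        · subst hi
          rw [Equiv.swap_apply_left, Equiv.optionSubtypeNe_symm_of_ne i.2, Equiv.optionSubtypeNe_symm_of_ne j.2]
          simp
        · by_cases hj : o = j.1
          · subst hj
            rw [Equiv.swap_apply_right, Equiv.optionSubtypeNe_symm_of_ne i.2, Equiv.optionSubtypeNe_symm_of_ne j.2]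
            simp
          · rw [Equiv.swap_apply_of_ne_of_ne hi hj]
            by_cases hk : o = k
            · subst hk; simp
            · rw [Equiv.optionSubtypeNe_symm_of_ne hk]
              simp only [Option.map_some]
              rw [Equiv.swap_apply_of_ne_of_ne]
              · intro h; exact hi (congrArg Subtype.val h)
              · intro h; exact hj (congrArg Subtype.val h)
    have sG : Sm (G : Ten n (Fin p)) := by obtain ⟨J, h⟩ := hG; exact (h.good1 B H.good).1
    have e3 : rl (Equiv.swap i j) D = - D := by
      show rl (Equiv.swap i j) (tr g (rl e (CD g (G : Ten n (Fin p))))) = _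
      rw [← tr_rl, rl_rl, ← e2, ← rl_rl, ← CD_rl, e1, CD_smul sG, rl_smul, tr_smul, neg_one_smul]
    exact congrFun (congrFun e3 x) idx
  have hz := alt_zero B.toBg aD (gD.fil x)
  have := congrFun hz (fun i => idx i.1)
  rw [Pi.zero_apply] at this
  rw [← this]
  have hdef : D x (fun i => idx i.1) = ∑ a, ∑ b, (g x)⁻¹ a b *
      CD g (G : Ten n (Fin p)) x (fun o => oc a (oc b fun i => idx i.1) (e o)) := rfl
  rw [hdef]
  refine Finset.sum_congr rfl fun a _ => Finset.sum_congr rfl fun b _ => ?_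
  congr 2
  funext o
  rcases o with _ | i
  · rfl
  · show _ = oc a _ (some ((Equiv.optionSubtypeNe k).symm i))
    by_cases h : i = k
    · subst h; simp
    · rw [Equiv.optionSubtypeNe_symm_of_ne h]; simp [h]

end p13


section p14
variable {n : ℕ} {g : MetricField n} {p : ℕ} {F : TensorField n p}

theorem succAbove_F (h : IsAlternating F) (x : Pt n) (a : Fin n) (f : Fin p → Fin n) (k : Fin p) :
    F x (fun i => (Fin.cons a f : Fin (p+1) → Fin n) (k.succ.succAbove i))
      = (-1 : ℝ) ^ (k : ℕ) * F x (Function.update f k a) := by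
  have e : (fun i => (Fin.cons a f : Fin (p+1) → Fin n) (k.succ.succAbove i)) ∘ k.cycleRange
      = Function.update f k a := by
    funext j
    simp only [Function.comp_apply, Fin.succAbove_cycleRange]
    by_cases hj : j = k
    · subst hj; simp
    · rw [Equiv.swap_apply_of_ne_of_ne (Fin.succ_ne_zero _) (by simpa using hj)]
      simp [hj]
  have := h x (fun i => (Fin.cons a f : Fin (p+1) → Fin n) (k.succ.succAbove i)) k.cycleRange
  rw [e, Fin.sign_cycleRange] at this
  rw [this]
  push_cast
  rw [← mul_assoc, ← mul_pow]
  simp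

theorem pd_of_extD (h : IsAlternating F) {x : Pt n} (hd : ∀ idx, extD F x idx = 0)
    (a : Fin n) (f : Fin p → Fin n) :
    pd (fun y => F y f) a x = ∑ k, pd (fun y => F y (Function.update f k a)) (f k) x := by
  have := hd (Fin.cons a f)
  unfold extD at this
  rw [Fin.sum_univ_succ] at this
  simp only [Fin.val_zero, pow_zero, one_mul, Fin.zero_succAbove, Fin.cons_zero, Fin.cons_succ] at this
  rw [← sub_eq_zero, ← this, sub_eq_add_neg, ← Finset.sum_neg_distrib]
  congr 1
  refine Finset.sum_congr rfl fun k _ => ?_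
  simp only [succAbove_F h]
  have e : ∀ f : Pt n → ℝ, ∀ a, pd (fun y => (-1:ℝ)^(k:ℕ) * f y) a x = (-1:ℝ)^(k:ℕ) * pd f a x := by
    intro f a
    rcases neg_one_pow_eq_or ℝ (k:ℕ) with h | h
    · simp [h]
    · simp [h, pd_neg]
  rw [e, ← mul_assoc, ← pow_add, Fin.val_succ, show (k:ℕ)+1+k = 2*k+1 by ring, pow_succ, pow_mul]
  simp

theorem hd_of_extD (hg : MetOK g) (h : IsAlternating F) (hd : ∀ x idx, extD F x idx = 0) :
    CD g (F : Ten n (Fin p)) = ∑ k : Fin p, rl (Equiv.swap none (some k)) (CD g (F : Ten n (Fin p))) := by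
  funext x idx
  obtain ⟨a, f, rfl⟩ : ∃ a f, idx = oc a f := ⟨_, _, (oc_eta idx).symm⟩
  simp only [Finset.sum_apply]
  have hk : ∀ k : Fin p, rl (Equiv.swap none (some k)) (CD g (F : Ten n (Fin p))) x (oc a f)
      = nab g (f k) (F : Ten n (Fin p)) x (Function.update f k a) := by
    intro k
    simp only [rl, CD]
    congr 1
    funext i
    by_cases hi : i = k
    · subst hi; simp [oc]
    · rw [Equiv.swap_apply_of_ne_of_ne (by simp) (by simpa using hi)]
      simp [oc, hi]
  simp only [hk]
  show nab g a (F : Ten n (Fin p)) x f = _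
  unfold nab
  rw [Finset.sum_sub_distrib, pd_of_extD h (hd x)]
  congr 1
  -- the connection terms
  set A : Fin p → Fin p → ℝ := fun k m => ∑ e, christoffel g x e (f k) (Function.update f k a m) *
      F x (Function.update (Function.update f k a) m e) with hA
  have hdiag : ∀ k, A k k = ∑ e, christoffel g x e a (f k) * F x (Function.update f k e) := by
    intro k
    refine Finset.sum_congr rfl fun e _ => ?_
    rw [Function.update_self, hg.chr_symm, Function.update_idem]
  have hoff : ∀ k m, k ≠ m → A k m = - A m k := by
    intro k m hkm
    simp only [hA]
    rw [← Finset.sum_neg_distrib]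
    refine Finset.sum_congr rfl fun e _ => ?_
    rw [Function.update_of_ne hkm.symm, Function.update_of_ne hkm, hg.chr_symm, ← mul_neg]
    congr 1
    have := alt_of_isAlt h x k m hkm (Function.update (Function.update f m a) k e)
    rw [← this]
    congr 1
    funext i
    by_cases h1 : i = k
    · subst h1; simp [hkm, hkm.symm]
    · by_cases h2 : i = m
      · subst h2; simp [hkm, hkm.symm]
      · simp [h1, h2, Equiv.swap_apply_of_ne_of_ne h1 h2]
  have hsum : ∑ k, ∑ m, A k m = ∑ k, A k k := by
    have e1 : ∀ k m, A k m = (if k = m then A k m else 0) + (if k = m then 0 else A k m) := by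
      intro k m; by_cases hh : k = m <;> simp [hh]
    have e2 : ∑ k, ∑ m, (if k = m then 0 else A k m) = 0 := by
      have : ∑ k, ∑ m, (if k = m then 0 else A k m) = - ∑ k, ∑ m, (if k = m then 0 else A k m) := by
        conv_lhs => rw [Finset.sum_comm]
        rw [← Finset.sum_neg_distrib]
        refine Finset.sum_congr rfl fun m _ => ?_
        rw [← Finset.sum_neg_distrib]
        refine Finset.sum_congr rfl fun k _ => ?_
        by_cases hh : k = m
        · simp [hh]
        · rw [if_neg hh, if_neg (Ne.symm hh), hoff k m hh]
      linarith
    calc ∑ k, ∑ m, A k m = ∑ k, ∑ m, ((if k = m then A k m else 0) + (if k = m then 0 else A k m)) :=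
          Finset.sum_congr rfl fun k _ => Finset.sum_congr rfl fun m _ => e1 k m
      _ = _ := by simp only [Finset.sum_add_distrib, e2]; simp
  rw [hsum]
  exact Finset.sum_congr rfl fun k _ => (hdiag k).symm

end p14


section p15

/-- real-valued sign of a self-map -/
def eps {n : ℕ} (f : Fin n → Fin n) : ℝ := ((permSign f : ℤ) : ℝ)

theorem eps_det {n : ℕ} (f : Fin n → Fin n) :
    eps f = Matrix.det (Matrix.of fun r c : Fin n => if r = f c then (1:ℝ) else 0) := by
  unfold eps permSign
  split_ifs with h
  · set σ := Equiv.ofBijective f h with hσ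
    have : (Matrix.of fun r c : Fin n => if r = f c then (1:ℝ) else 0)
        = (1 : Matrix (Fin n) (Fin n) ℝ).submatrix id σ := by
      ext r c; simp [Matrix.one_apply, hσ]
    rw [this, Matrix.det_permute']
    simp
  · have h' : ¬ Function.Injective f := fun hi => h (Finite.injective_iff_bijective.mp hi)
    simp only [Function.Injective, not_forall] at h'
    obtain ⟨i, j, hf, hij⟩ := h'
    rw [Matrix.det_zero_of_column_eq hij]
    · simp
    · intro r; simp [hf]

theorem eps_swap {n : ℕ} (f : Fin n → Fin n) {i j : Fin n} (hij : i ≠ j) :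
    eps (fun k => f (Equiv.swap i j k)) = - eps f := by
  have := Matrix.det_permute' (Equiv.swap i j) (Matrix.of fun r c : Fin n => if r = f c then (1:ℝ) else 0)
  rw [eps_det, eps_det, Equiv.Perm.sign_swap hij] at *
  simp only [Units.val_neg, Units.val_one, Int.cast_neg, Int.cast_one, neg_mul, one_mul] at this
  exact this

theorem eps_ne_zero {n : ℕ} {f : Fin n → Fin n} : eps f ≠ 0 ↔ Function.Bijective f := by
  unfold eps permSign
  split_ifs with h
  · exact iff_of_true (by simp) h
  · exact iff_of_false (by simp) h

theorem cramer_id {n : ℕ} (seq : Fin (n+1) → Fin n) (b : Fin n) :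
    ∑ s : Fin (n+1), (-1 : ℝ)^(s:ℕ) * (if b = seq s then 1 else 0) * eps (fun i => seq (s.succAbove i)) = 0 := by
  set M : Matrix (Fin (n+1)) (Fin (n+1)) ℝ := Matrix.of fun r s =>
    (Fin.cons (if b = seq s then 1 else 0) (fun r' : Fin n => if r' = seq s then (1:ℝ) else 0) : Fin (n+1) → ℝ) r
    with hM
  have h0 : M.det = 0 := by
    refine Matrix.det_zero_of_row_eq (i := 0) (j := b.succ) (Fin.succ_ne_zero b).symm ?_
    funext s; simp [hM]
  rw [Matrix.det_succ_row_zero] at h0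
  refine Eq.trans ?_ h0
  refine Finset.sum_congr rfl fun s _ => ?_
  rw [eps_det]
  rfl

theorem append_val {α : Type*} {p q : ℕ} (a : Fin p → α) (b : Fin q → α) (i : Fin (p+q)) :
    Fin.append a b i = if h : (i:ℕ) < p then a ⟨i, h⟩ else b ⟨i - p, by omega⟩ := by
  refine Fin.addCases (fun i => ?_) (fun i => ?_) i
  · rw [Fin.append_left, dif_pos (by simp)]
    rfl
  · rw [Fin.append_right, dif_neg (by simp)]
    simp

theorem succAbove_val' {n : ℕ} (s : Fin (n+1)) (i : Fin n) :
    ((s.succAbove i : Fin (n+1)) : ℕ) = if (i:ℕ) < s then (i:ℕ) else i + 1 := by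
  simp only [Fin.succAbove, Fin.lt_def]
  simp only [Fin.val_castSucc]
  split_ifs <;> simp

/-- The sign of the concatenation of two lists of complementary length. -/
def Eap {p q : ℕ} (a : Fin p → Fin (p+1+q)) (I : Fin (q+1) → Fin (p+1+q)) : ℝ :=
  eps fun i : Fin (p+1+q) => Fin.append a I (Fin.cast (by omega) i)

theorem hodge_comb {p q : ℕ} (V : Fin (p+1+q) → (Fin (p+1) → Fin (p+1+q)) → ℝ)
    (hV : ∀ b a (σ : Equiv.Perm (Fin (p+1))), V b (a ∘ σ) = ((Equiv.Perm.sign σ : ℤ):ℝ) * V b a)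
    (I : Fin (q+1) → Fin (p+1+q)) :
    ((p:ℝ)+1) * ∑ a' : Fin p → Fin (p+1+q), (∑ b, V b (Fin.cons b a')) * Eap a' I
      + (-1:ℝ)^(p+1) * ∑ m : Fin (q+1), (-1:ℝ)^(m:ℕ) *
        ∑ a : Fin (p+1) → Fin (p+1+q), V (I m) a * eps (Fin.append a (fun i => I (m.succAbove i))) = 0 := by
  have key : ∑ b, ∑ a : Fin (p+1) → Fin (p+1+q), V b a * ∑ s : Fin (p+1+(q+1)), (-1 : ℝ)^(s:ℕ) *
      (if b = Fin.append a I s then 1 else 0) *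
        eps (fun i : Fin (p+1+q) => Fin.append a I (Fin.succAbove (n := p+1+q) s i)) = 0 := by
    refine Finset.sum_eq_zero fun b _ => Finset.sum_eq_zero fun a _ => ?_
    have := cramer_id (n := p+1+q) (Fin.append (m := p+1) (n := q+1) a I) b
    rw [show (∑ s : Fin (p+1+(q+1)), (-1 : ℝ)^(s:ℕ) *
      (if b = Fin.append a I s then 1 else 0) *
        eps (fun i : Fin (p+1+q) => Fin.append a I (Fin.succAbove (n := p+1+q) s i))) = 0 from this, mul_zero]
  simp only [@Fin.sum_univ_add ℝ _ (p+1) (q+1), mul_add, Finset.sum_add_distrib] at key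
  rw [← key]
  congr 1
  · -- first part
    have term : ∀ k : Fin (p+1), ∑ b, ∑ a : Fin (p+1) → Fin (p+1+q), V b a * ((-1 : ℝ)^(k:ℕ) *
      (if b = a k then 1 else 0) *
        eps (fun i : Fin (p+1+q) => Fin.append a I (Fin.succAbove (n := p+1+q) (Fin.castAdd (q+1) k) i)))
        = ∑ a' : Fin p → Fin (p+1+q), (∑ b, V b (Fin.cons b a')) * Eap a' I := by
      intro k
      have h1 : ∀ b, ∑ a : Fin (p+1) → Fin (p+1+q), V b a * ((-1 : ℝ)^(k:ℕ) *
        (if b = a k then 1 else 0) *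
        eps (fun i : Fin (p+1+q) => Fin.append a I (Fin.succAbove (n := p+1+q) (Fin.castAdd (q+1) k) i)))
        = ∑ a' : Fin p → Fin (p+1+q), V b (Fin.cons b a') * Eap a' I := by
        intro b
        rw [← (Equiv.arrowCongr k.cycleRange.symm (Equiv.refl _)).sum_comp]
        rw [← (Fin.consEquiv fun _ : Fin (p+1) => Fin (p+1+q)).sum_comp, Fintype.sum_prod_type]
        rw [Finset.sum_eq_single b]
        · refine Finset.sum_congr rfl fun a' _ => ?_
          have e1 : (Equiv.arrowCongr k.cycleRange.symm (Equiv.refl (Fin (p+1+q))))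
             ((Fin.consEquiv fun _ : Fin (p+1) => Fin (p+1+q)) (b, a')) = (Fin.cons b a' : Fin (p+1) → Fin (p+1+q)) ∘ k.cycleRange := by
            funext i; rfl
          rw [e1, hV, Fin.sign_cycleRange]
          have e2 : ((Fin.cons b a' : Fin (p+1) → Fin (p+1+q)) ∘ k.cycleRange) k = b := by
            simp
          rw [e2, if_pos rfl]
          have e3 : (fun i : Fin (p+1+q) => Fin.append ((Fin.cons b a' : Fin (p+1) → Fin (p+1+q)) ∘ k.cycleRange) I
              (Fin.succAbove (n := p+1+q) (Fin.castAdd (q+1) k) i)) =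
              fun i : Fin (p+1+q) => Fin.append a' I (Fin.cast (by omega) i) := by
            funext i
            rw [append_val, append_val]
            by_cases hi : (i:ℕ) < p
            · have e4 : ∀ hh, (⟨((Fin.succAbove (n := p+1+q) (Fin.castAdd (q+1) k) i : Fin (p+1+q+1)) : ℕ), hh⟩ : Fin (p+1))
                  = k.succAbove ⟨i, hi⟩ := by
                intro hh; ext
                simp only [succAbove_val', Fin.val_castAdd]
              rw [dif_pos, dif_pos (by simpa using hi), e4]
              · rw [Function.comp_apply, Fin.cycleRange_succAbove, Fin.cons_succ]; rfl
              · rw [succAbove_val']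
                split_ifs <;> omega
            · have hk := k.2
              have e4 : ((Fin.succAbove (n := p+1+q) (Fin.castAdd (q+1) k) i : Fin (p+1+q+1)) : ℕ) = i + 1 := by
                rw [succAbove_val', if_neg]
                rw [Fin.val_castAdd]; omega
              rw [dif_neg (by rw [e4]; omega), dif_neg (by simpa using hi)]
              congr 1; ext; simp only [e4, Fin.val_cast]; omega
          rw [e3]
          unfold Eap
          push_cast
          have : ((-1:ℝ)^(k:ℕ)) * (-1)^(k:ℕ) = 1 := by rw [← mul_pow]; simp
          linear_combination (V b (Fin.cons b a') * eps fun i : Fin (p+1+q) => Fin.append a' I (Fin.cast (by omega) i)) * this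
        · intro c _ hc
          refine Finset.sum_eq_zero fun a' _ => ?_
          rw [if_neg]
          · simp
          · intro h; apply hc; rw [h]
            simp [Equiv.arrowCongr]
        · simp
      rw [Finset.sum_congr rfl fun b _ => h1 b, Finset.sum_comm]
      refine Finset.sum_congr rfl fun a' _ => ?_
      rw [Finset.sum_mul]
    have t2 : ((p:ℝ)+1) * ∑ a' : Fin p → Fin (p+1+q), (∑ b, V b (Fin.cons b a')) * Eap a' I
      = ∑ k : Fin (p+1), ∑ a' : Fin p → Fin (p+1+q), (∑ b, V b (Fin.cons b a')) * Eap a' I := by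
      simp
    rw [t2, ← Finset.sum_congr rfl fun k _ => term k, Finset.sum_comm]
    refine Finset.sum_congr rfl fun b _ => ?_
    rw [Finset.sum_comm]
    refine Finset.sum_congr rfl fun a _ => ?_
    rw [Finset.mul_sum]
    refine Finset.sum_congr rfl fun k _ => ?_
    rw [Fin.append_left]; rfl
  · rw [Finset.mul_sum]
    have term : ∀ m : Fin (q+1), (-1:ℝ)^(p+1) * ((-1:ℝ)^(m:ℕ) *
        ∑ a : Fin (p+1) → Fin (p+1+q), V (I m) a * eps (Fin.append a (fun i => I (m.succAbove i))))
        = ∑ b, ∑ a : Fin (p+1) → Fin (p+1+q), V b a * ((-1 : ℝ)^(p+1+(m:ℕ)) *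
      (if b = I m then 1 else 0) *
        eps (fun i : Fin (p+1+q) => Fin.append a I (Fin.succAbove (n := p+1+q) (Fin.natAdd (p+1) m) i))) := by
      intro m
      rw [Finset.sum_eq_single (I m)]
      · rw [← mul_assoc, ← pow_add, Finset.mul_sum]
        refine Finset.sum_congr rfl fun a _ => ?_
        have e3 : (fun i : Fin (p+1+q) => Fin.append a I (Fin.succAbove (n := p+1+q) (Fin.natAdd (p+1) m) i))
            = Fin.append a (fun i => I (m.succAbove i)) := by
          funext i
          rw [append_val, append_val]
          by_cases hi : (i:ℕ) < p+1
          · have e4 : ((Fin.succAbove (n := p+1+q) (Fin.natAdd (p+1) m) i : Fin (p+1+q+1)) : ℕ) = i := by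
              rw [succAbove_val', if_pos]
              rw [Fin.val_natAdd]; omega
            rw [dif_pos (by omega), dif_pos hi]
            congr 1; ext; exact e4
          · have e4 : ((Fin.succAbove (n := p+1+q) (Fin.natAdd (p+1) m) i : Fin (p+1+q+1)) : ℕ)
                = p + 1 + (m.succAbove ⟨i - (p+1), by omega⟩ : Fin (q+1)) := by
              rw [succAbove_val', succAbove_val', Fin.val_natAdd]
              simp only
              split_ifs <;> omega
            rw [dif_neg (by omega), dif_neg hi]
            congr 1; ext; simp only [e4]; omega
        rw [e3, if_pos rfl]; ring
      · intro b _ hb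
        exact Finset.sum_eq_zero fun a _ => by simp [hb]
      · simp
    rw [Finset.sum_congr rfl fun m _ => term m, Finset.sum_comm]
    refine Finset.sum_congr rfl fun b _ => ?_
    rw [Finset.sum_comm]
    refine Finset.sum_congr rfl fun a _ => ?_
    rw [Finset.mul_sum]
    refine Finset.sum_congr rfl fun k _ => ?_
    rw [Fin.append_right]; rfl

end p15


section p16
variable {p q : ℕ}

theorem Eap_swap (a : Fin p → Fin (p+1+q)) (I : Fin (q+1) → Fin (p+1+q)) {i j : Fin p} (hij : i ≠ j) :
    Eap (fun k => a (Equiv.swap i j k)) I = - Eap a I := by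
  unfold Eap
  have hi := i.2
  have hj := j.2
  set i' : Fin (p+1+q) := ⟨i, by omega⟩ with hi'
  set j' : Fin (p+1+q) := ⟨j, by omega⟩ with hj'
  have hij' : i' ≠ j' := by
    intro h; apply hij; ext; simpa [hi', hj', Fin.ext_iff] using h
  rw [← eps_swap _ hij']
  congr 1
  funext k
  rw [append_val, append_val]
  by_cases hk : (k:ℕ) < p
  · rw [dif_pos (by simpa using hk)]
    by_cases h1 : k = i'
    · have e : (⟨(Fin.cast (by omega) k : Fin (p+(q+1))), by simpa using hk⟩ : Fin p) = i := by
        ext; simp [h1, hi']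
      rw [e, h1]
      simp [hj']
    · by_cases h2 : k = j'
      · have e : (⟨(Fin.cast (by omega) k : Fin (p+(q+1))), by simpa using hk⟩ : Fin p) = j := by
          ext; simp [h2, hj']
        rw [e, h2]
        simp [hi']
      · rw [Equiv.swap_apply_of_ne_of_ne h1 h2, dif_pos (by simpa using hk), Equiv.swap_apply_of_ne_of_ne]
        · intro h; apply h1; ext; simpa [Fin.ext_iff, hi'] using h
        · intro h; apply h2; ext; simpa [Fin.ext_iff, hj'] using h
  · have h1 : k ≠ i' := by intro h; apply hk; rw [h]; simp [hi']
    have h2 : k ≠ j' := by intro h; apply hk; rw [h]; simp [hj']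
    rw [Equiv.swap_apply_of_ne_of_ne h1 h2]
    rw [dif_neg (by simpa using hk), dif_neg (by simpa using hk)]

theorem Eap_ne_zero {a : Fin p → Fin (p+1+q)} {I : Fin (q+1) → Fin (p+1+q)} :
    Eap a I ≠ 0 ↔ Function.Bijective (Fin.append a I) := by
  unfold Eap
  rw [eps_ne_zero]
  exact (finCongr (show p+1+q = p+(q+1) by omega)).bijective_comp (Fin.append a I)

theorem exists_compl {a : Fin p → Fin (p+1+q)} (ha : Function.Injective a) :
    ∃ I : Fin (q+1) → Fin (p+1+q), Function.Bijective (Fin.append a I) := by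
  classical
  have hc : (Finset.univ.image a)ᶜ.card = q + 1 := by
    rw [Finset.card_compl, Finset.card_image_of_injective _ ha]; simp; omega
  set e := Finset.orderEmbOfFin _ hc with he
  refine ⟨e, ?_⟩
  have hinj : Function.Injective (Fin.append a e) := by
    rw [Fin.append_injective_iff]
    refine ⟨ha, e.injective, ?_⟩
    intro i j h
    have := Finset.orderEmbOfFin_mem _ hc j
    rw [Finset.mem_compl] at this
    apply this
    rw [← he, ← h]; simp
  exact (Fintype.bijective_iff_injective_and_card _).mpr ⟨hinj, by simp; omega⟩

theorem inv_perm {W : (Fin p → Fin (p+1+q)) → ℝ}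
    (hW : ∀ i j : Fin p, i ≠ j → ∀ a, W (fun k => a (Equiv.swap i j k)) = W a)
    (τ : Equiv.Perm (Fin p)) : ∀ a, W (a ∘ τ) = W a := by
  induction τ using Equiv.Perm.swap_induction_on with
  | one => intro a; rfl
  | swap_mul f x y hxy ih =>
    intro a
    have := ih (a ∘ Equiv.swap x y)
    rw [show a ∘ (Equiv.swap x y * f : Equiv.Perm (Fin p)) = (a ∘ Equiv.swap x y) ∘ f from rfl, this]
    exact hW x y hxy a

theorem nondeg {W : (Fin p → Fin (p+1+q)) → ℝ} (hW : Alt W)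
    (h : ∀ I : Fin (q+1) → Fin (p+1+q), ∑ a, W a * Eap a I = 0) : W = 0 := by
  classical
  funext a
  by_cases ha : Function.Injective a
  · obtain ⟨I, hI⟩ := exists_compl ha
    have h1 := h I
    have hinv : ∀ b, Eap b I ≠ 0 → W b * Eap b I = W a * Eap a I := by
      intro b hb
      rw [Eap_ne_zero] at hb
      have hr : ∀ i, ∃ j, a j = b i := by
        intro i
        obtain ⟨s, hs⟩ := hI.2 (b i)
        induction s using Fin.addCases with
        | left j => exact ⟨j, by rw [← hs, Fin.append_left]⟩
        | right j =>
          exfalso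
          have e1 : Fin.append b I (Fin.natAdd p j) = Fin.append b I (Fin.castAdd (q+1) i) := by
            rw [Fin.append_left, ← hs, Fin.append_right, Fin.append_right]
          have := hb.1 e1
          rw [Fin.ext_iff] at this
          have := i.2
          simp at *
          omega
      choose τ hτ using hr
      have hbi : Function.Injective b := by
        intro i j hij
        have : Fin.append b I (Fin.castAdd (q+1) i) = Fin.append b I (Fin.castAdd (q+1) j) := by simp [hij]
        have := hb.1 this
        simpa using this
      have hτi : Function.Injective τ := by
        intro i j hij; apply hbi; rw [← hτ, ← hτ, hij]
      have := inv_perm (W := fun a => W a * Eap a I) (fun i j hij c => by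
        rw [hW i j hij, Eap_swap c I hij]; ring) (Equiv.ofBijective τ (Finite.injective_iff_bijective.mp hτi)) a
      rw [← this]
      have e : a ∘ (Equiv.ofBijective τ (Finite.injective_iff_bijective.mp hτi)) = b := by
        funext i; exact hτ i
      rw [e]
    have h2 : ∑ b, W b * Eap b I = ((Finset.univ.filter fun b => Eap b I ≠ 0).card : ℝ) * (W a * Eap a I) := by
      rw [← Finset.sum_filter_ne_zero, ← nsmul_eq_mul, ← Finset.sum_const]
      rw [Finset.sum_filter_ne_zero, Finset.sum_filter]
      refine Finset.sum_congr rfl fun b _ => ?_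
      by_cases hb : Eap b I = 0
      · simp [hb]
      · rw [if_pos hb, hinv b hb]
    rw [h2] at h1
    have hE := Eap_ne_zero.mpr hI
    have hcard : ((Finset.univ.filter fun b : Fin p → Fin (p+1+q) => Eap b I ≠ 0).card : ℝ) ≠ 0 := by
      rw [Nat.cast_ne_zero, ← Nat.pos_iff_ne_zero, Finset.card_pos]
      exact ⟨a, by simpa using hE⟩
    rcases mul_eq_zero.mp h1 with h3 | h3
    · exact absurd h3 hcard
    · exact (mul_eq_zero.mp h3).resolve_right hE
  · simp only [Function.Injective, not_forall] at ha
    obtain ⟨i, j, hf, hij⟩ := ha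
    have := hW i j hij a
    have e : (fun k => a (Equiv.swap i j k)) = a := by
      funext k; rw [Equiv.swap_apply_def]; split_ifs with h1 h2
      · rw [h1, hf]
      · rw [h2, hf]
      · rfl
    rw [e] at this
    show W a = 0
    linarith

end p16


section p17
variable {n : ℕ} {g : MetricField n} {p : ℕ}

/-- volume density -/
def sq (g : MetricField n) (x : Pt n) : ℝ := Real.sqrt |(g x).det|

theorem absdet_ne (hg : MetOK g) (x : Pt n) : |(g x).det| ≠ 0 := abs_ne_zero.mpr (hg.det x).ne_zero

theorem sq_ne (hg : MetOK g) (x : Pt n) : sq g x ≠ 0 :=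
  Real.sqrt_ne_zero'.mpr (abs_pos.mpr (hg.det x).ne_zero)

theorem sm_sq (hg : MetOK g) : Smf (sq g) := by
  unfold sq
  refine ContDiff.sqrt ?_ (absdet_ne hg)
  rw [contDiff_iff_contDiffAt]
  intro x
  exact ((hg.sm_det).contDiffAt (x := x)).abs (hg.det x).ne_zero

theorem pd_det (hg : MetOK g) (x : Pt n) (b : Fin n) : pd (fun y => (g y).det) b x
    = (g x).det * ∑ i, ∑ j, (g x)⁻¹ i j * pd (fun y => g y j i) b x := by
  have e1 : pd (fun y => (g y).det) b x = ∑ k, ((g x).updateCol k (fun j => pd (fun y => g y j k) b x)).det := by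
    simp only [Matrix.det_apply']
    rw [pd_sum _ _ (fun σ => contDiff_const.mul (Smf.prod fun i => hg.sm _ _)), Finset.sum_comm]
    refine Finset.sum_congr rfl fun σ _ => ?_
    rw [pd_const_mul _ (Smf.prod fun i => hg.sm _ _), pd_prod _ _ (fun i => hg.sm _ _), Finset.mul_sum]
    refine Finset.sum_congr rfl fun k _ => ?_
    congr 1
    rw [← Finset.mul_prod_erase _ _ (Finset.mem_univ k)]
    rw [Matrix.updateCol_self]
    congr 1
    refine Finset.prod_congr rfl fun j hj => ?_
    rw [Matrix.updateCol_ne (Finset.ne_of_mem_erase hj)]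
  rw [e1, Finset.mul_sum]
  refine Finset.sum_congr rfl fun k _ => ?_
  have := Matrix.cramer_apply (g x) (fun j => pd (fun y => g y j k) b x) k
  rw [← this, Matrix.cramer_eq_adjugate_mulVec, Matrix.mulVec, dotProduct, Finset.mul_sum]
  refine Finset.sum_congr rfl fun j _ => ?_
  rw [Matrix.inv_def, Matrix.smul_apply, smul_eq_mul, Ring.inverse_eq_inv', ← mul_assoc, ← mul_assoc,
    mul_inv_cancel₀ (hg.det x).ne_zero, one_mul]

theorem pd_sq (hg : MetOK g) (x : Pt n) (b : Fin n) :
    pd (sq g) b x = sq g x * ∑ a, christoffel g x a b a := by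
  have e0 : ∀ y, sq g y * sq g y = |(g y).det| := fun y => Real.mul_self_sqrt (abs_nonneg _)
  have s := sm_sq hg
  -- (sq)^4 = det^2
  have e1 : (fun y => (sq g y * sq g y) * (sq g y * sq g y)) = fun y => (g y).det * (g y).det := by
    funext y; rw [e0, abs_mul_abs_self]
  have e2 : pd (fun y => (sq g y * sq g y) * (sq g y * sq g y)) b x = pd (fun y => (g y).det * (g y).det) b x := by
    rw [e1]
  rw [pd_mul (s.mul s) (s.mul s), pd_mul s s, pd_mul hg.sm_det hg.sm_det, pd_det hg] at e2
  have e3 : ∑ i, ∑ j, (g x)⁻¹ i j * pd (fun y => g y j i) b x = 2 * ∑ a, christoffel g x a b a := by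
    have h1 : ∀ i j, (g x)⁻¹ i j * pd (fun y => g y j i) b x = 
       ∑ e, (christoffel g x e b j * (g x e i * (g x)⁻¹ i j)) + ∑ e, (christoffel g x e b i * ((g x)⁻¹ i j * g x j e)) := by
      intro i j
      rw [hg.pd_g, Finset.mul_sum, ← Finset.sum_add_distrib]
      refine Finset.sum_congr rfl fun e _ => ?_
      ring
    simp only [h1, Finset.sum_add_distrib]
    have h2 : ∑ i, ∑ j, ∑ e, (christoffel g x e b j * (g x e i * (g x)⁻¹ i j)) = ∑ a, christoffel g x a b a := by
      rw [Finset.sum_comm]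
      refine Finset.sum_congr rfl fun j _ => ?_
      rw [Finset.sum_comm]
      simp only [← Finset.mul_sum, hg.mul_inv]
      simp
    have h3 : ∑ i, ∑ j, ∑ e, (christoffel g x e b i * ((g x)⁻¹ i j * g x j e)) = ∑ a, christoffel g x a b a := by
      refine Finset.sum_congr rfl fun i _ => ?_
      rw [Finset.sum_comm]
      simp only [← Finset.mul_sum, hg.inv_mul]
      simp
    rw [h2, h3]; ring
  rw [e3] at e2
  have e4 : sq g x * sq g x * (sq g x * sq g x) = (g x).det * (g x).det := congrFun e1 x
  have hne : 4 * (sq g x * sq g x * sq g x) ≠ 0 := by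
    have := sq_ne hg x; positivity
  apply mul_left_cancel₀ hne
  linear_combination e2 - 4 * (∑ a, christoffel g x a b a) * e4

theorem raise_ev (T : TensorField n p) (x : Pt n) (idx : Fin p → Fin n) :
    raiseAll g T x idx = evM (T x : (Fin p → Fin n) → ℝ) (fun m => (g x)⁻¹ (idx m)) := by
  rw [evM_apply]; unfold raiseAll
  exact Finset.sum_congr rfl fun j _ => mul_comm _ _

theorem sm_raise (hg : MetOK g) {T : TensorField n p} (hT : Sm (T : Ten n (Fin p))) (idx : Fin p → Fin n) :
    Smf fun x => raiseAll g T x idx := by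
  unfold raiseAll
  exact Smf.sum fun j => (Smf.prod fun m => hg.sm_inv _ _).mul (hT j)

theorem pd_raise (hg : MetOK g) {T : TensorField n p} (hT : Sm (T : Ten n (Fin p))) (idx : Fin p → Fin n)
    (b : Fin n) (x : Pt n) : pd (fun y => raiseAll g T y idx) b x =
      raiseAll g (nab g b (T : Ten n (Fin p)) : TensorField n p) x idx
      - ∑ m, ∑ e, christoffel g x (idx m) b e * raiseAll g T x (Function.update idx m e) := by
  simp only [raise_ev]
  have := pd_ev (g := g) (T := (T : Ten n (Fin p))) hT (fun m y => (g y)⁻¹ (idx m)) (fun m e => hg.sm_inv _ _) b x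
  rw [this, sub_eq_add_neg, ← Finset.sum_neg_distrib]
  congr 1
  refine Finset.sum_congr rfl fun m _ => ?_
  have e1 : nabV g b (fun y => (g y)⁻¹ (idx m)) x = ∑ e, (-christoffel g x (idx m) b e) • (g x)⁻¹ e := by
    funext c
    unfold nabV
    rw [hg.pd_gi, Finset.sum_add_distrib]
    rw [Finset.sum_apply]
    simp only [Pi.smul_apply, smul_eq_mul, neg_mul, Finset.sum_neg_distrib]
    ring
  rw [e1, MultilinearMap.map_update_sum, ← Finset.sum_neg_distrib]
  refine Finset.sum_congr rfl fun e _ => ?_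
  rw [MultilinearMap.map_update_smul, smul_eq_mul, neg_mul]
  congr 3
  funext k
  by_cases hk : k = m
  · subst hk; simp
  · simp [hk]

theorem raise_alt {T : (Fin p → Fin n) → ℝ} {x : Pt n} {S : TensorField n p} (hS : S x = T)
    (hT : ∀ idx (σ : Equiv.Perm (Fin p)), T (idx ∘ σ) = ((Equiv.Perm.sign σ : ℤ) : ℝ) * T idx)
    (idx : Fin p → Fin n) (σ : Equiv.Perm (Fin p)) :
    raiseAll g S x (idx ∘ σ) = ((Equiv.Perm.sign σ : ℤ) : ℝ) * raiseAll g S x idx := by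
  subst hS
  unfold raiseAll
  rw [← (Equiv.arrowCongr σ.symm (Equiv.refl (Fin n))).sum_comp, Finset.mul_sum]
  refine Finset.sum_congr rfl fun j _ => ?_
  have e : (Equiv.arrowCongr σ.symm (Equiv.refl (Fin n))) j = j ∘ σ := by funext i; rfl
  rw [e, hT]
  have e2 : ∏ m, (g x)⁻¹ ((idx ∘ σ) m) ((j ∘ σ) m) = ∏ m, (g x)⁻¹ (idx m) (j m) :=
    Equiv.prod_comp σ (fun m => (g x)⁻¹ (idx m) (j m))
  rw [e2]; ring

theorem lower_raise (hg : MetOK g) (T : TensorField n p) (x : Pt n) (k : Fin p → Fin n) :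
    ∑ a : Fin p → Fin n, (∏ m, g x (k m) (a m)) * raiseAll g T x a = T x k := by
  unfold raiseAll
  simp only [Finset.mul_sum]
  rw [Finset.sum_comm]
  have h1 : ∀ j : Fin p → Fin n, ∑ a : Fin p → Fin n, (∏ m, g x (k m) (a m)) * ((∏ m, (g x)⁻¹ (a m) (j m)) * T x j)
      = if j = k then T x j else 0 := by
    intro j
    have h2 : ∑ a : Fin p → Fin n, (∏ m, (g x (k m) (a m) * (g x)⁻¹ (a m) (j m)))
        = ∏ m, ∑ c, g x (k m) c * (g x)⁻¹ c (j m) := by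
      rw [Finset.prod_univ_sum, Fintype.piFinset_univ]
    simp only [← mul_assoc, ← Finset.prod_mul_distrib]
    rw [← Finset.sum_mul, h2]
    simp only [hg.mul_inv]
    by_cases hjk : j = k
    · subst hjk; simp
    · rw [if_neg hjk]
      obtain ⟨m, hm⟩ := Function.ne_iff.mp hjk
      rw [Finset.prod_eq_zero (Finset.mem_univ m) (by simp [Ne.symm hm]), zero_mul]
  rw [Finset.sum_congr rfl fun j _ => h1 j]
  simp

end p17


section p18
variable {n : ℕ} {g : MetricField n} {p : ℕ}

/-- divergence on the first slot -/
def divF (g : MetricField n) (G : TensorField n (p+1)) : TensorField n p := fun x j =>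
  ∑ b, ∑ c, (g x)⁻¹ b c * nab g b (G : Ten n (Fin (p+1))) x (Fin.cons c j)

theorem raise_swap {G : TensorField n (p+1)} (hA : IsAlternating G) (x : Pt n) (k : Fin p)
    (a' : Fin p → Fin n) (b e : Fin n) :
    raiseAll g G x (Fin.cons b (Function.update a' k e)) = - raiseAll g G x (Fin.cons e (Function.update a' k b)) := by
  have := raise_alt (g := g) (x := x) (S := G) rfl (hA x) (Fin.cons e (Function.update a' k b)) (Equiv.swap 0 k.succ)
  rw [Equiv.Perm.sign_swap (Fin.succ_ne_zero k).symm] at this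
  have e1 : (Fin.cons e (Function.update a' k b) : Fin (p+1) → Fin n) ∘ Equiv.swap 0 k.succ
      = Fin.cons b (Function.update a' k e) := by
    funext i
    rw [Function.comp_apply]
    induction i using Fin.cases with
    | zero => simp
    | succ i =>
      by_cases hi : i = k
      · subst hi; simp
      · rw [Equiv.swap_apply_of_ne_of_ne (Fin.succ_ne_zero _) (by simpa using hi)]
        simp [hi]
  rw [e1] at this
  rw [this]; simp

theorem W_eq (hg : MetOK g) {G : TensorField n (p+1)} (hS : Sm (G : Ten n (Fin (p+1)))) (hA : IsAlternating G)
    (x : Pt n) (a' : Fin p → Fin n) :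
    ∑ b, pd (fun y => sq g y * raiseAll g G y (Fin.cons b a')) b x = sq g x * raiseAll g (divF g G) x a' := by
  have h1 : ∀ b, pd (fun y => sq g y * raiseAll g G y (Fin.cons b a')) b x =
      sq g x * (∑ a, christoffel g x a a b * raiseAll g G x (Fin.cons b a'))
      + sq g x * raiseAll g (nab g b (G : Ten n (Fin (p+1))) : TensorField n (p+1)) x (Fin.cons b a')
      - sq g x * (∑ e, christoffel g x b b e * raiseAll g G x (Fin.cons e a'))
      - sq g x * ∑ k : Fin p, ∑ e, christoffel g x (a' k) b e * raiseAll g G x (Fin.cons b (Function.update a' k e)) := by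
    intro b
    rw [pd_mul (sm_sq hg) (sm_raise hg hS _), pd_sq hg, pd_raise hg hS, Fin.sum_univ_succ]
    simp only [Fin.cons_zero, Fin.cons_succ, Fin.update_cons_zero, ← Fin.cons_update]
    simp only [← Finset.sum_mul, hg.chr_symm x _ _ b]
    rw [Finset.sum_congr rfl fun a _ => hg.chr_symm x a b a]
    ring
  rw [Finset.sum_congr rfl fun b _ => h1 b]
  simp only [Finset.sum_sub_distrib, Finset.sum_add_distrib, ← Finset.mul_sum]
  have h2 : ∑ b, ∑ k : Fin p, ∑ e, christoffel g x (a' k) b e * raiseAll g G x (Fin.cons b (Function.update a' k e)) = 0 := by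
    rw [Finset.sum_comm]
    refine Finset.sum_eq_zero fun k _ => ?_
    have : ∑ b, ∑ e, christoffel g x (a' k) b e * raiseAll g G x (Fin.cons b (Function.update a' k e))
      = - ∑ b, ∑ e, christoffel g x (a' k) b e * raiseAll g G x (Fin.cons b (Function.update a' k e)) := by
      conv_lhs => rw [Finset.sum_comm]
      rw [← Finset.sum_neg_distrib]
      refine Finset.sum_congr rfl fun b _ => ?_
      rw [← Finset.sum_neg_distrib]
      refine Finset.sum_congr rfl fun e _ => ?_
      rw [raise_swap hA, hg.chr_symm x (a' k) b e]; ring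
    linarith
  have h3 : ∑ b, ∑ e, christoffel g x b b e * raiseAll g G x (Fin.cons e a') = 
     ∑ b, ∑ a, christoffel g x a a b * raiseAll g G x (Fin.cons b a') := Finset.sum_comm
  rw [h2, h3]
  have h4 : ∑ b, raiseAll g (nab g b (G : Ten n (Fin (p+1))) : TensorField n (p+1)) x (Fin.cons b a')
      = raiseAll g (divF g G) x a' := by
    unfold raiseAll divF
    simp only [Finset.mul_sum]
    rw [Finset.sum_comm' (t' := Finset.univ) (s' := fun _ => Finset.univ) (by simp)]
    rw [← (Fin.consEquiv fun _ : Fin (p+1) => Fin n).sum_comp, Fintype.sum_prod_type, Finset.sum_comm]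
    refine Finset.sum_congr rfl fun j _ => ?_
    rw [Finset.sum_comm]
    refine Finset.sum_congr rfl fun b _ => ?_
    refine Finset.sum_congr rfl fun c _ => ?_
    rw [Fin.prod_univ_succ]
    simp only [Fin.consEquiv, Equiv.coe_fn_mk, Fin.cons_zero, Fin.cons_succ]
    ring
  rw [h4]; ring

theorem hodge_div {q : ℕ} (h : p + 1 + q = n) (hg : MetOK g) {G : TensorField n (p+1)}
    (hS : Sm (G : Ten n (Fin (p+1)))) (hA : IsAlternating G) :
    (∀ x I, extD (hodge h g G) x I = 0) ↔ ∀ x j, divF g G x j = 0 := by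
  subst h
  have hV : ∀ x b a (σ : Equiv.Perm (Fin (p+1))),
      pd (fun y => sq g y * raiseAll g G y (a ∘ σ)) b x
       = ((Equiv.Perm.sign σ : ℤ):ℝ) * pd (fun y => sq g y * raiseAll g G y a) b x := by
    intro x b a σ
    rw [← pd_const_mul _ ((sm_sq hg).mul (sm_raise hg hS a))]
    congr 1
    funext y
    rw [raise_alt (g := g) (x := y) (S := G) rfl (hA y) a σ]; ring
  have hE : ∀ x I, extD (hodge rfl g G) x I = (1 / (Nat.factorial (p+1) : ℝ)) *
      ∑ m : Fin (q+1), (-1:ℝ)^(m:ℕ) * ∑ a : Fin (p+1) → Fin (p+1+q),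
        pd (fun y => sq g y * raiseAll g G y a) (I m) x * eps (Fin.append a (fun i => I (m.succAbove i))) := by
    intro x I
    unfold extD
    rw [Finset.mul_sum]
    refine Finset.sum_congr rfl fun m _ => ?_
    have e1 : (fun y => hodge rfl g G y fun i => I (m.succAbove i)) = fun y => (1 / (Nat.factorial (p+1) : ℝ)) *
        ∑ a : Fin (p+1) → Fin (p+1+q), eps (Fin.append a (fun i => I (m.succAbove i))) * (sq g y * raiseAll g G y a) := by
      funext y
      unfold hodge
      congr 1
      refine Finset.sum_congr rfl fun a _ => ?_
      show _ * (sq g y * eps (Fin.append a (fun i => I (m.succAbove i)))) = _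
      ring
    have sm : ∀ a, Smf fun y => sq g y * raiseAll g G y a := fun a => (sm_sq hg).mul (sm_raise hg hS a)
    rw [e1, pd_const_mul _ (Smf.sum fun a => contDiff_const.mul (sm a)), pd_sum _ _ (fun a => contDiff_const.mul (sm a))]
    rw [Finset.sum_congr rfl fun a _ => (pd_const_mul _ (sm a)).trans (mul_comm _ _)]
    ring
  have hfac : (1 / (Nat.factorial (p+1) : ℝ)) ≠ 0 := by positivity
  have key := fun x I => hodge_comb (fun b a => pd (fun y => sq g y * raiseAll g G y a) b x) (hV x) I
  simp only [W_eq hg hS hA] at key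
  constructor
  · intro h0 x
    have h1 : ∀ I : Fin (q+1) → Fin (p+1+q), ∑ a, (sq g x * raiseAll g (divF g G) x a) * Eap a I = 0 := by
      intro I
      have k := key x I
      have := h0 x I
      rw [hE] at this
      rw [(mul_eq_zero.mp this).resolve_left hfac, mul_zero, add_zero] at k
      exact (mul_eq_zero.mp k).resolve_left (by positivity)
    have h2 := nondeg (W := fun a => sq g x * raiseAll g (divF g G) x a) (by
      intro i j hij a
      simp only [← W_eq hg hS hA]
      rw [← Finset.sum_neg_distrib]
      refine Finset.sum_congr rfl fun b _ => ?_
      have := hV x b (Fin.cons b a) (Equiv.swap i.succ j.succ)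
      rw [Equiv.Perm.sign_swap (by simpa using hij)] at this
      have e1 : (Fin.cons b a : Fin (p+1) → Fin (p+1+q)) ∘ Equiv.swap i.succ j.succ
          = Fin.cons b (fun k => a (Equiv.swap i j k)) := by
        funext k
        rw [Function.comp_apply]
        induction k using Fin.cases with
        | zero => rw [Equiv.swap_apply_of_ne_of_ne (Fin.succ_ne_zero _).symm (Fin.succ_ne_zero _).symm]; rfl
        | succ k =>
          rw [Fin.cons_succ]
          by_cases h1 : k = i
          · subst h1; simp
          · by_cases h2 : k = j
            · subst h2; simp
            · rw [Equiv.swap_apply_of_ne_of_ne h1 h2, Equiv.swap_apply_of_ne_of_ne (by simpa using h1) (by simpa using h2)]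
              simp
      rw [e1] at this
      rw [this]; simp) h1
    intro j
    rw [← lower_raise hg (divF g G) x j]
    refine Finset.sum_eq_zero fun a _ => ?_
    have := congrFun h2 a
    simp only [Pi.zero_apply] at this
    rw [(mul_eq_zero.mp this).resolve_left (sq_ne hg x), mul_zero]
  · intro h0 x I
    have hz : ∀ a, raiseAll g (divF g G) x a = 0 := by
      intro a; unfold raiseAll; simp [h0]
    have k := key x I
    simp only [hz, mul_zero, zero_mul, Finset.sum_const_zero, zero_add] at k
    rw [hE, (mul_eq_zero.mp k).resolve_left (pow_ne_zero _ (by norm_num)), mul_zero]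

theorem divF_slot {G : TensorField n (p+1)} (x : Pt n)
    (hs : ∀ b, Alt (nab g b (G : Ten n (Fin (p+1))) x)) (idx : Fin (p+1) → Fin n) (k : Fin (p+1))
    (h0 : ∀ j, divF g G x j = 0) :
    ∑ a, ∑ b, (g x)⁻¹ a b * CD g (G : Ten n (Fin (p+1))) x (oc a (Function.update idx k b)) = 0 := by
  show ∑ a, ∑ b, (g x)⁻¹ a b * nab g a (G : Ten n (Fin (p+1))) x (Function.update idx k b) = 0
  by_cases hk : k = 0
  · subst hk
    refine Eq.trans ?_ (h0 (Fin.tail idx))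
    unfold divF
    refine Finset.sum_congr rfl fun a _ => Finset.sum_congr rfl fun b _ => ?_
    congr 2
    funext i
    induction i using Fin.cases with
    | zero => simp
    | succ i => simp [Fin.tail]
  · have e : ∀ b, Function.update idx k b = fun i => (Fin.cons b (Fin.tail (idx ∘ Equiv.swap 0 k)) : Fin (p+1) → Fin n) (Equiv.swap 0 k i) := by
      intro b
      funext i
      by_cases hi : i = k
      · subst hi; simp
      · by_cases h0 : i = 0
        · subst h0
          rw [Equiv.swap_apply_left, Function.update_of_ne hi]
          obtain ⟨k', rfl⟩ := Fin.exists_succ_eq.mpr hk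
          simp [Fin.tail]
        · rw [Equiv.swap_apply_of_ne_of_ne h0 hi, Function.update_of_ne hi]
          obtain ⟨i', rfl⟩ := Fin.exists_succ_eq.mpr h0
          simp [Fin.tail, Equiv.swap_apply_of_ne_of_ne h0 hi]
    have := h0 (Fin.tail (idx ∘ Equiv.swap 0 k))
    unfold divF at this
    rw [← neg_eq_zero]
    refine Eq.trans ?_ this
    rw [← Finset.sum_neg_distrib]
    refine Finset.sum_congr rfl fun a _ => ?_
    rw [← Finset.sum_neg_distrib]
    refine Finset.sum_congr rfl fun b _ => ?_
    rw [e, hs a 0 k (Ne.symm hk)]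
    ring

theorem alt_nab {G : TensorField n p} (hS : Sm (G : Ten n (Fin p))) (hA : IsAlternating G) (x : Pt n) (b : Fin n) :
    Alt (nab g b (G : Ten n (Fin p)) x) := by
  intro i j hij idx
  have e1 : rl (Equiv.swap i j) (G : Ten n (Fin p)) = (-1 : ℝ) • (G : Ten n (Fin p)) := by
    funext y f
    have := alt_of_isAlt hA y i j hij f
    show G y _ = (-1:ℝ) • G y f
    rw [this]; simp
  have e2 : rl (Equiv.swap i j) (nab g b (G : Ten n (Fin p))) = (-1:ℝ) • nab g b (G : Ten n (Fin p)) := by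
    rw [← nab_rl, e1, nab_smul hS]
  have := congrFun (congrFun e2 x) idx
  show rl (Equiv.swap i j) (nab g b (G : Ten n (Fin p))) x idx = _
  rw [this]; simp

end p18

/-- a VSI Maxwell `p`-form on a Kundt spacetime of aligned Weyl and
traceless-Ricci type III with `DR = 0 = δᵢR` is universal: it solves the field
equations `dF = 0`, `d*F̃ = 0` of any generalized electrodynamics, `F̃` being any
`p`-form constructed from `F` and its covariant derivatives. -/
theorem vsi_maxwell_universal {n p : ℕ} [NeZero n] [NeZero p] (hn3 : 3 ≤ n) (hp : p ≤ n)
    (g : MetricField n) (hg : IsLorentzMetric g) (ℓ : VecField n)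
    (F : TensorField n p) (hF : IsFormField F)
    (hN : IsTypeN g F ℓ) (hLie : ∀ x idx, lieD ℓ F x idx = 0)
    (hK : IsKundt g ℓ) (haff : IsAffinelyParam g ℓ)
    (hWeyl : BoostOrderLE g ℓ (weyl g) (-1))
    (hTRic : BoostOrderLE g ℓ (tracelessRicci g) (-1))
    (hR : ∀ (x : Pt n) (X : Fin n → ℝ), gdot g x X (ℓ x) = 0 →
      (∑ a, X a * pd (fun y => ricciScalar g y) a x) = 0)
    (hMax : MaxwellEqs (Nat.add_sub_cancel' hp) g F) :
    ∀ G : TensorField n p, IsConstructedFrom g F G → IsAlternating G →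
      (∀ x idx, extD F x idx = 0) ∧
      (∀ x idx, extD (hodge (Nat.add_sub_cancel' hp) g G) x idx = 0) := by
  obtain ⟨p', rfl⟩ : ∃ p', p = p' + 1 := Nat.exists_eq_succ_of_ne_zero (NeZero.ne p)
  intro G hG hGA
  refine ⟨hMax.1, ?_⟩
  have B : Bg g ℓ := ⟨hg.ok, hN.1.1, hN.1.2.1, hN.1.2.2, hK.2.2, haff⟩
  have B2 : Bg2 g ℓ := mk_Bg2 hn3 hg B hWeyl hTRic hR
  have hdiv := (hodge_div (Nat.add_sub_cancel' hp) hg.ok (G := F) hF.1 hF.2).mp hMax.2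
  have H : FOK g ℓ F :=
    { good := good_F B hF hN.2.1 hN.2.2 hLie
      alt := alt_of_isAlt hF.2
      hdiv := fun x idx k => divF_slot x (alt_nab hF.1 hF.2 x) idx k (hdiv x)
      hd := hd_of_extD hg.ok hF.2 hMax.1 }
  have hC := isCl_constr B2 H hG
  have sG : Sm (G : Ten n (Fin (p' + 1))) := by
    obtain ⟨J, h⟩ := hC
    exact (h.good1 B2 H.good).1
  refine (hodge_div (Nat.add_sub_cancel' hp) hg.ok sG hGA).mpr fun x j => ?_
  have := div_zero B2 H hC (alt_of_isAlt hGA) x (Fin.cons 0 j) 0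
  simp only [Fin.update_cons_zero] at this
  exact this

end VSI
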